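/- Let 1 < p < ∞. There exists a constant C > 0 such that for every u ∈ C_0^∞((-1,1) × ℝ^2) satisfying ∂_t u(t,x,y) + (1+e^t) ∂_{xx}^2 u(t,x,y) + t ∂_{xy}^2 u(t,x,y) + t^2 ∂_{yy}^2 u(t,x,y) + y ∂_y u(t,x,y) = f(t,x,y) on ℝ^3, one has ‖∂_{xx}^2 u‖_{L^p(ℝ^3)} ≤ C ‖f‖_{L^p(ℝ^3)}. -/

import Mathlib

open MeasureTheory ENNReal

/-- `∂ₜ u` for `u : ℝ × ℝ × ℝ → ℝ`, `(t,x,y) ↦ u(t,x,y)`. -/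
noncomputable def pt3 (u : ℝ × ℝ × ℝ → ℝ) (z : ℝ × ℝ × ℝ) : ℝ :=
  deriv (fun s => u (s, z.2.1, z.2.2)) z.1

/-- `∂ₓ u` for `u : ℝ × ℝ × ℝ → ℝ`. -/
noncomputable def px3 (u : ℝ × ℝ × ℝ → ℝ) (z : ℝ × ℝ × ℝ) : ℝ :=
  deriv (fun a => u (z.1, a, z.2.2)) z.2.1

/-- `∂_y u` for `u : ℝ × ℝ × ℝ → ℝ`. -/
noncomputable def py3 (u : ℝ × ℝ × ℝ → ℝ) (z : ℝ × ℝ × ℝ) : ℝ :=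
  deriv (fun b => u (z.1, z.2.1, b)) z.2.2

/-- Parabolic box of spatial side `l` (temporal side `l ^ 2`) with lower corner `c`. -/
def pbox (c : ℝ × ℝ) (l : ℝ) : Set (ℝ × ℝ) :=
  Set.Ico c.1 (c.1 + l ^ 2) ×ˢ Set.Ico c.2 (c.2 + l)

lemma measurableSet_pbox (c : ℝ × ℝ) (l : ℝ) : MeasurableSet (pbox c l) :=
  measurableSet_Ico.prod measurableSet_Ico

lemma mem_pbox {c : ℝ × ℝ} {l : ℝ} {z : ℝ × ℝ} :
    z ∈ pbox c l ↔ (c.1 ≤ z.1 ∧ z.1 < c.1 + l ^ 2) ∧ c.2 ≤ z.2 ∧ z.2 < c.2 + l := by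
  simp [pbox, Set.mem_prod]

lemma volume_pbox (c : ℝ × ℝ) (l : ℝ) :
    volume (pbox c l) = ENNReal.ofReal (l ^ 3) := by
  rw [pbox, Measure.volume_eq_prod, Measure.prod_prod, Real.volume_Ico, Real.volume_Ico,
    ← ENNReal.ofReal_mul (by nlinarith [sq_nonneg l])]
  congr 1; ring

lemma volume_real_pbox (c : ℝ × ℝ) {l : ℝ} (hl : 0 ≤ l) :
    volume.real (pbox c l) = l ^ 3 := by
  rw [Measure.real, volume_pbox c l, ENNReal.toReal_ofReal (by positivity)]

/-- Lower corner of the child box with index `i`. -/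
noncomputable def pchild (c : ℝ × ℝ) (l : ℝ) (i : Fin 4 × Fin 2) : ℝ × ℝ :=
  (c.1 + (i.1 : ℕ) * (l / 2) ^ 2, c.2 + (i.2 : ℕ) * (l / 2))

lemma pchild_subset (c : ℝ × ℝ) {l : ℝ} (hl : 0 < l) (i : Fin 4 × Fin 2) :
    pbox (pchild c l i) (l / 2) ⊆ pbox c l := by
  obtain ⟨i, j⟩ := i
  intro z hz
  rw [mem_pbox] at hz ⊢
  have h1 : ((i : ℕ) : ℝ) ≤ 3 := by exact_mod_cast (by omega : (i : ℕ) ≤ 3)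
  have h2 : ((j : ℕ) : ℝ) ≤ 1 := by exact_mod_cast (by omega : (j : ℕ) ≤ 1)
  have h3 : (0 : ℝ) ≤ (i : ℕ) := by positivity
  have h4 : (0 : ℝ) ≤ (j : ℕ) := by positivity
  simp only [pchild] at hz
  obtain ⟨⟨a, b⟩, d, e⟩ := hz
  have h5 : 0 < (l / 2) ^ 2 := by positivity
  refine ⟨⟨?_, ?_⟩, ?_, ?_⟩ <;> nlinarith

lemma exists_mem_pchild (c : ℝ × ℝ) {l : ℝ} (hl : 0 < l) {z : ℝ × ℝ} (hz : z ∈ pbox c l) :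
    ∃ i, z ∈ pbox (pchild c l i) (l / 2) := by
  rw [mem_pbox] at hz
  obtain ⟨⟨a, b⟩, d, e⟩ := hz
  have h5 : 0 < (l / 2) ^ 2 := by positivity
  have key : ∀ (n : ℕ) (s x : ℝ), 0 < s → 0 ≤ x → x < n * s →
      ∃ i : Fin n, ((i : ℕ) : ℝ) * s ≤ x ∧ x < (i : ℕ) * s + s := by
    intro n s x hs hx hxn
    have h0 : 0 ≤ x / s := by positivity
    refine ⟨⟨⌊x / s⌋₊, ?_⟩, ?_, ?_⟩
    · rw [Nat.floor_lt h0, div_lt_iff₀ hs]; exact hxn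
    · have := Nat.floor_le h0
      rwa [le_div_iff₀ hs] at this
    · have := Nat.lt_floor_add_one (x / s)
      rw [div_lt_iff₀ hs] at this
      simp only; linarith
  obtain ⟨i, hi1, hi2⟩ := key 4 ((l / 2) ^ 2) (z.1 - c.1) h5 (by linarith) (by push_cast; nlinarith)
  obtain ⟨j, hj1, hj2⟩ := key 2 (l / 2) (z.2 - c.2) (by linarith) (by linarith)
    (by push_cast; linarith)
  refine ⟨(i, j), ?_⟩
  rw [mem_pbox]
  simp only [pchild]
  refine ⟨⟨?_, ?_⟩, ?_, ?_⟩ <;> linarith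

lemma disjoint_pchild (c : ℝ × ℝ) {l : ℝ} (hl : 0 < l) {i j : Fin 4 × Fin 2} (hij : i ≠ j) :
    Disjoint (pbox (pchild c l i) (l / 2)) (pbox (pchild c l j) (l / 2)) := by
  rw [Set.disjoint_left]
  intro z hz hz'
  apply hij
  rw [mem_pbox] at hz hz'
  simp only [pchild] at hz hz'
  obtain ⟨⟨a, b⟩, d, e⟩ := hz
  obtain ⟨⟨a', b'⟩, d', e'⟩ := hz'
  have h5 : 0 < (l / 2) ^ 2 := by positivity
  have key : ∀ (m n : ℕ) (s x : ℝ), 0 < s → x < m * s + s → n * s ≤ x → n ≤ m := by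
    intro m n s x hs h1 h2
    have : (n : ℝ) * s < (m + 1) * s := by linarith
    have := lt_of_mul_lt_mul_right this hs.le
    have : n < m + 1 := by exact_mod_cast this
    omega
  have e1 : (i.1 : ℕ) = j.1 := le_antisymm
    (key _ _ _ (z.1 - c.1) h5 (by linarith) (by linarith))
    (key _ _ _ (z.1 - c.1) h5 (by linarith) (by linarith))
  have e2 : (i.2 : ℕ) = j.2 := le_antisymm
    (key _ _ (l / 2) (z.2 - c.2) (by linarith) (by linarith) (by linarith))
    (key _ _ (l / 2) (z.2 - c.2) (by linarith) (by linarith) (by linarith))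
  exact Prod.ext (Fin.ext e1) (Fin.ext e2)

/-- The finite family `S` of parabolic boxes is a Calderón–Zygmund family for `f` at height `a`
inside `pbox c l`. -/
structure IsCZFamily (f : ℝ × ℝ → ℝ) (a : ℝ) (c : ℝ × ℝ) (l : ℝ)
    (S : Finset ((ℝ × ℝ) × ℝ)) : Prop where
  pos : ∀ q ∈ S, 0 < q.2
  subset : ∀ q ∈ S, pbox q.1 q.2 ⊆ pbox c l
  lower : ∀ q ∈ S, a * q.2 ^ 3 ≤ ∫ z in pbox q.1 q.2, |f z|
  upper : ∀ q ∈ S, ∫ z in pbox q.1 q.2, |f z| ≤ 8 * a * q.2 ^ 3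
  disj : (S : Set ((ℝ × ℝ) × ℝ)).PairwiseDisjoint fun q => pbox q.1 q.2
  bound : ∀ z ∈ pbox c l, (∀ q ∈ S, z ∉ pbox q.1 q.2) → |f z| ≤ 2 * a

lemma exists_isCZFamily {f : ℝ × ℝ → ℝ} (hf : Integrable f) {a : ℝ} (n : ℕ) :
    ∀ (c : ℝ × ℝ) (l : ℝ), 0 < l →
      (∀ z w : ℝ × ℝ, |z.1 - w.1| ≤ (l / 2 ^ n) ^ 2 → |z.2 - w.2| ≤ l / 2 ^ n →
        |f z - f w| ≤ a) →
      ∫ z in pbox c l, |f z| ≤ a * l ^ 3 → ∃ S, IsCZFamily f a c l S := by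
  classical
  induction n with
  | zero =>
    intro c l hl hosc havg
    refine ⟨∅, by simp, by simp, by simp, by simp, by simp, ?_⟩
    intro z hz _
    by_contra! hcon
    have h1 : ∀ w ∈ pbox c l, |f z| - a ≤ |f w| := by
      intro w hw
      rw [mem_pbox] at hz hw
      have := hosc z w (by rw [abs_le]; simp; constructor <;> linarith [hz.1.1, hz.1.2, hw.1.1, hw.1.2])
        (by rw [abs_le]; simp; constructor <;> linarith [hz.2.1, hz.2.2, hw.2.1, hw.2.2])
      have := abs_sub_abs_le_abs_sub (f z) (f w)
      linarith
    have hfin : volume (pbox c l) ≠ ⊤ := by rw [volume_pbox c l]; exact ENNReal.ofReal_ne_top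
    have h2 : ∫ w in pbox c l, (|f z| - a) ≤ ∫ w in pbox c l, |f w| :=
      setIntegral_mono_on (integrableOn_const hfin (by simp)) hf.abs.integrableOn
        (measurableSet_pbox c l) h1
    rw [setIntegral_const, volume_real_pbox c hl.le, smul_eq_mul] at h2
    have : 0 < l ^ 3 := by positivity
    nlinarith
  | succ n ih =>
    intro c l hl hosc havg
    have hchild : ∀ i, ∃ S, IsCZFamily f a (pchild c l i) (l / 2) S := by
      intro i
      by_cases h : ∫ z in pbox (pchild c l i) (l / 2), |f z| ≤ a * (l / 2) ^ 3
      · refine ih _ _ (by linarith) ?_ h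
        intro z w h1 h2
        have : l / 2 / 2 ^ n = l / 2 ^ (n + 1) := by rw [pow_succ]; field_simp
        rw [this] at h1 h2
        exact hosc z w h1 h2
      · refine ⟨{(pchild c l i, l / 2)}, ?_, ?_, ?_, ?_, by simp, ?_⟩
        · simp [hl]
        · simp
        · simp only [Finset.mem_singleton, forall_eq]; exact (not_le.1 h).le
        · simp only [Finset.mem_singleton, forall_eq]
          have := setIntegral_mono_set hf.abs.integrableOn (s := pbox (pchild c l i) (l / 2))
            (t := pbox c l) (Filter.Eventually.of_forall fun z => abs_nonneg _)
            (pchild_subset c hl i).eventuallyLE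
          nlinarith
        · intro z hz h; simp at h; exact absurd hz h
    choose S hS using hchild
    refine ⟨Finset.univ.biUnion S, ?_, ?_, ?_, ?_, ?_, ?_⟩
    · intro q hq; simp only [Finset.mem_biUnion, Finset.mem_univ, true_and] at hq
      obtain ⟨i, hi⟩ := hq; exact (hS i).pos q hi
    · intro q hq; simp only [Finset.mem_biUnion, Finset.mem_univ, true_and] at hq
      obtain ⟨i, hi⟩ := hq; exact ((hS i).subset q hi).trans (pchild_subset c hl i)
    · intro q hq; simp only [Finset.mem_biUnion, Finset.mem_univ, true_and] at hq
      obtain ⟨i, hi⟩ := hq; exact (hS i).lower q hi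
    · intro q hq; simp only [Finset.mem_biUnion, Finset.mem_univ, true_and] at hq
      obtain ⟨i, hi⟩ := hq; exact (hS i).upper q hi
    · intro q hq q' hq' hne
      simp only [Finset.coe_biUnion, Finset.coe_univ, Set.mem_univ, Set.iUnion_true,
        Set.mem_iUnion, Finset.mem_coe] at hq hq'
      obtain ⟨i, hi⟩ := hq
      obtain ⟨j, hj⟩ := hq'
      by_cases hij : i = j
      · subst hij; exact (hS i).disj hi hj hne
      · exact (disjoint_pchild c hl hij).mono ((hS i).subset q hi) ((hS j).subset q' hj)
    · intro z hz h
      obtain ⟨i, hi⟩ := exists_mem_pchild c hl hz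
      exact (hS i).bound z hi fun q hq => h q (by
        simp only [Finset.mem_biUnion, Finset.mem_univ, true_and]; exact ⟨i, hq⟩)

/-- The operator with kernel `K (w - z)`. -/
noncomputable def czop (K f : ℝ × ℝ → ℝ) (z : ℝ × ℝ) : ℝ := ∫ w, K (w - z) * f w

/-- Dilated parabolic box around the origin. -/
def bigBox (l : ℝ) : Set (ℝ × ℝ) := Set.Icc (-(16 * l ^ 2)) (16 * l ^ 2) ×ˢ Set.Icc (-(4 * l)) (4 * l)

/-- Truncated parabolic Calderón–Zygmund kernels with constant `A`. -/
structure IsCZKernel (K : ℝ × ℝ → ℝ) (A : ℝ) : Prop where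
  measurable : Measurable K
  bdd : ∃ M, ∀ z, ‖K z‖ ≤ M
  integrable : Integrable K
  pos : 0 < A
  l2 : ∀ g : ℝ × ℝ → ℝ, Measurable g → Integrable g → (∃ M, ∀ z, ‖g z‖ ≤ M) →
    ∫⁻ z, ‖czop K g z‖ₑ ^ 2 ≤ ENNReal.ofReal A * ∫⁻ z, ‖g z‖ₑ ^ 2
  hormander : ∀ l : ℝ, 0 < l → ∀ h : ℝ × ℝ, 0 ≤ h.1 → h.1 < l ^ 2 → 0 ≤ h.2 → h.2 < l →
    ∫⁻ z in (bigBox l)ᶜ, ‖K (h + z) - K z‖ₑ ≤ ENNReal.ofReal A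

section calderonZygmund

variable {K : ℝ × ℝ → ℝ} {A : ℝ}

lemma measurableSet_bigBox (l : ℝ) : MeasurableSet (bigBox l) :=
  measurableSet_Icc.prod measurableSet_Icc

lemma volume_bigBox {l : ℝ} : volume (bigBox l) = ENNReal.ofReal (256 * l ^ 3) := by
  rw [bigBox, Measure.volume_eq_prod, Measure.prod_prod, Real.volume_Icc, Real.volume_Icc,
    ← ENNReal.ofReal_mul (by nlinarith [sq_nonneg l])]
  congr 1; ring

lemma IsCZKernel.integrable_mul (hK : IsCZKernel K A) {f : ℝ × ℝ → ℝ} (hf : Integrable f)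
    (z : ℝ × ℝ) : Integrable fun w => K (w - z) * f w := by
  obtain ⟨M, hM⟩ := hK.bdd
  exact hf.bdd_mul (c := M) (hK.measurable.comp (measurable_id.sub_const z)).aestronglyMeasurable
    (Filter.Eventually.of_forall fun w => hM _)

lemma IsCZKernel.measurable_czop (hK : IsCZKernel K A) {f : ℝ × ℝ → ℝ} (hf : Measurable f) :
    Measurable (czop K f) := by
  have : StronglyMeasurable (Function.uncurry fun z w : ℝ × ℝ => K (w - z) * f w) :=
    ((hK.measurable.comp (measurable_snd.sub measurable_fst)).mul
      (hf.comp measurable_snd)).stronglyMeasurable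
  exact this.integral_prod_right.measurable

lemma IsCZKernel.czop_sub (hK : IsCZKernel K A) {f g : ℝ × ℝ → ℝ} (hf : Integrable f)
    (hg : Integrable g) (z : ℝ × ℝ) :
    czop K (fun w => f w - g w) z = czop K f z - czop K g z := by
  simp only [czop, mul_sub]
  exact integral_sub (hK.integrable_mul hf z) (hK.integrable_mul hg z)

lemma IsCZKernel.czop_sum (hK : IsCZKernel K A) {ι : Type*} (S : Finset ι)
    {f : ι → ℝ × ℝ → ℝ} (hf : ∀ i ∈ S, Integrable (f i)) (z : ℝ × ℝ) :
    czop K (fun w => ∑ i ∈ S, f i w) z = ∑ i ∈ S, czop K (f i) z := by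
  simp only [czop, Finset.mul_sum]
  exact integral_finsetSum S fun i hi => hK.integrable_mul (hf i hi) z

lemma IsCZKernel.lintegral_czop_le (hK : IsCZKernel K A) {b : ℝ × ℝ → ℝ} (hbm : Measurable b)
    (hb : Integrable b) {c : ℝ × ℝ} {l : ℝ} (hl : 0 < l) (hsupp : ∀ z, z ∉ pbox c l → b z = 0)
    (h0 : ∫ z, b z = 0) :
    ∫⁻ z in (fun z => c - z) ⁻¹' (bigBox l)ᶜ, ‖czop K b z‖ₑ
      ≤ ENNReal.ofReal A * ∫⁻ z, ‖b z‖ₑ := by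
  set s := (fun z => c - z) ⁻¹' (bigBox l)ᶜ with hs
  have h1 : ∀ z, ‖czop K b z‖ₑ ≤ ∫⁻ w, ‖K (w - z) - K (c - z)‖ₑ * ‖b w‖ₑ := by
    intro z
    have : czop K b z = ∫ w, (K (w - z) - K (c - z)) * b w := by
      simp only [sub_mul]
      rw [integral_sub (hK.integrable_mul hb z) (hb.const_mul _), integral_const_mul, h0]
      simp [czop]
    rw [this]
    refine (enorm_integral_le_lintegral_enorm _).trans (le_of_eq ?_)
    simp only [enorm_mul]
  have hm : Measurable (Function.uncurry fun z w : ℝ × ℝ => ‖K (w - z) - K (c - z)‖ₑ * ‖b w‖ₑ) := by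
    have := hK.measurable
    have e1 : Measurable fun x : (ℝ × ℝ) × (ℝ × ℝ) => K (x.2 - x.1) :=
      this.comp (measurable_snd.sub measurable_fst)
    have e2 : Measurable fun x : (ℝ × ℝ) × (ℝ × ℝ) => K (c - x.1) :=
      this.comp (measurable_const.sub measurable_fst)
    exact (e1.sub e2).enorm.mul (hbm.comp measurable_snd).enorm
  calc ∫⁻ z in s, ‖czop K b z‖ₑ
      ≤ ∫⁻ z in s, ∫⁻ w, ‖K (w - z) - K (c - z)‖ₑ * ‖b w‖ₑ := lintegral_mono h1
    _ = ∫⁻ w, ∫⁻ z in s, ‖K (w - z) - K (c - z)‖ₑ * ‖b w‖ₑ :=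
        lintegral_lintegral_swap hm.aemeasurable
    _ ≤ ∫⁻ w, ENNReal.ofReal A * ‖b w‖ₑ := by
        refine lintegral_mono fun w => ?_
        by_cases hw : w ∈ pbox c l
        · rw [lintegral_mul_const]
          · gcongr
            have hp := (Measure.measurePreserving_sub_left (volume : Measure (ℝ × ℝ)) c)
            have h2 := hp.setLIntegral_comp_preimage (measurableSet_bigBox l).compl
              (f := fun z => ‖K ((w - c) + z) - K z‖ₑ)
              ((hK.measurable.comp (measurable_const.add measurable_id)).sub hK.measurable).enorm
            have h3 : ∀ z, w - c + (c - z) = w - z := fun z => by abel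
            simp only [h3] at h2
            rw [h2]
            rw [mem_pbox] at hw
            exact hK.hormander l hl _ (by simp; linarith) (by simp; linarith) (by simp; linarith)
              (by simp; linarith)
          · exact ((hK.measurable.comp (measurable_const.sub measurable_id)).sub
              (hK.measurable.comp (measurable_const.sub measurable_id))).enorm
        · simp [hsupp w hw]
    _ = ENNReal.ofReal A * ∫⁻ z, ‖b z‖ₑ := lintegral_const_mul _ hbm.enorm

/-- Weak type `(1, 1)` bound. -/
lemma IsCZKernel.weak_type (hK : IsCZKernel K A) {f : ℝ × ℝ → ℝ} (hc : Continuous f)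
    (hs : HasCompactSupport f) {a : ℝ} (ha : 0 < a) :
    volume {z | 2 * a < |czop K f z|}
      ≤ ENNReal.ofReal ((26 * A + 256) / a) * ∫⁻ z, ‖f z‖ₑ := by
  classical
  have hf : Integrable f := hc.integrable_of_hasCompactSupport hs
  set F := ∫ z, |f z| with hF
  have hFl : ∫⁻ z, ‖f z‖ₑ = ENNReal.ofReal F :=
    (ofReal_integral_norm_eq_lintegral_enorm hf).symm
  have hF0 : 0 ≤ F := integral_nonneg fun _ => abs_nonneg _
  have hA := hK.pos
  -- the initial box
  obtain ⟨R, hR⟩ : ∃ R : ℝ, ∀ z, f z ≠ 0 → |z.1| < R ∧ |z.2| < R := by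
    obtain ⟨R, hR⟩ := hs.isCompact.isBounded.subset_ball 0
    refine ⟨R, fun z hz => ?_⟩
    have := hR (subset_tsupport f hz)
    rw [mem_ball_zero_iff, Prod.norm_def, max_lt_iff] at this
    exact this
  obtain ⟨l, hl1, hlR, hlF⟩ : ∃ l : ℝ, 1 ≤ l ∧ 2 * R ≤ l ∧ F / a ≤ l :=
    ⟨max 1 (max (2 * R) (F / a)), by simp, by simp, by simp⟩
  have hl : 0 < l := by linarith
  set c : ℝ × ℝ := (-(l ^ 2 / 2), -(l / 2)) with hcdef
  have hin : ∀ z, z ∉ pbox c l → f z = 0 := by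
    intro z hz
    by_contra h
    apply hz
    obtain ⟨h1, h2⟩ := hR z h
    rw [abs_lt] at h1 h2
    rw [mem_pbox]
    simp only [hcdef]
    refine ⟨⟨?_, ?_⟩, ?_, ?_⟩ <;> nlinarith
  have havg : ∫ z in pbox c l, |f z| ≤ a * l ^ 3 := by
    have h1 : ∫ z in pbox c l, |f z| ≤ F :=
      setIntegral_le_integral hf.abs (Filter.Eventually.of_forall fun _ => abs_nonneg _)
    have h2 : F ≤ a * l := by rw [div_le_iff₀ ha] at hlF; linarith
    have h3 : l ≤ l ^ 3 := by nlinarith [sq_nonneg l, mul_pos hl hl]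
    nlinarith
  obtain ⟨n, hn⟩ : ∃ n : ℕ, ∀ z w : ℝ × ℝ, |z.1 - w.1| ≤ (l / 2 ^ n) ^ 2 →
      |z.2 - w.2| ≤ l / 2 ^ n → |f z - f w| ≤ a := by
    have huc := hs.uniformContinuous_of_continuous hc
    rw [Metric.uniformContinuous_iff] at huc
    obtain ⟨δ, hδ, hd⟩ := huc a ha
    obtain ⟨n, hn⟩ := exists_pow_lt_of_lt_one (show 0 < min δ 1 / l by positivity)
      (show (1 / 2 : ℝ) < 1 by norm_num)
    have h1 : l / 2 ^ n < min δ 1 := by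
      rw [lt_div_iff₀ hl] at hn
      calc l / 2 ^ n = (1 / 2) ^ n * l := by rw [one_div, inv_pow]; field_simp
        _ < _ := hn
    have h0 : 0 < l / 2 ^ n := by positivity
    refine ⟨n, fun z w hz hw => ?_⟩
    have h2 := lt_min_iff.1 h1
    have := hd (a := z) (b := w) (by
      rw [Prod.dist_eq, max_lt_iff, Real.dist_eq, Real.dist_eq]
      exact ⟨by nlinarith, by linarith⟩)
    rw [Real.dist_eq] at this
    exact this.le
  obtain ⟨S, hS⟩ := exists_isCZFamily hf n c l hl hn havg
  -- good and bad parts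
  set avg : (ℝ × ℝ) × ℝ → ℝ := fun q => (∫ z in pbox q.1 q.2, f z) / q.2 ^ 3 with havgdef
  set b : (ℝ × ℝ) × ℝ → ℝ × ℝ → ℝ := fun q =>
    (pbox q.1 q.2).indicator fun z => f z - avg q with hb
  set g : ℝ × ℝ → ℝ := fun z => f z - ∑ q ∈ S, b q z with hg
  have hIq : ∀ q ∈ S, IntegrableOn (fun z => f z - avg q) (pbox q.1 q.2) := fun q hq =>
    hf.integrableOn.sub (integrableOn_const (by rw [volume_pbox]; exact ENNReal.ofReal_ne_top)
      (by simp))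
  have hbm : ∀ q, Measurable (b q) := fun q =>
    (hc.measurable.sub_const _).indicator (measurableSet_pbox _ _)
  have hbi : ∀ q ∈ S, Integrable (b q) := fun q hq =>
    (integrable_indicator_iff (measurableSet_pbox _ _)).2 (hIq q hq)
  have havgle : ∀ q ∈ S, |avg q| * q.2 ^ 3 ≤ ∫ z in pbox q.1 q.2, |f z| := by
    intro q hq
    have h0 := hS.pos q hq
    have : |avg q| * q.2 ^ 3 = |∫ z in pbox q.1 q.2, f z| := by
      simp only [havgdef, abs_div, abs_of_pos (pow_pos h0 3)]
      field_simp
    rw [this]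
    exact abs_integral_le_integral_abs
  have hb0 : ∀ q ∈ S, ∫ z, b q z = 0 := by
    intro q hq
    have h0 := hS.pos q hq
    simp only [hb]
    rw [integral_indicator (measurableSet_pbox _ _), integral_sub hf.integrableOn
      (integrableOn_const (by rw [volume_pbox]; exact ENNReal.ofReal_ne_top) (by simp)),
      setIntegral_const, volume_real_pbox _ h0.le, smul_eq_mul, havgdef]
    simp only
    field_simp
    ring
  have hb1 : ∀ q ∈ S, ∫ z, |b q z| ≤ 2 * ∫ z in pbox q.1 q.2, |f z| := by
    intro q hq
    have h0 := hS.pos q hq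
    have e : (fun z => |b q z|) = (pbox q.1 q.2).indicator fun z => |f z - avg q| := by
      ext z; simp only [hb, Set.indicator]; split_ifs <;> simp
    rw [e, integral_indicator (measurableSet_pbox _ _)]
    calc ∫ z in pbox q.1 q.2, |f z - avg q|
        ≤ ∫ z in pbox q.1 q.2, (|f z| + |avg q|) :=
          setIntegral_mono (hIq q hq).abs (hf.abs.integrableOn.add (integrableOn_const
            (by rw [volume_pbox]; exact ENNReal.ofReal_ne_top) (by simp))) fun z => abs_sub _ _
      _ = (∫ z in pbox q.1 q.2, |f z|) + |avg q| * q.2 ^ 3 := by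
          rw [integral_add hf.abs.integrableOn (integrableOn_const
            (by rw [volume_pbox]; exact ENNReal.ofReal_ne_top) (by simp)), setIntegral_const,
            volume_real_pbox _ h0.le, smul_eq_mul, mul_comm]
      _ ≤ _ := by linarith [havgle q hq]
  have hsum : ∑ q ∈ S, ∫ z in pbox q.1 q.2, |f z| ≤ F := by
    rw [← integral_biUnion_finset S (fun q _ => measurableSet_pbox _ _) hS.disj
      (fun q _ => hf.abs.integrableOn)]
    exact setIntegral_le_integral hf.abs (Filter.Eventually.of_forall fun _ => abs_nonneg _)
  have hgm : Measurable g := hc.measurable.sub (Finset.measurable_fun_sum S fun q _ => hbm q)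
  have hbsi : Integrable fun z => ∑ q ∈ S, b q z := integrable_finsetSum S hbi
  have hgi : Integrable g := hf.sub hbsi
  have hgb : ∀ z, |g z| ≤ 8 * a := by
    intro z
    by_cases hz : ∃ q ∈ S, z ∈ pbox q.1 q.2
    · obtain ⟨q, hq, hzq⟩ := hz
      have h0 := hS.pos q hq
      have : ∑ q' ∈ S, b q' z = b q z := by
        refine Finset.sum_eq_single_of_mem q hq fun q' hq' hne => ?_
        have := Set.disjoint_left.1 (hS.disj hq hq' hne.symm) hzq
        simp only [hb]
        exact Set.indicator_of_notMem this _
      have e : g z = avg q := by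
        simp only [hg, this]
        simp only [hb, Set.indicator_of_mem hzq]; ring
      rw [e]
      have h1 := havgle q hq
      have h2 := hS.upper q hq
      have h3 : 0 < q.2 ^ 3 := by positivity
      exact le_of_mul_le_mul_right (h1.trans h2) h3
    · push Not at hz
      have : ∑ q' ∈ S, b q' z = 0 := Finset.sum_eq_zero fun q hq =>
        Set.indicator_of_notMem (hz q hq) _
      have e : g z = f z := by simp only [hg, this, sub_zero]
      rw [e]
      by_cases h : z ∈ pbox c l
      · linarith [hS.bound z h hz]
      · rw [hin z h]; simp; exact ha.le
  have hg1 : ∫ z, |g z| ≤ 3 * F := by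
    calc ∫ z, |g z| ≤ ∫ z, (|f z| + ∑ q ∈ S, |b q z|) :=
          integral_mono hgi.abs (hf.abs.add (integrable_finsetSum S fun q hq => (hbi q hq).abs))
            fun z => (abs_sub _ _).trans (by gcongr; exact Finset.abs_sum_le_sum_abs _ _)
      _ = F + ∑ q ∈ S, ∫ z, |b q z| := by
          rw [integral_add hf.abs (integrable_finsetSum S fun q hq => (hbi q hq).abs),
            integral_finsetSum S fun q hq => (hbi q hq).abs]
      _ ≤ F + ∑ q ∈ S, 2 * ∫ z in pbox q.1 q.2, |f z| := by
          gcongr with q hq; exact hb1 q hq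
      _ ≤ 3 * F := by rw [← Finset.mul_sum]; linarith
  -- the good part
  have hgood : volume {z | a < |czop K g z|} ≤ ENNReal.ofReal (24 * A / a * F) := by
    have h1 : ∫⁻ z, ‖czop K g z‖ₑ ^ 2 ≤ ENNReal.ofReal (A * (24 * a * F)) := by
      refine (hK.l2 g hgm hgi ⟨8 * a, hgb⟩).trans ?_
      rw [ENNReal.ofReal_mul hA.le]
      gcongr
      calc ∫⁻ z, ‖g z‖ₑ ^ 2 ≤ ∫⁻ z, ENNReal.ofReal (8 * a) * ‖g z‖ₑ := by
            refine lintegral_mono fun z => ?_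
            rw [pow_two]
            gcongr
            rw [← ofReal_norm]
            exact ENNReal.ofReal_le_ofReal (hgb z)
        _ = ENNReal.ofReal (8 * a) * ENNReal.ofReal (∫ z, |g z|) := by
            rw [lintegral_const_mul _ hgm.enorm,
              ← ofReal_integral_norm_eq_lintegral_enorm hgi]
            rfl
        _ ≤ ENNReal.ofReal (8 * a) * ENNReal.ofReal (3 * F) := by gcongr
        _ = _ := by rw [← ENNReal.ofReal_mul (by positivity)]; congr 1; ring
    have h2 := mul_meas_ge_le_lintegral₀ (μ := (volume : Measure (ℝ × ℝ)))
      ((hK.measurable_czop hgm).enorm.pow_const 2).aemeasurable (ENNReal.ofReal (a ^ 2))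
    have h3 : {z | a < |czop K g z|} ⊆ {z | ENNReal.ofReal (a ^ 2) ≤ ‖czop K g z‖ₑ ^ 2} := by
      intro z hz
      simp only [Set.mem_ofPred_eq] at hz ⊢
      rw [← ofReal_norm, ← ENNReal.ofReal_pow (norm_nonneg _)]
      apply ENNReal.ofReal_le_ofReal
      rw [Real.norm_eq_abs]
      gcongr
    have h4 : ENNReal.ofReal (a ^ 2) ≠ 0 := by simp; positivity
    calc volume {z | a < |czop K g z|} ≤ _ := measure_mono h3
      _ ≤ ENNReal.ofReal (A * (24 * a * F)) / ENNReal.ofReal (a ^ 2) := by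
          rw [ENNReal.le_div_iff_mul_le (Or.inl h4) (Or.inl ENNReal.ofReal_ne_top), mul_comm]
          exact h2.trans h1
      _ = _ := by
          rw [← ENNReal.ofReal_div_of_pos (by positivity)]; congr 1; field_simp
  -- the bad part
  set B : ℝ × ℝ → ℝ := fun z => ∑ q ∈ S, czop K (b q) z with hB
  set Qs : (ℝ × ℝ) × ℝ → Set (ℝ × ℝ) := fun q => (fun z => q.1 - z) ⁻¹' bigBox q.2 with hQs
  have hQv : ∀ q ∈ S, volume (Qs q) ≤ ENNReal.ofReal (256 / a * ∫ z in pbox q.1 q.2, |f z|) := by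
    intro q hq
    rw [hQs, (Measure.measurePreserving_sub_left (volume : Measure (ℝ × ℝ)) q.1).measure_preimage
      (measurableSet_bigBox _).nullMeasurableSet, volume_bigBox]
    apply ENNReal.ofReal_le_ofReal
    have := hS.lower q hq
    rw [div_mul_eq_mul_div, le_div_iff₀ ha]; linarith
  have hcm : ∀ q, Measurable (czop K (b q)) := fun q => hK.measurable_czop (hbm q)
  have hbad : volume ({z | a < |B z|} \ ⋃ q ∈ S, Qs q) ≤ ENNReal.ofReal (2 * A / a * F) := by
    set U := (⋃ q ∈ S, Qs q)ᶜ with hU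
    have hQm : ∀ q, MeasurableSet (Qs q) := fun q =>
      (measurable_const.sub measurable_id) (measurableSet_bigBox _)
    have hUm : MeasurableSet U := (Finset.measurableSet_biUnion S fun q _ => hQm q).compl
    have h1 : ∫⁻ z in U, ‖B z‖ₑ ≤ ENNReal.ofReal (2 * A * F) := by
      calc ∫⁻ z in U, ‖B z‖ₑ ≤ ∫⁻ z in U, ∑ q ∈ S, ‖czop K (b q) z‖ₑ :=
            lintegral_mono fun z => enorm_sum_le _ _
        _ = ∑ q ∈ S, ∫⁻ z in U, ‖czop K (b q) z‖ₑ :=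
            lintegral_finsetSum S fun q _ => (hcm q).enorm
        _ ≤ ∑ q ∈ S, ENNReal.ofReal (2 * A * ∫ z in pbox q.1 q.2, |f z|) := by
            refine Finset.sum_le_sum fun q hq => ?_
            have hsub : U ⊆ (fun z => q.1 - z) ⁻¹' (bigBox q.2)ᶜ := by
              rw [Set.preimage_compl, hU, Set.compl_subset_compl]
              exact Set.subset_biUnion_of_mem (u := Qs) hq
            refine (lintegral_mono_set hsub).trans ((hK.lintegral_czop_le (hbm q) (hbi q hq)
              (hS.pos q hq) (fun z hz => Set.indicator_of_notMem hz _) (hb0 q hq)).trans ?_)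
            rw [← ofReal_integral_norm_eq_lintegral_enorm (hbi q hq), ← ENNReal.ofReal_mul hA.le]
            apply ENNReal.ofReal_le_ofReal
            have := hb1 q hq
            simp only [Real.norm_eq_abs]
            nlinarith
        _ = ENNReal.ofReal (2 * A * ∑ q ∈ S, ∫ z in pbox q.1 q.2, |f z|) := by
            rw [Finset.mul_sum, ENNReal.ofReal_sum_of_nonneg]
            intro q hq
            have : 0 ≤ ∫ z in pbox q.1 q.2, |f z| := integral_nonneg fun _ => abs_nonneg _
            positivity
        _ ≤ _ := by apply ENNReal.ofReal_le_ofReal; gcongr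
    have hBm : Measurable B := Finset.measurable_fun_sum S fun q _ => hcm q
    have h2 := mul_meas_ge_le_lintegral₀ (μ := (volume : Measure (ℝ × ℝ)).restrict U)
      hBm.enorm.aemeasurable (ENNReal.ofReal a)
    have h3 : {z | a < |B z|} \ ⋃ q ∈ S, Qs q ⊆ {z | ENNReal.ofReal a ≤ ‖B z‖ₑ} ∩ U := by
      intro z hz
      refine ⟨?_, hz.2⟩
      have := hz.1
      simp only [Set.mem_ofPred_eq] at this ⊢
      rw [← ofReal_norm]
      exact ENNReal.ofReal_le_ofReal this.le
    have h4 : ENNReal.ofReal a ≠ 0 := by simpa using ha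
    rw [Measure.restrict_apply' hUm] at h2
    calc _ ≤ _ := measure_mono h3
      _ ≤ ENNReal.ofReal (2 * A * F) / ENNReal.ofReal a := by
          rw [ENNReal.le_div_iff_mul_le (Or.inl h4) (Or.inl ENNReal.ofReal_ne_top), mul_comm]
          exact h2.trans h1
      _ = _ := by
          rw [← ENNReal.ofReal_div_of_pos ha]; congr 1; field_simp
  have hQU : volume (⋃ q ∈ S, Qs q) ≤ ENNReal.ofReal (256 / a * F) := by
    refine (measure_biUnion_finset_le S Qs).trans ((Finset.sum_le_sum hQv).trans ?_)
    rw [← ENNReal.ofReal_sum_of_nonneg]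
    · apply ENNReal.ofReal_le_ofReal
      rw [← Finset.mul_sum]
      gcongr
    · intro q hq
      have : 0 ≤ ∫ z in pbox q.1 q.2, |f z| := integral_nonneg fun _ => abs_nonneg _
      positivity
  have hsplit : ∀ z, czop K f z = czop K g z + B z := by
    intro z
    have h1 := hK.czop_sub hf hbsi z
    rw [hK.czop_sum S hbi] at h1
    have h2 : czop K g z = czop K f z - B z := h1
    rw [h2]; ring
  have hcover : {z | 2 * a < |czop K f z|} ⊆ {z | a < |czop K g z|} ∪
      (({z | a < |B z|} \ ⋃ q ∈ S, Qs q) ∪ ⋃ q ∈ S, Qs q) := by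
    intro z hz
    simp only [Set.mem_ofPred_eq] at hz
    rw [hsplit] at hz
    have h1 := abs_add_le (czop K g z) (B z)
    by_cases h2 : a < |czop K g z|
    · exact Or.inl h2
    · right
      by_cases h3 : z ∈ ⋃ q ∈ S, Qs q
      · exact Or.inr h3
      · exact Or.inl ⟨by simp only [Set.mem_ofPred_eq]; linarith, h3⟩
  rw [hFl, ← ENNReal.ofReal_mul (by positivity)]
  calc _ ≤ _ := measure_mono hcover
    _ ≤ ENNReal.ofReal (24 * A / a * F) + (ENNReal.ofReal (2 * A / a * F)
        + ENNReal.ofReal (256 / a * F)) :=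
      (measure_union_le _ _).trans (add_le_add hgood ((measure_union_le _ _).trans
        (add_le_add hbad hQU)))
    _ = _ := by
      rw [← ENNReal.ofReal_add (by positivity) (by positivity),
        ← ENNReal.ofReal_add (by positivity) (by positivity)]
      congr 1; field_simp; ring

lemma IsCZKernel.meas_le (hK : IsCZKernel K A) {f : ℝ × ℝ → ℝ} (hc : Continuous f)
    (hs : HasCompactSupport f) {a : ℝ} (ha : 0 < a) :
    volume {z | 3 * a < |czop K f z|}
      ≤ ENNReal.ofReal ((27 * A + 256) / a) * (∫⁻ z, {z | a < |f z|}.indicator (‖f ·‖ₑ) z)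
        + ENNReal.ofReal (A / a ^ 2) *
          ∫⁻ z, {z | a < |f z|}ᶜ.indicator (fun z => ‖f z‖ₑ ^ 2) z := by
  have hA := hK.pos
  set f₂ : ℝ × ℝ → ℝ := fun z => max (-a) (min (f z) a) with hf₂
  set f₁ : ℝ × ℝ → ℝ := fun z => f z - f₂ z with hf₁
  have hc₂ : Continuous f₂ := by fun_prop
  have hc₁ : Continuous f₁ := by fun_prop
  have hs₂ : HasCompactSupport f₂ := hs.comp_left (g := fun x => max (-a) (min x a)) (by simp [ha.le])
  have hs₁ : HasCompactSupport f₁ := hs.comp_left (g := fun x => x - max (-a) (min x a))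
    (by simp [ha.le])
  have hf := hc.integrable_of_hasCompactSupport hs (μ := volume)
  have hi₂ := hc₂.integrable_of_hasCompactSupport hs₂ (μ := volume)
  have hi₁ := hc₁.integrable_of_hasCompactSupport hs₁ (μ := volume)
  have hE : MeasurableSet {z | a < |f z|} := measurableSet_lt measurable_const hc.abs.measurable
  have hb₂ : ∀ z, |f₂ z| ≤ a := fun z => by
    rw [abs_le]; exact ⟨le_max_left _ _, max_le (by linarith) (min_le_right _ _)⟩
  have hsm : ∀ z, |f z| ≤ a → f₂ z = f z := fun z hz => by
    rw [abs_le] at hz; simp only [hf₂]; rw [min_eq_left hz.2, max_eq_right hz.1]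
  have hb₂' : ∀ z, |f₂ z| ≤ |f z| := fun z => by
    by_cases hz : |f z| ≤ a
    · rw [hsm z hz]
    · linarith [hb₂ z]
  have hb₁ : ∀ z, |f₁ z| ≤ |f z| := fun z => by
    simp only [hf₁, hf₂]
    rcases max_cases (-a) (min (f z) a) with h | h <;> rcases min_cases (f z) a with h' | h' <;>
      cases abs_cases (f z) <;> rw [abs_le] <;> constructor <;> linarith
  have h₁ : volume {z | 2 * a < |czop K f₁ z|}
      ≤ ENNReal.ofReal ((26 * A + 256) / a) * ∫⁻ z, {z | a < |f z|}.indicator (‖f ·‖ₑ) z := by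
    refine (hK.weak_type hc₁ hs₁ ha).trans ?_
    gcongr with z
    by_cases hz : a < |f z|
    · rw [Set.indicator_of_mem (by exact hz)]
      exact enorm_le_iff_norm_le.2 (hb₁ z)
    · rw [Set.indicator_of_notMem (by exact hz)]
      simp [hf₁, hsm z (not_lt.1 hz)]
  have h₂ : volume {z | a < |czop K f₂ z|} ≤ ENNReal.ofReal (A / a ^ 2) * ∫⁻ z, ‖f₂ z‖ₑ ^ 2 := by
    have h2 := mul_meas_ge_le_lintegral₀ (μ := (volume : Measure (ℝ × ℝ)))
      ((hK.measurable_czop hc₂.measurable).enorm.pow_const 2).aemeasurable (ENNReal.ofReal (a ^ 2))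
    have h3 : {z | a < |czop K f₂ z|} ⊆ {z | ENNReal.ofReal (a ^ 2) ≤ ‖czop K f₂ z‖ₑ ^ 2} := by
      intro z hz
      simp only [Set.mem_ofPred_eq] at hz ⊢
      rw [← ofReal_norm, ← ENNReal.ofReal_pow (norm_nonneg _)]
      apply ENNReal.ofReal_le_ofReal
      rw [Real.norm_eq_abs]
      gcongr
    have h4 : ENNReal.ofReal (a ^ 2) ≠ 0 := by simp; positivity
    rw [ENNReal.ofReal_div_of_pos (by positivity), ENNReal.mul_comm_div, ← mul_div_assoc,
      ENNReal.le_div_iff_mul_le (Or.inl h4) (Or.inl ENNReal.ofReal_ne_top)]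
    calc _ ≤ ENNReal.ofReal (a ^ 2) * _ := by rw [mul_comm]; gcongr
      _ ≤ _ := h2.trans (hK.l2 f₂ hc₂.measurable hi₂ ⟨a, hb₂⟩)
  have h₃ : ENNReal.ofReal (A / a ^ 2) * ∫⁻ z, ‖f₂ z‖ₑ ^ 2 ≤
      ENNReal.ofReal (A / a) * (∫⁻ z, {z | a < |f z|}.indicator (‖f ·‖ₑ) z)
        + ENNReal.ofReal (A / a ^ 2) *
          ∫⁻ z, {z | a < |f z|}ᶜ.indicator (fun z => ‖f z‖ₑ ^ 2) z := by
    have e : ENNReal.ofReal (A / a) = ENNReal.ofReal (A / a ^ 2) * ENNReal.ofReal a := by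
      rw [← ENNReal.ofReal_mul (by positivity)]; congr 1; field_simp
    rw [e, mul_assoc, ← mul_add, ← lintegral_const_mul _ (hc.measurable.enorm.indicator hE),
      ← lintegral_add_left ((hc.measurable.enorm.indicator hE).const_mul _)]
    gcongr with z
    by_cases hz : a < |f z|
    · rw [Set.indicator_of_mem (by exact hz), Set.indicator_of_notMem (by simpa using hz), add_zero,
        pow_two]
      gcongr
      · rw [← ofReal_norm]; exact ENNReal.ofReal_le_ofReal (hb₂ z)
      · exact enorm_le_iff_norm_le.2 (hb₂' z)
    · rw [Set.indicator_of_notMem (by exact hz), Set.indicator_of_mem (by simpa using hz),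
        hsm z (not_lt.1 hz)]
      simp
  have hcover : {z | 3 * a < |czop K f z|} ⊆ {z | 2 * a < |czop K f₁ z|} ∪
      {z | a < |czop K f₂ z|} := by
    intro z hz
    have h1 := hK.czop_sub hf hi₂ z
    have h2 : czop K f₁ z = czop K f z - czop K f₂ z := h1
    have h3 := abs_add_le (czop K f₁ z) (czop K f₂ z)
    have h4 : czop K f₁ z + czop K f₂ z = czop K f z := by rw [h2]; ring
    rw [h4] at h3
    simp only [Set.mem_union, Set.mem_ofPred_eq] at hz ⊢
    by_contra! hcon
    linarith [hcon.1, hcon.2]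
  calc _ ≤ _ := (measure_mono hcover).trans (measure_union_le _ _)
    _ ≤ _ := add_le_add h₁ (h₂.trans h₃)
    _ = _ := by
      rw [← add_assoc, ← add_mul, ← ENNReal.ofReal_add (by positivity) (by positivity)]
      congr 3; field_simp; ring

lemma lintegral_Ioi_indicator_lt {p : ℝ} (hp : 1 < p) {y : ℝ} (hy : 0 ≤ y) :
    ∫⁻ a in Set.Ioi (0 : ℝ), (Set.Iio y).indicator (fun a => ENNReal.ofReal (a ^ (p - 2))) a
      ≤ ENNReal.ofReal (y ^ (p - 1) / (p - 1)) := by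
  rw [lintegral_indicator measurableSet_Iio, Measure.restrict_restrict measurableSet_Iio,
    Set.inter_comm, Set.Ioi_inter_Iio]
  have h1 := intervalIntegral.intervalIntegrable_rpow' (a := 0) (b := y) (r := p - 2) (by linarith)
  rw [intervalIntegrable_iff_integrableOn_Ioo_of_le hy] at h1
  rw [← ofReal_integral_eq_lintegral_ofReal h1, ← integral_Ioc_eq_integral_Ioo,
    ← intervalIntegral.integral_of_le hy, integral_rpow (Or.inl (by linarith))]
  · rw [show p - 2 + 1 = p - 1 by ring, Real.zero_rpow (by linarith), sub_zero]
  · exact (ae_restrict_mem measurableSet_Ioo).mono fun a ha => Real.rpow_nonneg ha.1.le _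

lemma lintegral_Ioi_indicator_ge {p : ℝ} (hp : p < 2) {y : ℝ} (hy : 0 < y) :
    ∫⁻ a in Set.Ioi (0 : ℝ), (Set.Ici y).indicator (fun a => ENNReal.ofReal (a ^ (p - 3))) a
      ≤ ENNReal.ofReal (y ^ (p - 2) / (2 - p)) := by
  have hsub : Set.Ici y ⊆ Set.Ioi (0 : ℝ) := fun a ha => hy.trans_le ha
  rw [lintegral_indicator measurableSet_Ici, Measure.restrict_restrict measurableSet_Ici,
    Set.inter_eq_left.2 hsub,
    setLIntegral_congr Ioi_ae_eq_Ici.symm]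
  have h1 := integrableOn_Ioi_rpow_of_lt (a := p - 3) (by linarith) hy
  rw [← ofReal_integral_eq_lintegral_ofReal h1, integral_Ioi_rpow_of_lt (by linarith) hy]
  · rw [show p - 3 + 1 = p - 2 by ring, ← neg_sub 2 p, div_neg, neg_div, neg_neg, neg_sub]
  · exact (ae_restrict_mem measurableSet_Ioi).mono fun a ha =>
      Real.rpow_nonneg (hy.trans ha).le _

/-- Strong type `(p, p)` bound for `1 < p < 2`. -/
lemma IsCZKernel.exists_bound_of_lt_two {p : ℝ} (hp : 1 < p) (hp2 : p < 2) (A : ℝ) :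
    ∃ C : ℝ, 0 ≤ C ∧ ∀ K, IsCZKernel K A → ∀ f : ℝ × ℝ → ℝ, Continuous f → HasCompactSupport f →
      ∫⁻ z, ‖czop K f z‖ₑ ^ p ≤ ENNReal.ofReal C * ∫⁻ z, ‖f z‖ₑ ^ p := by
  refine ⟨3 ^ p * p * (|27 * A + 256| / (p - 1) + |A| / (2 - p)), ?_, ?_⟩
  · have : 0 < 2 - p := by linarith
    have : 0 < p - 1 := by linarith
    positivity
  intro K hK f hc hs
  have hA := hK.pos
  have hp1 : 0 < p - 1 := by linarith
  have hp3 : 0 < 2 - p := by linarith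
  rw [abs_of_pos hA, abs_of_pos (by positivity : 0 < 27 * A + 256)]
  have hTm := hK.measurable_czop hc.measurable
  have hlayer := lintegral_rpow_eq_lintegral_meas_lt_mul (volume : Measure (ℝ × ℝ))
    (f := fun z => |czop K f z| / 3) (Filter.Eventually.of_forall fun z => by positivity)
    (by have := hTm.aemeasurable (μ := volume); fun_prop) (p := p) (by linarith)
  have h0 : ∫⁻ z, ‖czop K f z‖ₑ ^ p
      = ENNReal.ofReal (3 ^ p) * ∫⁻ z, ENNReal.ofReal ((|czop K f z| / 3) ^ p) := by
    rw [← lintegral_const_mul' _ _ ENNReal.ofReal_ne_top]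
    refine lintegral_congr fun z => ?_
    rw [← ENNReal.ofReal_mul (by positivity), ← Real.mul_rpow (by positivity) (by positivity),
      mul_div_cancel₀ _ (by norm_num : (3 : ℝ) ≠ 0), ← ofReal_norm, Real.norm_eq_abs,
      ENNReal.ofReal_rpow_of_nonneg (abs_nonneg _) (by linarith)]
  have hm1 : Measurable (Function.uncurry fun (a : ℝ) (z : ℝ × ℝ) =>
      (Set.Iio |f z|).indicator (fun a => ENNReal.ofReal (a ^ (p - 2))) a * ‖f z‖ₑ) := by
    have e : (Function.uncurry fun (a : ℝ) (z : ℝ × ℝ) =>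
      (Set.Iio |f z|).indicator (fun a => ENNReal.ofReal (a ^ (p - 2))) a * ‖f z‖ₑ)
      = fun x => {x : ℝ × (ℝ × ℝ) | x.1 < |f x.2|}.indicator
        (fun x => ENNReal.ofReal (x.1 ^ (p - 2))) x * ‖f x.2‖ₑ := by
      ext x; simp [Function.uncurry, Set.indicator]
    rw [e]
    have hmf := hc.measurable
    refine Measurable.mul (Measurable.indicator (by fun_prop) ?_) (by fun_prop)
    exact measurableSet_lt measurable_fst (by fun_prop)
  have hm2 : Measurable (Function.uncurry fun (a : ℝ) (z : ℝ × ℝ) =>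
      (Set.Ici |f z|).indicator (fun a => ENNReal.ofReal (a ^ (p - 3))) a * ‖f z‖ₑ ^ 2) := by
    have e : (Function.uncurry fun (a : ℝ) (z : ℝ × ℝ) =>
      (Set.Ici |f z|).indicator (fun a => ENNReal.ofReal (a ^ (p - 3))) a * ‖f z‖ₑ ^ 2)
      = fun x => {x : ℝ × (ℝ × ℝ) | |f x.2| ≤ x.1}.indicator
        (fun x => ENNReal.ofReal (x.1 ^ (p - 3))) x * ‖f x.2‖ₑ ^ 2 := by
      ext x; simp [Function.uncurry, Set.indicator]
    rw [e]
    have hmf := hc.measurable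
    refine Measurable.mul (Measurable.indicator (by fun_prop) ?_) (by fun_prop)
    exact measurableSet_le (by fun_prop) measurable_fst
  have hpt : ∀ a ∈ Set.Ioi (0 : ℝ), volume {z | a < |czop K f z| / 3} * ENNReal.ofReal (a ^ (p - 1))
      ≤ ENNReal.ofReal (27 * A + 256) * (∫⁻ z, (Set.Iio |f z|).indicator
          (fun a => ENNReal.ofReal (a ^ (p - 2))) a * ‖f z‖ₑ)
        + ENNReal.ofReal A * ∫⁻ z, (Set.Ici |f z|).indicator
          (fun a => ENNReal.ofReal (a ^ (p - 3))) a * ‖f z‖ₑ ^ 2 := by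
    intro a ha
    have ha' : 0 < a := ha
    have e1 : {z | a < |czop K f z| / 3} = {z | 3 * a < |czop K f z|} := by
      ext z; simp only [Set.mem_ofPred_eq]; constructor <;> intro h <;> linarith
    rw [e1]
    refine (mul_le_mul_left (hK.meas_le hc hs ha') _).trans (le_of_eq ?_)
    rw [add_mul]
    congr 1
    · rw [mul_right_comm, ← ENNReal.ofReal_mul (by positivity), ← lintegral_const_mul' _ _
        ENNReal.ofReal_ne_top, ← lintegral_const_mul' _ _ ENNReal.ofReal_ne_top]
      refine lintegral_congr fun z => ?_
      by_cases hz : a < |f z|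
      · rw [Set.indicator_of_mem (by exact hz), Set.indicator_of_mem (by exact hz), ← mul_assoc,
          ← ENNReal.ofReal_mul (by positivity)]
        congr 2
        rw [show p - 2 = p - 1 - 1 by ring, Real.rpow_sub_one ha'.ne' (p - 1)]; field_simp
      · rw [Set.indicator_of_notMem (by exact hz), Set.indicator_of_notMem (by exact hz)]; simp
    · rw [mul_right_comm, ← ENNReal.ofReal_mul (by positivity), ← lintegral_const_mul' _ _
        ENNReal.ofReal_ne_top, ← lintegral_const_mul' _ _ ENNReal.ofReal_ne_top]
      refine lintegral_congr fun z => ?_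
      by_cases hz : a < |f z|
      · rw [Set.indicator_of_notMem (by simpa using hz), Set.indicator_of_notMem (by simpa using hz)]
        simp
      · rw [Set.indicator_of_mem (by simpa using hz), Set.indicator_of_mem (by simpa using hz),
          ← mul_assoc, ← ENNReal.ofReal_mul (by positivity)]
        congr 2
        rw [show p - 3 = p - 1 - 1 - 1 by ring, Real.rpow_sub_one ha'.ne' (p - 1 - 1),
          Real.rpow_sub_one ha'.ne' (p - 1)]
        field_simp
  have hI1 : ∫⁻ a in Set.Ioi (0 : ℝ), ∫⁻ z, (Set.Iio |f z|).indicator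
          (fun a => ENNReal.ofReal (a ^ (p - 2))) a * ‖f z‖ₑ
      ≤ ENNReal.ofReal (1 / (p - 1)) * ∫⁻ z, ‖f z‖ₑ ^ p := by
    rw [lintegral_lintegral_swap hm1.aemeasurable, ← lintegral_const_mul' _ _ ENNReal.ofReal_ne_top]
    refine lintegral_mono fun z => ?_
    rw [lintegral_mul_const' _ _ enorm_ne_top]
    refine (mul_le_mul_left (lintegral_Ioi_indicator_lt hp (abs_nonneg (f z))) _).trans ?_
    rw [← ofReal_norm, Real.norm_eq_abs, ENNReal.ofReal_rpow_of_nonneg (abs_nonneg _) (by linarith),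
      ← ENNReal.ofReal_mul (by positivity), ← ENNReal.ofReal_mul (by positivity)]
    apply ENNReal.ofReal_le_ofReal
    rcases (abs_nonneg (f z)).eq_or_lt' with h | h
    · rw [h, Real.zero_rpow (by linarith), Real.zero_rpow (by linarith)]; simp
    · rw [Real.rpow_sub_one h.ne']; apply le_of_eq; field_simp
  have hI2 : ∫⁻ a in Set.Ioi (0 : ℝ), ∫⁻ z, (Set.Ici |f z|).indicator
          (fun a => ENNReal.ofReal (a ^ (p - 3))) a * ‖f z‖ₑ ^ 2
      ≤ ENNReal.ofReal (1 / (2 - p)) * ∫⁻ z, ‖f z‖ₑ ^ p := by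
    rw [lintegral_lintegral_swap hm2.aemeasurable, ← lintegral_const_mul' _ _ ENNReal.ofReal_ne_top]
    refine lintegral_mono fun z => ?_
    rw [lintegral_mul_const' _ _ (by finiteness)]
    rcases (abs_nonneg (f z)).eq_or_lt' with h | h
    · have : f z = 0 := abs_eq_zero.1 h
      simp [this]
    refine (mul_le_mul_left (lintegral_Ioi_indicator_ge hp2 h) _).trans ?_
    rw [← ofReal_norm, Real.norm_eq_abs, ENNReal.ofReal_rpow_of_nonneg (abs_nonneg _) (by linarith),
      ← ENNReal.ofReal_pow (abs_nonneg _),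
      ← ENNReal.ofReal_mul (by positivity), ← ENNReal.ofReal_mul (by positivity)]
    apply ENNReal.ofReal_le_ofReal
    rw [show p - 2 = p - 1 - 1 by ring, Real.rpow_sub_one h.ne', Real.rpow_sub_one h.ne']
    apply le_of_eq; field_simp
  rw [h0, hlayer]
  calc _ ≤ ENNReal.ofReal (3 ^ p) * (ENNReal.ofReal p * ∫⁻ a in Set.Ioi (0 : ℝ),
        (ENNReal.ofReal (27 * A + 256) * (∫⁻ z, (Set.Iio |f z|).indicator
          (fun a => ENNReal.ofReal (a ^ (p - 2))) a * ‖f z‖ₑ)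
        + ENNReal.ofReal A * ∫⁻ z, (Set.Ici |f z|).indicator
          (fun a => ENNReal.ofReal (a ^ (p - 3))) a * ‖f z‖ₑ ^ 2)) := by
        gcongr 2
        exact setLIntegral_mono' measurableSet_Ioi hpt
    _ ≤ ENNReal.ofReal (3 ^ p) * (ENNReal.ofReal p * (ENNReal.ofReal (27 * A + 256) *
          (ENNReal.ofReal (1 / (p - 1)) * ∫⁻ z, ‖f z‖ₑ ^ p) + ENNReal.ofReal A *
          (ENNReal.ofReal (1 / (2 - p)) * ∫⁻ z, ‖f z‖ₑ ^ p))) := by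
        gcongr 2
        rw [lintegral_add_left (hm1.lintegral_prod_right.const_mul _),
          lintegral_const_mul' _ _ ENNReal.ofReal_ne_top,
          lintegral_const_mul' _ _ ENNReal.ofReal_ne_top]
        gcongr
    _ = _ := by
        rw [← mul_assoc (ENNReal.ofReal (27 * A + 256)), ← mul_assoc (ENNReal.ofReal A), ← add_mul,
          ← ENNReal.ofReal_mul (by positivity), ← ENNReal.ofReal_mul (by positivity),
          ← ENNReal.ofReal_add (by positivity) (by positivity), ← mul_assoc, ← mul_assoc,
          ← ENNReal.ofReal_mul (by positivity), ← ENNReal.ofReal_mul (by positivity)]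
        congr 2; field_simp

end calderonZygmund

lemma eLpNorm_ofReal_rpow {α : Type*} [MeasurableSpace α] {μ : Measure α} {p : ℝ} (hp : 0 < p)
    (f : α → ℝ) : eLpNorm f (ENNReal.ofReal p) μ ^ p = ∫⁻ z, ‖f z‖ₑ ^ p ∂μ := by
  rw [eLpNorm_eq_lintegral_rpow_enorm_toReal (by simpa using hp) ofReal_ne_top,
    ENNReal.toReal_ofReal hp.le, ← ENNReal.rpow_mul, one_div_mul_cancel hp.ne', ENNReal.rpow_one]

lemma lintegral_rpow_ne_top_of_integrable_of_bdd {α : Type*} [MeasurableSpace α] {μ : Measure α}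
    {p : ℝ} (hp : 1 < p) {f : α → ℝ} (hf : Integrable f μ) {M : ℝ} (hM : ∀ z, ‖f z‖ ≤ M) :
    ∫⁻ z, ‖f z‖ₑ ^ p ∂μ ≠ ⊤ := by
  have h : ∀ z, ‖f z‖ₑ ^ p ≤ ENNReal.ofReal M ^ (p - 1) * ‖f z‖ₑ := fun z => by
    rw [show ‖f z‖ₑ ^ p = ‖f z‖ₑ ^ ((p - 1) + 1) by ring_nf,
      ENNReal.rpow_add_of_nonneg _ _ (by linarith) zero_le_one, ENNReal.rpow_one]
    gcongr
    rw [← ofReal_norm]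
    exact ENNReal.ofReal_le_ofReal (hM z)
  refine ((lintegral_mono h).trans_lt ?_).ne
  rw [lintegral_const_mul' _ _ (by finiteness)]
  exact ENNReal.mul_lt_top (by finiteness) hf.2

lemma memLp_of_integrable_of_bdd {α : Type*} [MeasurableSpace α] {μ : Measure α}
    {p : ℝ} (hp : 1 < p) {f : α → ℝ} (hf : Integrable f μ) {M : ℝ} (hM : ∀ z, ‖f z‖ ≤ M) :
    MemLp f (ENNReal.ofReal p) μ := by
  refine ⟨hf.1, ?_⟩
  have h := lintegral_rpow_ne_top_of_integrable_of_bdd hp hf hM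
  rw [← eLpNorm_ofReal_rpow (by linarith)] at h
  rw [lt_top_iff_ne_top]
  intro h'
  rw [h', ENNReal.top_rpow_of_pos (by linarith)] at h
  exact h rfl

lemma IsCZKernel.enorm_czop_le {K : ℝ × ℝ → ℝ} {A p q : ℝ} (hpq : p.HolderConjugate q)
    (hK : IsCZKernel K A) {f : ℝ × ℝ → ℝ} (hf : AEStronglyMeasurable f) (z : ℝ × ℝ) :
    ‖czop K f z‖ₑ ≤ (∫⁻ w, ‖K w‖ₑ ^ q) ^ (1 / q) * eLpNorm f (ENNReal.ofReal p) volume := by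
  have hm : Measurable fun w => K (w - z) := hK.measurable.comp (measurable_id.sub_const z)
  calc ‖czop K f z‖ₑ ≤ ∫⁻ w, ‖K (w - z) * f w‖ₑ := enorm_integral_le_lintegral_enorm _
    _ = ∫⁻ w, ((fun w => ‖K (w - z)‖ₑ) * fun w => ‖f w‖ₑ) w := by simp [enorm_mul]
    _ ≤ _ := ENNReal.lintegral_mul_le_Lp_mul_Lq _ hpq.symm hm.enorm.aemeasurable hf.enorm
    _ = _ := by
      rw [lintegral_sub_right_eq_self (fun w => ‖K w‖ₑ ^ q) z, ← eLpNorm_ofReal_rpow hpq.pos,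
        ← ENNReal.rpow_mul, mul_one_div_cancel hpq.pos.ne', ENNReal.rpow_one]

/-- An `L^p` bound on continuous compactly supported functions extends to bounded integrable
functions. -/
lemma IsCZKernel.extend_bound {K : ℝ × ℝ → ℝ} {A p C : ℝ} (hp : 1 < p) (hK : IsCZKernel K A)
    (hC : ∀ f : ℝ × ℝ → ℝ, Continuous f → HasCompactSupport f →
      ∫⁻ z, ‖czop K f z‖ₑ ^ p ≤ ENNReal.ofReal C * ∫⁻ z, ‖f z‖ₑ ^ p)
    {f : ℝ × ℝ → ℝ} (hfi : Integrable f) (hfb : ∃ M, ∀ z, ‖f z‖ ≤ M) :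
    ∫⁻ z, ‖czop K f z‖ₑ ^ p ≤ ENNReal.ofReal C * ∫⁻ z, ‖f z‖ₑ ^ p := by
  obtain ⟨M, hM⟩ := hfb
  obtain ⟨MK, hMK⟩ := hK.bdd
  have hp0 : 0 < p := by linarith
  have hpq := Real.HolderConjugate.conjExponent hp
  set q := p.conjExponent
  have hKq := lintegral_rpow_ne_top_of_integrable_of_bdd hpq.symm.lt hK.integrable hMK
  have hf := memLp_of_integrable_of_bdd hp hfi hM
  have hε : ∀ n : ℕ, ((n : ℝ≥0∞) + 1)⁻¹ ≠ 0 := fun n => by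
    simp
  choose g hgs hgd hgc hgp using fun n : ℕ =>
    hf.exists_hasCompactSupport_eLpNorm_sub_le ofReal_ne_top (hε n)
  have hε0 : Filter.Tendsto (fun n : ℕ => ((n : ℝ≥0∞) + 1)⁻¹) Filter.atTop (nhds 0) := by
    have := (Filter.tendsto_add_atTop_iff_nat 1).2 ENNReal.tendsto_inv_nat_nhds_zero
    simpa using this
  have hp1' : (1 : ℝ≥0∞) ≤ ENNReal.ofReal p := by
    rw [← ENNReal.ofReal_one]; exact ENNReal.ofReal_le_ofReal hp.le
  have hpt : ∀ z, Filter.Tendsto (fun n => czop K (g n) z) Filter.atTop (nhds (czop K f z)) := by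
    intro z
    rw [tendsto_iff_edist_tendsto_0]
    refine tendsto_of_tendsto_of_tendsto_of_le_of_le tendsto_const_nhds
      (h := fun n : ℕ => (∫⁻ w, ‖K w‖ₑ ^ q) ^ (1 / q) * ((n : ℝ≥0∞) + 1)⁻¹) ?_
      (fun _ => zero_le) fun n => ?_
    · have := ENNReal.Tendsto.const_mul hε0 (a := (∫⁻ w, ‖K w‖ₑ ^ q) ^ (1 / q))
        (Or.inr (ENNReal.rpow_ne_top_of_nonneg (by simpa using hpq.symm.nonneg) hKq))
      simpa using this
    · rw [edist_comm, edist_eq_enorm_sub,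
        ← hK.czop_sub hfi ((hgc n).integrable_of_hasCompactSupport (hgs n))]
      refine (hK.enorm_czop_le hpq (f := fun w => f w - g n w)
        (hf.1.sub (hgc n).aestronglyMeasurable) z).trans ?_
      exact mul_le_mul_right (hgd n) _
  have hT : ∀ n, eLpNorm (czop K (g n)) (ENNReal.ofReal p) volume ≤
      ENNReal.ofReal C ^ (1 / p) * (eLpNorm f (ENNReal.ofReal p) volume + ((n : ℝ≥0∞) + 1)⁻¹) := by
    intro n
    rw [← ENNReal.rpow_le_rpow_iff hp0, eLpNorm_ofReal_rpow hp0,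
      ENNReal.mul_rpow_of_nonneg _ _ hp0.le, ← ENNReal.rpow_mul, one_div_mul_cancel hp0.ne',
      ENNReal.rpow_one]
    refine (hC (g n) (hgc n) (hgs n)).trans ?_
    rw [← eLpNorm_ofReal_rpow hp0]
    gcongr
    have e : g n = f - (f - g n) := by simp
    conv_lhs => rw [e]
    refine (eLpNorm_sub_le hf.1 (hf.1.sub (hgc n).aestronglyMeasurable) hp1').trans ?_
    gcongr
    exact hgd n
  have hfin : eLpNorm (czop K f) (ENNReal.ofReal p) volume ≤
      ENNReal.ofReal C ^ (1 / p) * eLpNorm f (ENNReal.ofReal p) volume := by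
    have h1 := Lp.eLpNorm_lim_le_liminf_eLpNorm (μ := volume) (p := ENNReal.ofReal p)
      (f := fun n => czop K (g n))
      (fun n => (hK.measurable_czop (hgc n).measurable).aestronglyMeasurable) (czop K f)
      (Filter.Eventually.of_forall hpt)
    have h2 : Filter.Tendsto (fun n : ℕ => ENNReal.ofReal C ^ (1 / p) *
        (eLpNorm f (ENNReal.ofReal p) volume + ((n : ℝ≥0∞) + 1)⁻¹)) Filter.atTop
        (nhds (ENNReal.ofReal C ^ (1 / p) * eLpNorm f (ENNReal.ofReal p) volume)) := by
      refine ENNReal.Tendsto.const_mul ?_ (Or.inr (by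
        exact ENNReal.rpow_ne_top_of_nonneg (by positivity) ofReal_ne_top))
      simpa using hε0.const_add (eLpNorm f (ENNReal.ofReal p) volume)
    refine h1.trans (le_of_le_of_eq (Filter.liminf_le_liminf
      (Filter.Eventually.of_forall hT)) h2.liminf_eq)
  rw [← eLpNorm_ofReal_rpow hp0, ← eLpNorm_ofReal_rpow hp0]
  rw [← ENNReal.rpow_le_rpow_iff hp0, ENNReal.mul_rpow_of_nonneg _ _ hp0.le, ← ENNReal.rpow_mul,
    one_div_mul_cancel hp0.ne', ENNReal.rpow_one] at hfin
  exact hfin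

/-- Duality: an `L^q` bound on bounded integrable functions gives an `L^p` bound. -/
lemma IsCZKernel.dual_bound {K : ℝ × ℝ → ℝ} {A p q C : ℝ} (hpq : p.HolderConjugate q)
    (hK : IsCZKernel K A)
    (hC : ∀ f : ℝ × ℝ → ℝ, Integrable f → (∃ M, ∀ z, ‖f z‖ ≤ M) →
      ∫⁻ z, ‖czop K f z‖ₑ ^ q ≤ ENNReal.ofReal C * ∫⁻ z, ‖f z‖ₑ ^ q)
    {f : ℝ × ℝ → ℝ} (hfm : Measurable f) (hfi : Integrable f) (hfb : ∃ M, ∀ z, ‖f z‖ ≤ M) :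
    ∫⁻ z, ‖czop K f z‖ₑ ^ p ≤ ENNReal.ofReal C ^ (p - 1) * ∫⁻ z, ‖f z‖ₑ ^ p := by
  have hp0 := hpq.pos
  have hq0 := hpq.symm.pos
  have hp1 := hpq.lt
  obtain ⟨M, hM⟩ := hfb
  obtain ⟨MK, hMK⟩ := hK.bdd
  have hTm := hK.measurable_czop hfm
  set T := czop K f with hTdef
  have hTb : ∀ z, ‖T z‖ ≤ MK * ∫ w, ‖f w‖ := fun z => by
    rw [← integral_const_mul]
    refine norm_integral_le_of_norm_le (hfi.norm.const_mul _) (Filter.Eventually.of_forall fun w => ?_)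
    rw [norm_mul]
    gcongr
    exact hMK _
  set D := MK * ∫ w, ‖f w‖
  have hD : 0 ≤ D := (norm_nonneg _).trans (hTb 0)
  have key : ∀ n : ℕ, ∫⁻ z in Metric.ball (0 : ℝ × ℝ) n, ‖T z‖ₑ ^ p ≤
      ENNReal.ofReal C ^ (p - 1) * ∫⁻ z, ‖f z‖ₑ ^ p := by
    intro n
    set B := Metric.ball (0 : ℝ × ℝ) n
    have hBm : MeasurableSet B := measurableSet_ball
    have hBf : volume B < ⊤ := measure_ball_lt_top
    set s : ℝ × ℝ → ℝ := B.indicator fun z => |T z| ^ (p - 2) * T z with hs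
    have hsabs : ∀ z, |(|T z| ^ (p - 2) * T z)| = |T z| ^ (p - 1) := fun z => by
      rw [abs_mul, abs_of_nonneg (Real.rpow_nonneg (abs_nonneg _) _)]
      rcases (abs_nonneg (T z)).eq_or_lt' with h | h
      · rw [h, mul_zero, Real.zero_rpow (by linarith)]
      · rw [show p - 1 = (p - 2) + 1 by ring, Real.rpow_add_one h.ne']
    have hsm : Measurable s := ((hTm.abs.pow_const _).mul hTm).indicator hBm
    have hsb : ∀ z, ‖s z‖ ≤ D ^ (p - 1) := fun z => by
      by_cases hz : z ∈ B
      · rw [hs, Set.indicator_of_mem hz, Real.norm_eq_abs, hsabs]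
        exact Real.rpow_le_rpow (abs_nonneg _) (hTb z) (by linarith)
      · rw [hs, Set.indicator_of_notMem hz, norm_zero]; positivity
    have hsi : Integrable s := by
      have : IntegrableOn (fun _ : ℝ × ℝ => D ^ (p - 1)) B := integrableOn_const hBf.ne (by simp)
      refine ((integrable_indicator_iff hBm).2 this).mono' hsm.aestronglyMeasurable
        (Filter.Eventually.of_forall fun z => ?_)
      by_cases hz : z ∈ B
      · rw [Set.indicator_of_mem hz]; exact hsb z
      · rw [hs, Set.indicator_of_notMem hz, Set.indicator_of_notMem hz, norm_zero]
    set I := ∫⁻ z in B, ‖T z‖ₑ ^ p with hI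
    have hIne : I ≠ ⊤ := by
      refine ((setLIntegral_mono measurable_const (fun z _ => ?_)).trans_lt
        (by rw [setLIntegral_const]; exact ENNReal.mul_lt_top
              (by finiteness : ENNReal.ofReal D ^ p < ⊤) hBf)).ne
      gcongr
      rw [← ofReal_norm]; exact ENNReal.ofReal_le_ofReal (hTb z)
    have hsq : ∫⁻ z, ‖s z‖ₑ ^ q = I := by
      rw [hI, ← lintegral_indicator hBm]
      refine lintegral_congr fun z => ?_
      by_cases hz : z ∈ B
      · rw [hs, Set.indicator_of_mem hz, Set.indicator_of_mem hz, ← ofReal_norm,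
          Real.norm_eq_abs, hsabs, ← ofReal_norm, Real.norm_eq_abs,
          ENNReal.ofReal_rpow_of_nonneg (by positivity) hq0.le,
          ENNReal.ofReal_rpow_of_nonneg (by positivity) hp0.le, ← Real.rpow_mul (abs_nonneg _),
          hpq.sub_one_mul_conj]
      · rw [hs, Set.indicator_of_notMem hz, Set.indicator_of_notMem hz]
        simp [hq0]
    have hIs : ENNReal.ofReal (∫ z, s z * T z) = I := by
      have hsT : ∀ z, s z * T z = B.indicator (fun z => |T z| ^ p) z := fun z => by
        by_cases hz : z ∈ B
        · rw [hs, Set.indicator_of_mem hz, Set.indicator_of_mem hz]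
          rcases (abs_nonneg (T z)).eq_or_lt' with h | h
          · rw [h, abs_eq_zero.1 h, Real.zero_rpow hp0.ne', mul_zero]
          · rw [mul_assoc, ← abs_mul_abs_self, ← mul_assoc, ← Real.rpow_add_one h.ne',
              ← Real.rpow_add_one h.ne']
            congr 1; ring
        · rw [hs, Set.indicator_of_notMem hz, Set.indicator_of_notMem hz, zero_mul]
      have hsTi : Integrable fun z => s z * T z :=
        hsi.mul_bdd (c := D) hTm.aestronglyMeasurable (Filter.Eventually.of_forall hTb)
      rw [ofReal_integral_eq_lintegral_ofReal hsTi (Filter.Eventually.of_forall fun z => by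
        simp only [hsT]; exact Set.indicator_nonneg (fun z _ => by positivity) z), hI,
        ← lintegral_indicator hBm]
      refine lintegral_congr fun z => ?_
      rw [hsT]
      by_cases hz : z ∈ B
      · rw [Set.indicator_of_mem hz, Set.indicator_of_mem hz, ← ofReal_norm, Real.norm_eq_abs,
          ENNReal.ofReal_rpow_of_nonneg (by positivity) hp0.le]
      · rw [Set.indicator_of_notMem hz, Set.indicator_of_notMem hz, ENNReal.ofReal_zero]
    set s' : ℝ × ℝ → ℝ := fun z => s (-z)
    have hs'i : Integrable s' := hsi.comp_neg
    have hfub : ∫ z, s z * T z = ∫ w, f w * czop K s' (-w) := by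
      have h_int : Integrable (Function.uncurry fun z w : ℝ × ℝ => s z * (K (w - z) * f w))
          (volume.prod volume) := by
        have h1 : Integrable (fun v : (ℝ × ℝ) × (ℝ × ℝ) => s v.1 * f v.2) (volume.prod volume) :=
          hsi.mul_prod hfi
        have h2 := h1.bdd_mul (c := MK) (f := fun v : (ℝ × ℝ) × (ℝ × ℝ) => K (v.2 - v.1))
          (hK.measurable.comp (measurable_snd.sub measurable_fst)).aestronglyMeasurable
          (Filter.Eventually.of_forall fun v => hMK _)
        refine h2.congr (Filter.Eventually.of_forall fun v => ?_)
        simp only [Function.uncurry]; ring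
      have e1 : ∀ z, s z * T z = ∫ w, s z * (K (w - z) * f w) := fun z =>
        (integral_const_mul _ _).symm
      simp_rw [e1]
      rw [integral_integral_swap h_int]
      refine integral_congr_ae (Filter.Eventually.of_forall fun w => ?_)
      simp only [czop, s']
      rw [← integral_const_mul, ← integral_neg_eq_self]
      refine integral_congr_ae (Filter.Eventually.of_forall fun z => ?_)
      simp only [sub_neg_eq_add]
      rw [add_comm w z]; ring
    have hTs := hC s' hs'i ⟨_, fun z => hsb _⟩
    have hs'q : ∫⁻ z, ‖s' z‖ₑ ^ q = I := by
      rw [← hsq]; exact lintegral_neg_eq_self (fun z => ‖s z‖ₑ ^ q)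
    have hcm : Measurable fun w => czop K s' (-w) :=
      (hK.measurable_czop (hsm.comp measurable_neg)).comp measurable_neg
    have hmain : I ≤ (∫⁻ z, ‖f z‖ₑ ^ p) ^ (1 / p) * (ENNReal.ofReal C * I) ^ (1 / q) := by
      calc I = ENNReal.ofReal (∫ w, f w * czop K s' (-w)) := by rw [← hfub, hIs]
        _ ≤ ‖∫ w, f w * czop K s' (-w)‖ₑ := by
            rw [← ofReal_norm]; exact ENNReal.ofReal_le_ofReal (Real.le_norm_self _)
        _ ≤ ∫⁻ w, ‖f w * czop K s' (-w)‖ₑ := enorm_integral_le_lintegral_enorm _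
        _ = ∫⁻ w, ((fun w => ‖f w‖ₑ) * fun w => ‖czop K s' (-w)‖ₑ) w := by simp [enorm_mul]
        _ ≤ _ := ENNReal.lintegral_mul_le_Lp_mul_Lq _ hpq hfm.enorm.aemeasurable
            hcm.enorm.aemeasurable
        _ ≤ _ := by
            gcongr
            rw [lintegral_neg_eq_self (fun w => ‖czop K s' w‖ₑ ^ q), ← hs'q]
            exact hTs
    rcases eq_or_ne I 0 with h0 | h0
    · rw [h0]; exact zero_le
    have hpow : I ^ p ≤ (∫⁻ z, ‖f z‖ₑ ^ p) * (ENNReal.ofReal C * I) ^ (p - 1) := by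
      have := ENNReal.rpow_le_rpow hmain hp0.le
      rw [ENNReal.mul_rpow_of_nonneg _ _ hp0.le, ← ENNReal.rpow_mul, ← ENNReal.rpow_mul,
        one_div_mul_cancel hp0.ne', ENNReal.rpow_one] at this
      rwa [show 1 / q * p = p - 1 by
        rw [← hpq.div_conj_eq_sub_one]; ring] at this
    rw [ENNReal.mul_rpow_of_nonneg _ _ (by linarith), ← mul_assoc,
      show I ^ p = I * I ^ (p - 1) by
        nth_rw 2 [← ENNReal.rpow_one I]
        rw [← ENNReal.rpow_add _ _ h0 hIne]; congr 1; ring] at hpow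
    rw [mul_comm]
    refine (ENNReal.mul_le_mul_iff_left ?_ ?_).1 hpow
    · simp [h0, hIne]
    · exact ENNReal.rpow_ne_top_of_nonneg (by linarith) hIne
  have hlim := (aecover_ball (μ := (volume : Measure (ℝ × ℝ))) (x := 0)
    tendsto_natCast_atTop_atTop).lintegral_tendsto_of_countably_generated
    (hTm.enorm.pow_const p).aemeasurable
  exact le_of_tendsto' hlim key

/-- Uniform strong type `(p, p)` bound for all `1 < p < ∞`. -/
lemma IsCZKernel.exists_bound {p : ℝ} (hp : 1 < p) {A : ℝ} (hA : 0 ≤ A) :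
    ∃ C : ℝ, 0 ≤ C ∧ ∀ K, IsCZKernel K A → ∀ f : ℝ × ℝ → ℝ, Measurable f → Integrable f →
      (∃ M, ∀ z, ‖f z‖ ≤ M) →
      ∫⁻ z, ‖czop K f z‖ₑ ^ p ≤ ENNReal.ofReal C * ∫⁻ z, ‖f z‖ₑ ^ p := by
  rcases lt_trichotomy p 2 with h | h | h
  · obtain ⟨C, hC0, hC⟩ := IsCZKernel.exists_bound_of_lt_two hp h A
    exact ⟨C, hC0, fun K hK f _ hfi hfb => hK.extend_bound hp (hC K hK) hfi hfb⟩
  · subst h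
    refine ⟨A, hA, fun K hK f hfm hfi hfb => ?_⟩
    simpa using hK.l2 f hfm hfi hfb
  · have hpq := Real.HolderConjugate.conjExponent hp
    set q := p.conjExponent with hq
    have hq1 := hpq.symm.lt
    have hq2 : q < 2 := by
      rw [hq, Real.conjExponent, div_lt_iff₀ (by linarith)]; linarith
    obtain ⟨C, hC0, hC⟩ := IsCZKernel.exists_bound_of_lt_two hq1 hq2 A
    refine ⟨C ^ (p - 1), by positivity, fun K hK f hfm hfi hfb => ?_⟩
    rw [← ENNReal.ofReal_rpow_of_nonneg hC0 (by linarith)]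
    exact hK.dual_bound hpq (fun g hgi hgb => hK.extend_bound hq1 (hC K hK) hgi hgb) hfm hfi hfb

/-- The one-dimensional heat kernel. -/
noncomputable def heatG (r q : ℝ) : ℝ := (√(4 * Real.pi * r))⁻¹ * Real.exp (-(q ^ 2 / (4 * r)))

/-- Second space derivative of the heat kernel. -/
noncomputable def heatGxx (r q : ℝ) : ℝ := (q ^ 2 / (4 * r ^ 2) - 1 / (2 * r)) * heatG r q

lemma heatG_pos {r : ℝ} (hr : 0 < r) (q : ℝ) : 0 < heatG r q := by
  unfold heatG; positivity

lemma measurable_heatG : Measurable fun z : ℝ × ℝ => heatG z.1 z.2 := by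
  unfold heatG; fun_prop

lemma measurable_heatGxx : Measurable fun z : ℝ × ℝ => heatGxx z.1 z.2 := by
  unfold heatGxx
  exact Measurable.mul (by fun_prop) measurable_heatG

lemma hasDerivAt_heatG_space {r : ℝ} (hr : 0 < r) (q : ℝ) :
    HasDerivAt (heatG r) (-(q / (2 * r)) * heatG r q) q := by
  have h := (((hasDerivAt_pow 2 q).div_const (4 * r)).neg.exp).const_mul (√(4 * Real.pi * r))⁻¹
  refine h.congr_deriv ?_
  simp only [heatG, Pi.neg_apply]
  field_simp
  ring

lemma hasDerivAt_heatG_space_two {r : ℝ} (hr : 0 < r) (q : ℝ) :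
    HasDerivAt (fun q => -(q / (2 * r)) * heatG r q) (heatGxx r q) q := by
  have h := (((hasDerivAt_id q).div_const (2 * r)).neg).mul (hasDerivAt_heatG_space hr q)
  refine h.congr_deriv ?_
  simp only [heatGxx, Pi.neg_apply, id]
  field_simp
  ring

lemma hasDerivAt_heatGxx_space {r : ℝ} (hr : 0 < r) (q : ℝ) :
    HasDerivAt (heatGxx r) ((3 * q / (4 * r ^ 2) - q ^ 3 / (8 * r ^ 3)) * heatG r q) q := by
  have h := (((hasDerivAt_pow 2 q).div_const (4 * r ^ 2)).sub_const (1 / (2 * r))).mul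
    (hasDerivAt_heatG_space hr q)
  refine h.congr_deriv ?_
  field_simp
  ring

lemma hasDerivAt_heatG_time {r : ℝ} (hr : 0 < r) (q : ℝ) :
    HasDerivAt (fun r => heatG r q) (heatGxx r q) r := by
  have h1 : HasDerivAt (fun r : ℝ => √(4 * Real.pi * r)) _ r :=
    ((hasDerivAt_id r).const_mul (4 * Real.pi)).sqrt (by simp; positivity)
  have h2 : HasDerivAt (fun r : ℝ => -(q ^ 2 / (4 * r))) (q ^ 2 / (4 * r ^ 2)) r := by
    have := ((hasDerivAt_const r (q ^ 2)).div ((hasDerivAt_id r).const_mul 4)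
      (by simpa using hr.ne')).neg
    refine this.congr_deriv ?_
    simp only [id]; field_simp; ring
  have hs : √(4 * Real.pi * r) ≠ 0 := by positivity
  have hsq : √(4 * Real.pi * r) ^ 2 = 4 * Real.pi * r := Real.sq_sqrt (by positivity)
  have h := (h1.inv hs).mul h2.exp
  refine h.congr_deriv ?_
  simp only [heatGxx, heatG, Pi.inv_apply, id]
  rw [hsq]
  field_simp
  ring

lemma hasDerivAt_heatGxx_time {r : ℝ} (hr : 0 < r) (q : ℝ) :
    HasDerivAt (fun r => heatGxx r q)
      ((3 / (4 * r ^ 2) - 3 * q ^ 2 / (4 * r ^ 3) + q ^ 4 / (16 * r ^ 4)) * heatG r q) r := by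
  have h2 : HasDerivAt (fun r : ℝ => q ^ 2 / (4 * r ^ 2) - 1 / (2 * r))
      (-(q ^ 2 / (2 * r ^ 3)) + 1 / (2 * r ^ 2)) r := by
    have := ((hasDerivAt_const r (q ^ 2)).div ((hasDerivAt_pow 2 r).const_mul 4)
      (by positivity)).sub ((hasDerivAt_const r (1 : ℝ)).div ((hasDerivAt_id r).const_mul 2)
      (by simpa using hr.ne'))
    refine this.congr_deriv ?_
    simp only [id]; field_simp; ring
  refine (h2.mul (hasDerivAt_heatG_time hr q)).congr_deriv ?_
  simp only [heatGxx]
  field_simp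
  ring

lemma one_add_sq_pow_mul_exp_le (w : ℝ) :
    (1 + w ^ 2) ^ 5 * Real.exp (-(w ^ 2 / 4)) ≤ 500000 := by
  have h1 : ((1 + w ^ 2) / 4) ^ 5 / (Nat.factorial 5 : ℝ) ≤ Real.exp ((1 + w ^ 2) / 4) :=
    Real.pow_div_factorial_le_exp _ (by positivity) 5
  have h2 : Real.exp ((1 + w ^ 2) / 4) * Real.exp (-(w ^ 2 / 4)) ≤ 3 := by
    rw [← Real.exp_add]
    refine (Real.exp_le_exp.2 (by linarith : _ ≤ (1 : ℝ))).trans ?_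
    linarith [Real.exp_one_lt_d9]
  have h3 : (Nat.factorial 5 : ℝ) = 120 := by norm_num [Nat.factorial]
  rw [h3] at h1
  calc (1 + w ^ 2) ^ 5 * Real.exp (-(w ^ 2 / 4))
      = 122880 * (((1 + w ^ 2) / 4) ^ 5 / 120 * Real.exp (-(w ^ 2 / 4))) := by ring
    _ ≤ 122880 * (Real.exp ((1 + w ^ 2) / 4) * Real.exp (-(w ^ 2 / 4))) := by gcongr
    _ ≤ 500000 := by linarith

lemma heatG_le {s w : ℝ} (hs : 0 < s) :
    s * heatG (s ^ 2) (s * w) ≤ Real.exp (-(w ^ 2 / 4)) := by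
  unfold heatG
  rw [show 4 * Real.pi * s ^ 2 = (4 * Real.pi) * s ^ 2 by ring, Real.sqrt_mul (by positivity),
    Real.sqrt_sq hs.le, show (s * w) ^ 2 / (4 * s ^ 2) = w ^ 2 / 4 by field_simp]
  have h1 : (1 : ℝ) ≤ √(4 * Real.pi) := by
    rw [Real.one_le_sqrt]; linarith [Real.pi_gt_three]
  have h2 : s * ((√(4 * Real.pi) * s)⁻¹ * Real.exp (-(w ^ 2 / 4)))
      = (√(4 * Real.pi))⁻¹ * Real.exp (-(w ^ 2 / 4)) := by field_simp
  rw [h2]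
  exact mul_le_of_le_one_left (by positivity) (inv_le_one_of_one_le₀ h1)

lemma mul_heatG_le {c s w : ℝ} (hs : 0 < s) (hc : |c| ≤ (1 + w ^ 2) ^ 5) :
    |c * (s * heatG (s ^ 2) (s * w))| ≤ 500000 := by
  have h0 := heatG_pos (pow_pos hs 2) (s * w)
  rw [abs_mul, abs_of_nonneg (by positivity : 0 ≤ s * heatG (s ^ 2) (s * w))]
  calc _ ≤ (1 + w ^ 2) ^ 5 * Real.exp (-(w ^ 2 / 4)) := by gcongr; exact heatG_le hs
    _ ≤ _ := one_add_sq_pow_mul_exp_le w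

lemma sqrt_one_add_sq_le (w : ℝ) : √(1 + w ^ 2) ≤ 1 + w ^ 2 := by
  rw [Real.sqrt_le_left (by positivity)]; nlinarith [sq_nonneg w]

lemma sqrt_scale {s : ℝ} (hs : 0 < s) (w : ℝ) :
    √(s ^ 2 + (s * w) ^ 2) = s * √(1 + w ^ 2) := by
  rw [show s ^ 2 + (s * w) ^ 2 = s ^ 2 * (1 + w ^ 2) by ring, Real.sqrt_mul (by positivity),
    Real.sqrt_sq hs.le]

lemma exists_scale {r : ℝ} (hr : 0 < r) (q : ℝ) : ∃ s w, 0 < s ∧ r = s ^ 2 ∧ q = s * w :=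
  ⟨√r, q / √r, Real.sqrt_pos.2 hr, (Real.sq_sqrt hr.le).symm, by
    have := (Real.sqrt_pos.2 hr).ne'; field_simp⟩

lemma abs_heatGxx_le {r : ℝ} (hr : 0 < r) (q : ℝ) :
    (r + q ^ 2) * √(r + q ^ 2) * |heatGxx r q| ≤ 500000 := by
  obtain ⟨s, w, hs, rfl, rfl⟩ := exists_scale hr q
  rw [sqrt_scale hs, ← abs_of_nonneg (by positivity :
    0 ≤ (s ^ 2 + (s * w) ^ 2) * (s * √(1 + w ^ 2))), ← abs_mul]
  have e : (s ^ 2 + (s * w) ^ 2) * (s * √(1 + w ^ 2)) * heatGxx (s ^ 2) (s * w)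
      = ((1 + w ^ 2) * √(1 + w ^ 2) * (w ^ 2 / 4 - 1 / 2)) * (s * heatG (s ^ 2) (s * w)) := by
    unfold heatGxx; field_simp
  rw [e]
  refine mul_heatG_le hs ?_
  rw [abs_mul, abs_of_nonneg (by positivity)]
  have h1 : |w ^ 2 / 4 - 1 / 2| ≤ 1 + w ^ 2 := by
    rw [abs_le]; constructor <;> nlinarith [sq_nonneg w]
  calc _ ≤ (1 + w ^ 2) * (1 + w ^ 2) * (1 + w ^ 2) := by
        gcongr; exact sqrt_one_add_sq_le w
    _ = (1 + w ^ 2) ^ 3 := by ring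
    _ ≤ _ := pow_le_pow_right₀ (by nlinarith [sq_nonneg w]) (by norm_num)

lemma abs_heatGxxx_le {r : ℝ} (hr : 0 < r) (q : ℝ) :
    (r + q ^ 2) ^ 2 * |(3 * q / (4 * r ^ 2) - q ^ 3 / (8 * r ^ 3)) * heatG r q| ≤ 500000 := by
  obtain ⟨s, w, hs, rfl, rfl⟩ := exists_scale hr q
  rw [← abs_of_nonneg (by positivity : 0 ≤ (s ^ 2 + (s * w) ^ 2) ^ 2), ← abs_mul]
  have e : (s ^ 2 + (s * w) ^ 2) ^ 2 * ((3 * (s * w) / (4 * (s ^ 2) ^ 2)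
      - (s * w) ^ 3 / (8 * (s ^ 2) ^ 3)) * heatG (s ^ 2) (s * w))
      = ((1 + w ^ 2) ^ 2 * (3 * w / 4 - w ^ 3 / 8)) * (s * heatG (s ^ 2) (s * w)) := by
    field_simp
  rw [e]
  refine mul_heatG_le hs ?_
  rw [abs_mul, abs_of_nonneg (by positivity)]
  have h1 : |3 * w / 4 - w ^ 3 / 8| ≤ (1 + w ^ 2) ^ 2 := by
    rw [abs_le]
    constructor <;> nlinarith [sq_nonneg w, sq_nonneg (w - 1), sq_nonneg (w + 1),
      sq_nonneg (w * (w - 1)), sq_nonneg (w * (w + 1))]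
  calc _ ≤ (1 + w ^ 2) ^ 2 * (1 + w ^ 2) ^ 2 := by gcongr
    _ = (1 + w ^ 2) ^ 4 := by ring
    _ ≤ _ := pow_le_pow_right₀ (by nlinarith [sq_nonneg w]) (by norm_num)

lemma abs_heatGxxxx_le {r : ℝ} (hr : 0 < r) (q : ℝ) :
    (r + q ^ 2) ^ 2 * √(r + q ^ 2) *
      |(3 / (4 * r ^ 2) - 3 * q ^ 2 / (4 * r ^ 3) + q ^ 4 / (16 * r ^ 4)) * heatG r q|
        ≤ 500000 := by
  obtain ⟨s, w, hs, rfl, rfl⟩ := exists_scale hr q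
  rw [sqrt_scale hs, ← abs_of_nonneg (by positivity :
    0 ≤ (s ^ 2 + (s * w) ^ 2) ^ 2 * (s * √(1 + w ^ 2))), ← abs_mul]
  have e : (s ^ 2 + (s * w) ^ 2) ^ 2 * (s * √(1 + w ^ 2)) * ((3 / (4 * (s ^ 2) ^ 2)
      - 3 * (s * w) ^ 2 / (4 * (s ^ 2) ^ 3) + (s * w) ^ 4 / (16 * (s ^ 2) ^ 4))
        * heatG (s ^ 2) (s * w))
      = ((1 + w ^ 2) ^ 2 * √(1 + w ^ 2) * (3 / 4 - 3 * w ^ 2 / 4 + w ^ 4 / 16))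
        * (s * heatG (s ^ 2) (s * w)) := by
    field_simp
  rw [e]
  refine mul_heatG_le hs ?_
  rw [abs_mul, abs_of_nonneg (by positivity)]
  have h1 : |3 / 4 - 3 * w ^ 2 / 4 + w ^ 4 / 16| ≤ (1 + w ^ 2) ^ 2 := by
    rw [abs_le]
    constructor <;> nlinarith [sq_nonneg w, sq_nonneg (w ^ 2)]
  calc _ ≤ (1 + w ^ 2) ^ 2 * (1 + w ^ 2) * (1 + w ^ 2) ^ 2 := by
        gcongr; exact sqrt_one_add_sq_le w
    _ = (1 + w ^ 2) ^ 5 := by ring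

/-- The truncated second space derivative of the heat kernel. -/
noncomputable def heatK (ε N : ℝ) (z : ℝ × ℝ) : ℝ :=
  (Set.Ioo ε N ×ˢ Set.univ).indicator (fun z : ℝ × ℝ => heatGxx z.1 z.2) z

lemma heatK_of_mem {ε N : ℝ} {z : ℝ × ℝ} (h : z.1 ∈ Set.Ioo ε N) :
    heatK ε N z = heatGxx z.1 z.2 := Set.indicator_of_mem (by simpa using h) _

lemma heatK_of_notMem {ε N : ℝ} {z : ℝ × ℝ} (h : z.1 ∉ Set.Ioo ε N) :
    heatK ε N z = 0 := Set.indicator_of_notMem (by simpa using h) _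

lemma measurable_heatK (ε N : ℝ) : Measurable (heatK ε N) :=
  measurable_heatGxx.indicator (measurableSet_Ioo.prod MeasurableSet.univ)

lemma inv_sq_add_sq_eq {l : ℝ} (hl : 0 < l) (q : ℝ) :
    (q ^ 2 + l ^ 2)⁻¹ = (l ^ 2)⁻¹ * (1 + (q / l) ^ 2)⁻¹ := by
  rw [← mul_inv]; congr 1; field_simp; ring

lemma integrable_inv_sq_add_sq {l : ℝ} (hl : 0 < l) :
    Integrable fun q : ℝ => (q ^ 2 + l ^ 2)⁻¹ := by
  simp_rw [inv_sq_add_sq_eq hl]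
  exact (integrable_inv_one_add_sq.comp_div hl.ne').const_mul _

lemma integral_univ_inv_sq_add_sq {l : ℝ} (hl : 0 < l) :
    ∫ q : ℝ, (q ^ 2 + l ^ 2)⁻¹ = Real.pi / l := by
  simp_rw [inv_sq_add_sq_eq hl]
  rw [integral_const_mul, Measure.integral_comp_div (fun q : ℝ => (1 + q ^ 2)⁻¹) l,
    integral_univ_inv_one_add_sq, abs_of_pos hl, smul_eq_mul]
  field_simp

lemma lintegral_inv_sq_add_sq {l c : ℝ} (hl : 0 < l) (hc : 0 ≤ c) :
    ∫⁻ q : ℝ, ENNReal.ofReal (c * (q ^ 2 + l ^ 2)⁻¹) = ENNReal.ofReal (c * (Real.pi / l)) := by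
  rw [← ofReal_integral_eq_lintegral_ofReal ((integrable_inv_sq_add_sq hl).const_mul c)
    (Filter.Eventually.of_forall fun q => by positivity), integral_const_mul,
    integral_univ_inv_sq_add_sq hl]

lemma abs_heatGxx_le_div {r : ℝ} (hr : 0 < r) (q : ℝ) {a b : ℝ} (ha : 0 < a) (hb : 0 < b)
    (hab : a ≤ r + q ^ 2) (hbb : b ^ 2 ≤ r + q ^ 2) :
    |heatGxx r q| ≤ 500000 / (a * b) := by
  have hS : 0 < r + q ^ 2 := by positivity
  have h := abs_heatGxx_le hr q
  have hb' : b ≤ √(r + q ^ 2) := Real.le_sqrt_of_sq_le hbb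
  rw [le_div_iff₀ (by positivity), mul_comm]
  refine le_trans ?_ h
  gcongr

lemma heatK_le {ε N : ℝ} (hε : 0 < ε) (z : ℝ × ℝ) :
    ‖heatK ε N z‖ ≤ (Set.Ioo ε N).indicator (fun _ => 500000 / √ε) z.1
      * (z.2 ^ 2 + (√ε) ^ 2)⁻¹ := by
  by_cases h : z.1 ∈ Set.Ioo ε N
  · have h0 : 0 < √ε := Real.sqrt_pos.2 hε
    rw [heatK_of_mem h, Set.indicator_of_mem h, Real.norm_eq_abs]
    refine (abs_heatGxx_le_div (hε.trans h.1) z.2 (a := z.2 ^ 2 + (√ε) ^ 2) (b := √ε)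
      (by positivity) h0 ?_ ?_).trans (le_of_eq (by field_simp))
    · rw [Real.sq_sqrt hε.le]; linarith [h.1]
    · rw [Real.sq_sqrt hε.le]; nlinarith [h.1]
  · rw [heatK_of_notMem h, Set.indicator_of_notMem h]; simp

lemma heatK_bdd {ε : ℝ} (hε : 0 < ε) (N : ℝ) : ∃ M, ∀ z, ‖heatK ε N z‖ ≤ M := by
  have h0 : 0 < √ε := Real.sqrt_pos.2 hε
  refine ⟨500000 / √ε * ((√ε) ^ 2)⁻¹, fun z => (heatK_le hε z).trans ?_⟩
  have h1 : (z.2 ^ 2 + (√ε) ^ 2)⁻¹ ≤ ((√ε) ^ 2)⁻¹ := by gcongr; nlinarith [sq_nonneg z.2]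
  gcongr
  by_cases h : z.1 ∈ Set.Ioo ε N
  · rw [Set.indicator_of_mem h]
  · rw [Set.indicator_of_notMem h]; positivity

lemma integrable_heatK {ε : ℝ} (hε : 0 < ε) (N : ℝ) : Integrable (heatK ε N) := by
  have h1 : Integrable ((Set.Ioo ε N).indicator fun _ : ℝ => 500000 / √ε) :=
    (integrable_indicator_iff measurableSet_Ioo).2
      (integrableOn_const measure_Ioo_lt_top.ne (by simp))
  exact (h1.mul_prod (integrable_inv_sq_add_sq (Real.sqrt_pos.2 hε))).mono'
    (measurable_heatK ε N).aestronglyMeasurable (Filter.Eventually.of_forall fun z => heatK_le hε z)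

lemma box_geom {l ρ q ξ : ℝ} (hl : 0 < l) (hρ : 0 < ρ) (h : 16 * l ^ 2 < ρ ∨ 4 * l < |q|)
    (hξ : |ξ - q| ≤ l) :
    (ρ + q ^ 2 + l ^ 2) / 4 ≤ ρ + ξ ^ 2 ∧ l ^ 2 ≤ ρ + ξ ^ 2 := by
  have key : 4 * l < |q| → 9 / 16 * q ^ 2 ≤ ξ ^ 2 ∧ 16 * l ^ 2 ≤ q ^ 2 := fun hq => by
    have h1 : 3 / 4 * |q| ≤ |ξ| := by
      have := abs_sub_abs_le_abs_sub q ξ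
      rw [abs_sub_comm] at this
      linarith
    rw [← sq_abs q, ← sq_abs ξ]
    constructor <;> nlinarith [abs_nonneg q, abs_nonneg ξ]
  rcases lt_or_ge (4 * l) |q| with hq | hq
  · obtain ⟨h1, h2⟩ := key hq
    constructor <;> nlinarith [sq_nonneg l]
  · have h1 : 16 * l ^ 2 < ρ := h.resolve_right (not_lt.2 hq)
    have h2 : q ^ 2 ≤ 16 * l ^ 2 := by rw [← sq_abs]; nlinarith [abs_nonneg q]
    constructor <;> nlinarith [sq_nonneg ξ, sq_nonneg l]

lemma heatGxx_sub_le {l r q h₁ h₂ : ℝ} (hl : 0 < l) (hr : 0 < r)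
    (h : 16 * l ^ 2 < r ∨ 4 * l < |q|) (h₁0 : 0 ≤ h₁) (h₁l : h₁ < l ^ 2) (h₂0 : 0 ≤ h₂)
    (h₂l : h₂ < l) :
    |heatGxx (h₁ + r) (h₂ + q) - heatGxx r q|
      ≤ 16000000 * l / (r + q ^ 2 + l ^ 2) ^ 2 := by
  set P := r + q ^ 2 + l ^ 2 with hP
  have hP0 : 0 < P := by positivity
  have hr1 : 0 < h₁ + r := by linarith
  have A1 : ‖heatGxx (h₁ + r) (h₂ + q) - heatGxx (h₁ + r) q‖ ≤ 8000000 / P ^ 2 * ‖h₂ + q - q‖ := by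
    refine (convex_Icc q (h₂ + q)).norm_image_sub_le_of_norm_hasDerivWithin_le
      (fun ξ _ => (hasDerivAt_heatGxx_space hr1 ξ).hasDerivWithinAt) (fun ξ hξ => ?_)
      (Set.left_mem_Icc.2 (by linarith)) (Set.right_mem_Icc.2 (by linarith))
    have hg := (box_geom (ρ := r) (ξ := ξ) hl hr h
      (by rw [abs_le]; constructor <;> linarith [hξ.1, hξ.2])).1
    have hb := abs_heatGxxx_le hr1 ξ
    rw [Real.norm_eq_abs, le_div_iff₀ (by positivity)]
    have h4 : (P / 4) ^ 2 ≤ (h₁ + r + ξ ^ 2) ^ 2 := by gcongr; linarith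
    nlinarith [mul_le_mul_of_nonneg_right h4 (abs_nonneg
      ((3 * ξ / (4 * (h₁ + r) ^ 2) - ξ ^ 3 / (8 * (h₁ + r) ^ 3)) * heatG (h₁ + r) ξ))]
  have A2 : ‖heatGxx (h₁ + r) q - heatGxx r q‖ ≤ 8000000 / (P ^ 2 * l) * ‖h₁ + r - r‖ := by
    refine (convex_Icc r (h₁ + r)).norm_image_sub_le_of_norm_hasDerivWithin_le
      (f := fun ρ => heatGxx ρ q)
      (fun ρ hρ => (hasDerivAt_heatGxx_time (hr.trans_le hρ.1) q).hasDerivWithinAt) (fun ρ hρ => ?_)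
      (Set.left_mem_Icc.2 (by linarith)) (Set.right_mem_Icc.2 (by linarith))
    have hg := box_geom (ρ := r) (ξ := q) hl hr h (by simpa using hl.le)
    have hb := abs_heatGxxxx_le (hr.trans_le hρ.1) q
    rw [Real.norm_eq_abs, le_div_iff₀ (by positivity)]
    have h4 : (P / 4) ^ 2 * l ≤ (ρ + q ^ 2) ^ 2 * √(ρ + q ^ 2) := by
      gcongr
      · linarith [hρ.1, hg.1]
      · exact Real.le_sqrt_of_sq_le (by linarith [hρ.1, hg.2])
    nlinarith [mul_le_mul_of_nonneg_right h4 (abs_nonneg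
      ((3 / (4 * ρ ^ 2) - 3 * q ^ 2 / (4 * ρ ^ 3) + q ^ 4 / (16 * ρ ^ 4)) * heatG ρ q))]
  rw [add_sub_cancel_right, Real.norm_eq_abs, Real.norm_eq_abs, abs_of_nonneg h₂0] at A1
  rw [add_sub_cancel_right, Real.norm_eq_abs, Real.norm_eq_abs, abs_of_nonneg h₁0] at A2
  have A1' : 8000000 / P ^ 2 * h₂ ≤ 8000000 * l / P ^ 2 := by
    rw [div_mul_eq_mul_div]; gcongr
  have A2' : 8000000 / (P ^ 2 * l) * h₁ ≤ 8000000 * l / P ^ 2 := by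
    calc _ ≤ 8000000 / (P ^ 2 * l) * l ^ 2 := by gcongr
      _ = _ := by field_simp
  calc _ ≤ |heatGxx (h₁ + r) (h₂ + q) - heatGxx (h₁ + r) q| + |heatGxx (h₁ + r) q - heatGxx r q| :=
        abs_sub_le _ _ _
    _ ≤ 8000000 * l / P ^ 2 + 8000000 * l / P ^ 2 := by linarith
    _ = _ := by ring

lemma heatGxx_le_of_geom {l ρ q ξ : ℝ} (hl : 0 < l) (hρ : 0 < ρ)
    (h : 16 * l ^ 2 < ρ ∨ 4 * l < |q|) (hξ : |ξ - q| ≤ l) :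
    |heatGxx ρ ξ| ≤ 2000000 / l * (q ^ 2 + l ^ 2)⁻¹ := by
  obtain ⟨h1, h2⟩ := box_geom hl hρ h hξ
  refine (abs_heatGxx_le_div hρ ξ (a := (q ^ 2 + l ^ 2) / 4) (b := l) (by positivity) hl
    (by linarith) h2).trans (le_of_eq ?_)
  field_simp; ring

lemma heatK_sub_le {ε N l : ℝ} (hε : 0 < ε) (hl : 0 < l) {h : ℝ × ℝ} (h₁0 : 0 ≤ h.1)
    (h₁l : h.1 < l ^ 2) (h₂0 : 0 ≤ h.2) (h₂l : h.2 < l) {z : ℝ × ℝ} (hz : z ∈ (bigBox l)ᶜ) :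
    ‖heatK ε N (h + z) - heatK ε N z‖ ≤
      (Set.Ioi 0).indicator (fun r => 16000000 * l / (r + z.2 ^ 2 + l ^ 2) ^ 2) z.1
      + (Set.Ioc (ε - l ^ 2) ε ∪ Set.Ico (N - l ^ 2) N).indicator (fun _ => (1 : ℝ)) z.1
        * (2000000 / l * (z.2 ^ 2 + l ^ 2)⁻¹) := by
  obtain ⟨r, q⟩ := z
  obtain ⟨h₁, h₂⟩ := h
  simp only at h₁0 h₁l h₂0 h₂l ⊢
  have hz' : -l ^ 2 < r → 16 * l ^ 2 < r ∨ 4 * l < |q| := fun hr => by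
    by_contra! hc
    refine hz ⟨⟨?_, hc.1⟩, abs_le.1 hc.2⟩
    nlinarith [sq_nonneg l]
  have n1 : 0 ≤ (Set.Ioi 0).indicator (fun r => 16000000 * l / (r + q ^ 2 + l ^ 2) ^ 2) r :=
    Set.indicator_nonneg (fun r _ => by positivity) r
  have n2 : 0 ≤ (2000000 / l * (q ^ 2 + l ^ 2)⁻¹) := by positivity
  have n3 : 0 ≤ (Set.Ioc (ε - l ^ 2) ε ∪ Set.Ico (N - l ^ 2) N).indicator (fun _ => (1 : ℝ)) r :=
    Set.indicator_nonneg (fun r _ => by positivity) r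
  by_cases a : r ∈ Set.Ioo ε N <;> by_cases b : h₁ + r ∈ Set.Ioo ε N
  · have hr : 0 < r := hε.trans a.1
    rw [heatK_of_mem (z := (r, q)) a, heatK_of_mem (z := (h₁, h₂) + (r, q)) b, Set.indicator_of_mem (by exact hr)]
    refine le_add_of_le_of_nonneg (heatGxx_sub_le hl hr (hz' (by nlinarith [sq_nonneg l])) h₁0 h₁l
      h₂0 h₂l) (by positivity)
  · have hr : 0 < r := hε.trans a.1
    have hJ : r ∈ Set.Ioc (ε - l ^ 2) ε ∪ Set.Ico (N - l ^ 2) N := by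
      refine Or.inr ⟨?_, a.2⟩
      by_contra! hc
      exact b ⟨by linarith [a.1], by linarith⟩
    rw [heatK_of_mem (z := (r, q)) a, heatK_of_notMem (z := (h₁, h₂) + (r, q)) b, Set.indicator_of_mem hJ, zero_sub,
      norm_neg, one_mul]
    exact le_add_of_nonneg_of_le n1 (heatGxx_le_of_geom hl hr (hz' (by nlinarith [sq_nonneg l]))
      (by simpa using hl.le))
  · have hr : 0 < h₁ + r := hε.trans b.1
    have hJ : r ∈ Set.Ioc (ε - l ^ 2) ε ∪ Set.Ico (N - l ^ 2) N := by
      refine Or.inl ⟨by linarith [b.1], ?_⟩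
      by_contra! hc
      exact a ⟨hc, by linarith [b.2]⟩
    rw [heatK_of_mem (z := (h₁, h₂) + (r, q)) b, heatK_of_notMem (z := (r, q)) a, Set.indicator_of_mem hJ, sub_zero,
      one_mul]
    refine le_add_of_nonneg_of_le n1 (heatGxx_le_of_geom hl hr
      ((hz' (by linarith)).imp_left fun h => by simp only [Prod.fst_add]; linarith) ?_)
    simp only [Prod.snd_add, add_sub_cancel_right]
    rw [abs_of_nonneg h₂0]; exact h₂l.le
  · rw [heatK_of_notMem (z := (r, q)) a, heatK_of_notMem (z := (h₁, h₂) + (r, q)) b, sub_zero, norm_zero]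
    positivity

lemma lintegral_Ioi_inv_add_sq {a c : ℝ} (hc : 0 < c) (ha : 0 ≤ a) :
    ∫⁻ r in Set.Ioi (0 : ℝ), ENNReal.ofReal (a / (r + c) ^ 2) = ENNReal.ofReal (a * c⁻¹) := by
  have h1 : IntegrableOn (fun x : ℝ => a * (x + c) ^ (-2 : ℝ)) (Set.Ioi 0) := by
    have := (integrableOn_Ioi_rpow_of_lt (a := (-2 : ℝ)) (c := c) (by norm_num) hc).const_mul a
    have h2 := (measurePreserving_add_right volume c).integrableOn_comp_preimage
      (measurableEmbedding_addRight c) (f := fun x : ℝ => a * x ^ (-2 : ℝ)) (s := Set.Ioi c)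
    rw [Set.preimage_add_const_Ioi, sub_self] at h2
    exact h2.2 this
  have e : ∀ r ∈ Set.Ioi (0 : ℝ), ENNReal.ofReal (a / (r + c) ^ 2)
      = ENNReal.ofReal (a * (r + c) ^ (-2 : ℝ)) := fun r hr => by
    have : 0 < r + c := add_pos hr hc
    rw [Real.rpow_neg this.le, Real.rpow_two, div_eq_mul_inv]
  rw [setLIntegral_congr_fun measurableSet_Ioi e, ← ofReal_integral_eq_lintegral_ofReal h1]
  · congr 1
    rw [integral_const_mul]
    congr 1
    have h2 := (measurePreserving_add_right volume c).setIntegral_preimage_emb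
      (measurableEmbedding_addRight c) (fun x : ℝ => x ^ (-2 : ℝ)) (Set.Ioi c)
    simp only [Set.preimage_add_const_Ioi, sub_self] at h2
    rw [h2, integral_Ioi_rpow_of_lt (by norm_num) hc]
    norm_num
    rw [Real.rpow_neg_one]
  · exact (ae_restrict_mem measurableSet_Ioi).mono fun r hr => by
      have : 0 < r + c := add_pos hr hc
      positivity

lemma hormander_heatK {ε N l : ℝ} (hε : 0 < ε) (hl : 0 < l) {h : ℝ × ℝ} (h₁0 : 0 ≤ h.1)
    (h₁l : h.1 < l ^ 2) (h₂0 : 0 ≤ h.2) (h₂l : h.2 < l) :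
    ∫⁻ z in (bigBox l)ᶜ, ‖heatK ε N (h + z) - heatK ε N z‖ₑ
      ≤ ENNReal.ofReal (20000000 * Real.pi) := by
  set J := Set.Ioc (ε - l ^ 2) ε ∪ Set.Ico (N - l ^ 2) N with hJ
  have hJm : MeasurableSet J := measurableSet_Ioc.union measurableSet_Ico
  have hJv : volume J ≤ ENNReal.ofReal (2 * l ^ 2) := by
    refine (measure_union_le _ _).trans ?_
    rw [Real.volume_Ioc, Real.volume_Ico, ← ENNReal.ofReal_add (by nlinarith [sq_nonneg l])
      (by nlinarith [sq_nonneg l])]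
    exact ENNReal.ofReal_le_ofReal (by linarith)
  set F1 : ℝ × ℝ → ℝ≥0∞ := fun z =>
    (Set.Ioi 0).indicator (fun r => ENNReal.ofReal (16000000 * l / (r + (z.2 ^ 2 + l ^ 2)) ^ 2)) z.1
  set F2 : ℝ × ℝ → ℝ≥0∞ := fun z => J.indicator (fun _ => (1 : ℝ≥0∞)) z.1
        * ENNReal.ofReal (2000000 / l * (z.2 ^ 2 + l ^ 2)⁻¹)
  have hF1m : Measurable F1 := by
    have : F1 = (Set.Ioi (0 : ℝ) ×ˢ (Set.univ : Set ℝ)).indicator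
        (fun z : ℝ × ℝ => ENNReal.ofReal (16000000 * l / (z.1 + (z.2 ^ 2 + l ^ 2)) ^ 2)) := by
      ext z; simp [F1, Set.indicator]
    rw [this]
    exact Measurable.indicator (by fun_prop) (measurableSet_Ioi.prod MeasurableSet.univ)
  have hpt : ∀ z ∈ (bigBox l)ᶜ, ‖heatK ε N (h + z) - heatK ε N z‖ₑ ≤ F1 z + F2 z := by
    intro z hz
    have := heatK_sub_le (N := N) hε hl h₁0 h₁l h₂0 h₂l hz
    rw [← ofReal_norm]
    refine (ENNReal.ofReal_le_ofReal this).trans (ENNReal.ofReal_add_le.trans ?_)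
    refine add_le_add ?_ ?_
    · by_cases hr : z.1 ∈ Set.Ioi (0 : ℝ)
      · simp only [F1, Set.indicator_of_mem hr]; rw [add_assoc]
      · simp [F1, Set.indicator_of_notMem hr]
    · by_cases hr : z.1 ∈ J
      · simp only [F2]
        rw [Set.indicator_of_mem hr, Set.indicator_of_mem hr, one_mul, one_mul]
      · rw [Set.indicator_of_notMem hr]; simp
  calc _ ≤ ∫⁻ z in (bigBox l)ᶜ, (F1 z + F2 z) :=
        setLIntegral_mono' (measurableSet_bigBox l).compl hpt
    _ ≤ ∫⁻ z, (F1 z + F2 z) := setLIntegral_le_lintegral _ _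
    _ = (∫⁻ z, F1 z) + ∫⁻ z, F2 z := lintegral_add_left hF1m _
    _ ≤ ENNReal.ofReal (16000000 * Real.pi) + ENNReal.ofReal (4000000 * Real.pi) := by
        refine add_le_add (le_of_eq ?_) ?_
        · rw [Measure.volume_eq_prod, lintegral_prod_symm _ hF1m.aemeasurable]
          have : ∀ q : ℝ, ∫⁻ r, F1 (r, q)
              = ENNReal.ofReal (16000000 * l * (q ^ 2 + l ^ 2)⁻¹) := fun q => by
            simp only [F1]
            rw [lintegral_indicator measurableSet_Ioi,
              lintegral_Ioi_inv_add_sq (by positivity) (by positivity)]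
          simp_rw [this]
          rw [lintegral_inv_sq_add_sq hl (by positivity)]
          congr 1; field_simp
        · rw [Measure.volume_eq_prod, lintegral_prod_mul
            (f := fun r => J.indicator (fun _ => (1 : ℝ≥0∞)) r)
            (g := fun q : ℝ => ENNReal.ofReal (2000000 / l * (q ^ 2 + l ^ 2)⁻¹))
            (by exact (measurable_const.indicator hJm).aemeasurable) (by fun_prop),
            lintegral_inv_sq_add_sq hl (by positivity), lintegral_indicator hJm, setLIntegral_one]
          refine (mul_le_mul_left hJv _).trans (le_of_eq ?_)
          rw [← ENNReal.ofReal_mul (by positivity)]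
          congr 1; field_simp; ring
    _ = _ := by
        rw [← ENNReal.ofReal_add (by positivity) (by positivity)]; congr 1; ring

lemma heatG_eq_gaussianPDFReal {r : ℝ} (hr : 0 < r) (q : ℝ) :
    heatG r q = ProbabilityTheory.gaussianPDFReal 0 (2 * r).toNNReal q := by
  rw [ProbabilityTheory.gaussianPDFReal_def, heatG, Real.coe_toNNReal _ (by positivity)]
  congr 2
  · congr 1; ring
  · rw [sub_zero, neg_div]; congr 2; ring

lemma heatG_even (r q : ℝ) : heatG r (-q) = heatG r q := by simp [heatG]

lemma heatGxx_even (r q : ℝ) : heatGxx r (-q) = heatGxx r q := by simp [heatGxx, heatG]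

lemma toNNReal_two_mul_ne_zero {r : ℝ} (hr : 0 < r) : (2 * r).toNNReal ≠ 0 := by
  simpa using hr

lemma integrable_heatG {r : ℝ} (hr : 0 < r) : Integrable (heatG r) := by
  rw [funext (heatG_eq_gaussianPDFReal hr)]
  exact ProbabilityTheory.integrable_gaussianPDFReal _ _

lemma integral_heatG {r : ℝ} (hr : 0 < r) : ∫ q, heatG r q = 1 := by
  simp_rw [heatG_eq_gaussianPDFReal hr]
  exact ProbabilityTheory.integral_gaussianPDFReal_eq_one _ (toNNReal_two_mul_ne_zero hr)

lemma integral_heatG_mul {r : ℝ} (hr : 0 < r) (φ : ℝ → ℝ) :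
    ∫ q, heatG r q * φ q = ∫ q, φ q ∂(ProbabilityTheory.gaussianReal 0 (2 * r).toNNReal) := by
  rw [ProbabilityTheory.integral_gaussianReal_eq_integral_smul (toNNReal_two_mul_ne_zero hr)]
  simp_rw [heatG_eq_gaussianPDFReal hr, smul_eq_mul]

lemma integrable_heatG_mul {r : ℝ} (hr : 0 < r) {φ : ℝ → ℝ} (h : Integrable φ
    (ProbabilityTheory.gaussianReal 0 (2 * r).toNNReal)) :
    Integrable fun q => heatG r q * φ q := by
  rw [ProbabilityTheory.gaussianReal_of_var_ne_zero _ (toNNReal_two_mul_ne_zero hr)] at h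
  rw [integrable_withDensity_iff (ProbabilityTheory.measurable_gaussianPDF _ _)
    (Filter.Eventually.of_forall fun _ => ProbabilityTheory.gaussianPDF_lt_top)] at h
  refine h.congr (Filter.Eventually.of_forall fun q => ?_)
  simp only [ProbabilityTheory.toReal_gaussianPDF, heatG_eq_gaussianPDFReal hr]
  ring

lemma integrable_sq_gaussian (v : NNReal) :
    Integrable (fun q : ℝ => q ^ 2) (ProbabilityTheory.gaussianReal 0 v) :=
  (ProbabilityTheory.memLp_id_gaussianReal (μ := 0) (v := v) 2).integrable_sq

lemma integral_sq_gaussian (v : NNReal) :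
    ∫ q : ℝ, q ^ 2 ∂(ProbabilityTheory.gaussianReal 0 v) = v := by
  have h := ProbabilityTheory.variance_id_gaussianReal (μ := 0) (v := v)
  rw [ProbabilityTheory.variance_of_integral_eq_zero measurable_id.aemeasurable
    (by simp [ProbabilityTheory.integral_id_gaussianReal])] at h
  simpa using h

lemma integral_heatG_mul_sq {r : ℝ} (hr : 0 < r) : ∫ q, heatG r q * q ^ 2 = 2 * r := by
  rw [integral_heatG_mul hr, integral_sq_gaussian, Real.coe_toNNReal _ (by positivity)]

lemma heatG_mul_heatG {s : ℝ} (hs : 0 < s) (d w : ℝ) :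
    heatG s (d / 2 + w) * heatG s (d / 2 - w) = heatG (2 * s) d * heatG (s / 2) w := by
  unfold heatG
  have h1 : (√(4 * Real.pi * s))⁻¹ * (√(4 * Real.pi * s))⁻¹
      = (√(4 * Real.pi * (2 * s)))⁻¹ * (√(4 * Real.pi * (s / 2)))⁻¹ := by
    rw [← mul_inv, ← mul_inv, ← Real.sqrt_mul (by positivity), ← Real.sqrt_mul (by positivity)]
    congr 2; ring
  have h2 : Real.exp (-((d / 2 + w) ^ 2 / (4 * s))) * Real.exp (-((d / 2 - w) ^ 2 / (4 * s)))
      = Real.exp (-(d ^ 2 / (4 * (2 * s)))) * Real.exp (-(w ^ 2 / (4 * (s / 2)))) := by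
    rw [← Real.exp_add, ← Real.exp_add]
    congr 1; field_simp; ring
  calc _ = ((√(4 * Real.pi * s))⁻¹ * (√(4 * Real.pi * s))⁻¹) *
        (Real.exp (-((d / 2 + w) ^ 2 / (4 * s))) * Real.exp (-((d / 2 - w) ^ 2 / (4 * s)))) := by
        ring
    _ = _ := by rw [h1, h2]; ring

/-- First space derivative of the heat kernel. -/
noncomputable def heatGx (r q : ℝ) : ℝ := -(q / (2 * r)) * heatG r q

lemma continuous_heatG (r : ℝ) : Continuous (heatG r) := by
  unfold heatG; fun_prop

lemma continuous_heatGx (r : ℝ) : Continuous (heatGx r) := by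
  unfold heatGx
  exact Continuous.mul (by fun_prop) (continuous_heatG r)

lemma continuous_heatGxx (r : ℝ) : Continuous (heatGxx r) := by
  unfold heatGxx
  exact Continuous.mul (by fun_prop) (continuous_heatG r)

lemma integral_heatGx_mul {s : ℝ} (hs : 0 < s) (x y : ℝ) :
    ∫ z, heatGx s (x - z) * heatGx s (y - z) = -heatGxx (2 * s) (y - x) := by
  set d := y - x with hd
  have h0 : ∀ w, heatGx s (x - (w + (x + y) / 2)) * heatGx s (y - (w + (x + y) / 2))
      = -(1 / (4 * s ^ 2)) * heatG (2 * s) d *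
        (d ^ 2 / 4 * heatG (s / 2) w - heatG (s / 2) w * w ^ 2) := by
    intro w
    have e1 : x - (w + (x + y) / 2) = -(d / 2 + w) := by rw [hd]; ring
    have e2 : y - (w + (x + y) / 2) = d / 2 - w := by rw [hd]; ring
    rw [e1, e2, heatGx, heatGx, heatG_even]
    have := heatG_mul_heatG hs d w
    calc _ = -((d / 2 + w) * (d / 2 - w) / (4 * s ^ 2)) *
          (heatG s (d / 2 + w) * heatG s (d / 2 - w)) := by field_simp; ring
      _ = _ := by rw [this]; field_simp; ring
  rw [← integral_add_right_eq_self _ ((x + y) / 2)]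
  simp_rw [h0]
  have hs2 : 0 < s / 2 := by positivity
  rw [integral_const_mul, integral_sub ((integrable_heatG hs2).const_mul _)
    (integrable_heatG_mul hs2 (integrable_sq_gaussian _)), integral_const_mul,
    integral_heatG hs2, integral_heatG_mul_sq hs2, heatGxx]
  field_simp
  ring

lemma integrable_heatGx {s : ℝ} (hs : 0 < s) : Integrable (heatGx s) := by
  have h : Integrable (fun q => heatG s q * (-(q / (2 * s)))) := by
    refine integrable_heatG_mul hs ?_
    have := (ProbabilityTheory.memLp_id_gaussianReal (μ := 0) (v := (2 * s).toNNReal) 1).integrable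
      (by simp)
    exact (this.div_const _).neg
  exact h.congr (Filter.Eventually.of_forall fun q => by simp only [heatGx]; ring)

lemma integrable_heatGxx {r : ℝ} (hr : 0 < r) : Integrable (heatGxx r) := by
  have h : Integrable (fun q => heatG r q * (q ^ 2 / (4 * r ^ 2) - 1 / (2 * r))) := by
    refine integrable_heatG_mul hr ?_
    exact ((integrable_sq_gaussian _).div_const _).sub (integrable_const _)
  exact h.congr (Filter.Eventually.of_forall fun q => by simp only [heatGxx]; ring)

lemma heatGx_bdd {s : ℝ} (hs : 0 < s) : ∃ M, ∀ q, ‖heatGx s q‖ ≤ M := by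
  refine ⟨500000 / s, fun q => ?_⟩
  obtain ⟨σ, w, hσ, rfl, rfl⟩ := exists_scale hs q
  have h := mul_heatG_le (w := w) (c := -(w / 2)) hσ (by
    rw [abs_neg, abs_div, abs_two]
    have h1 : |w| ≤ 1 + w ^ 2 := by
      rw [← sq_abs]; nlinarith [sq_nonneg (|w| - 1), abs_nonneg w]
    have h2 : 1 + w ^ 2 ≤ (1 + w ^ 2) ^ 5 := le_self_pow₀ (by nlinarith) (by norm_num)
    linarith [abs_nonneg w])
  rw [Real.norm_eq_abs, le_div_iff₀ hs, ← abs_of_pos hs, ← abs_mul, abs_of_pos hs]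
  refine le_trans (le_of_eq ?_) h
  congr 1
  rw [heatGx]; field_simp

lemma integral_heatGxx_autocorr_nonneg {r : ℝ} (hr : 0 < r) {u : ℝ → ℝ}
    (hi : Integrable u) : 0 ≤ ∫ x, ∫ q, -heatGxx r q * (u (x + q) * u x) := by
  set s := r / 2 with hs
  have hs0 : 0 < s := by positivity
  obtain ⟨M, hM⟩ := heatGx_bdd hs0
  have hm := (continuous_heatGx s).measurable
  have h_int : Integrable (fun p : (ℝ × ℝ) × ℝ =>
      (heatGx s (p.1.1 - p.2) * u p.1.1) * (heatGx s (p.1.2 - p.2) * u p.1.2))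
      ((volume.prod volume).prod volume) := by
    have h1 : Integrable (fun p : (ℝ × ℝ) × ℝ => (u p.1.1 * u p.1.2) * heatGx s p.2)
        ((volume.prod volume).prod volume) := (hi.mul_prod hi).mul_prod (integrable_heatGx hs0)
    have h2 : MeasurePreserving (fun p : (ℝ × ℝ) × ℝ => (p.1, p.1.1 - p.2))
        ((volume.prod volume).prod volume) ((volume.prod volume).prod volume) := by
      refine (MeasurePreserving.id (volume.prod volume)).skew_product (g := fun a b => a.1 - b)
        (by fun_prop) (Filter.Eventually.of_forall fun a => ?_)
      exact (Measure.measurePreserving_sub_left volume a.1).map_eq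
    have h3 := h2.integrable_comp_of_integrable h1
    refine (h3.bdd_mul (c := M) (f := fun p => heatGx s (p.1.2 - p.2))
      (hm.comp (by fun_prop)).aestronglyMeasurable (Filter.Eventually.of_forall fun p => hM _)).congr
      (Filter.Eventually.of_forall fun p => ?_)
    simp only [Function.comp_apply]
    ring
  have key : ∫ x, ∫ q, -heatGxx r q * (u (x + q) * u x)
      = ∫ z, (∫ x, heatGx s (x - z) * u x) * (∫ x, heatGx s (x - z) * u x) := by
    have h1 := integral_prod _ h_int
    have h2 := integral_prod_symm _ h_int
    rw [h1, integral_prod _ h_int.integral_prod_left] at h2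
    calc _ = ∫ x, ∫ y, -heatGxx r (y - x) * (u y * u x) := by
          congr 1; ext x
          rw [← integral_add_left_eq_self (fun y => -heatGxx r (y - x) * (u y * u x)) x]
          simp only [add_sub_cancel_left]
      _ = _ := by
          rw [show r = 2 * s by rw [hs]; ring]
          simp_rw [← integral_heatGx_mul hs0, ← integral_mul_const]
          convert h2 using 3
          · congr 1; ext y
            congr 1; ext z
            simp only; ring
          · rename_i z
            rw [integral_mul_const]
            exact (integral_prod_mul (μ := volume) (ν := volume) (fun x => heatGx s (x - z) * u x)
              (fun x => heatGx s (x - z) * u x)).symm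
  rw [key]
  exact integral_nonneg fun z => mul_self_nonneg _

/-- The correlation of two functions under translation in the second variable. -/
noncomputable def corr (φ ψ : ℝ × ℝ → ℝ) (q : ℝ) : ℝ := ∫ z, φ (z + (0, q)) * ψ z

lemma integrable_shift_mul {φ ψ : ℝ × ℝ → ℝ} (hφ : Measurable φ) (hφb : ∃ M, ∀ z, ‖φ z‖ ≤ M)
    (hψi : Integrable ψ) (a : ℝ × ℝ) : Integrable fun z => φ (z + a) * ψ z := by
  obtain ⟨M, hM⟩ := hφb
  exact hψi.bdd_mul (c := M) (hφ.comp (measurable_id.add_const a)).aestronglyMeasurable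
    (Filter.Eventually.of_forall fun z => hM _)

lemma measurable_corr {φ ψ : ℝ × ℝ → ℝ} (hφ : Measurable φ) (hψ : Measurable ψ) :
    Measurable (corr φ ψ) := by
  have : StronglyMeasurable (Function.uncurry fun (q : ℝ) (z : ℝ × ℝ) => φ (z + (0, q)) * ψ z) := by
    refine Measurable.stronglyMeasurable ?_
    exact (hφ.comp (by fun_prop)).mul (hψ.comp measurable_snd)
  exact this.integral_prod_right.measurable

lemma corr_bdd {φ ψ : ℝ × ℝ → ℝ} (hφb : ∃ M, ∀ z, ‖φ z‖ ≤ M)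
    (hψi : Integrable ψ) : ∃ M, ∀ q, ‖corr φ ψ q‖ ≤ M := by
  obtain ⟨M, hM⟩ := hφb
  refine ⟨∫ z, M * ‖ψ z‖, fun q => ?_⟩
  refine norm_integral_le_of_norm_le (hψi.norm.const_mul M) (Filter.Eventually.of_forall fun z => ?_)
  rw [norm_mul]
  exact mul_le_mul_of_nonneg_right (hM _) (norm_nonneg _)

lemma corr_symm (φ ψ : ℝ × ℝ → ℝ) (q : ℝ) : corr φ ψ (-q) = corr ψ φ q := by
  unfold corr
  rw [← integral_add_right_eq_self (fun z => φ (z + (0, -q)) * ψ z) ((0, q) : ℝ × ℝ)]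
  congr 1; ext z
  have : z + (0, q) + (0, -q) = z := by ext <;> simp
  simp only [this]; ring

lemma corr_sub {φ ψ : ℝ × ℝ → ℝ} (hφ : Measurable φ) (hφi : Integrable φ)
    (hφb : ∃ M, ∀ z, ‖φ z‖ ≤ M) (hψ : Measurable ψ) (hψi : Integrable ψ)
    (hψb : ∃ M, ∀ z, ‖ψ z‖ ≤ M) (q : ℝ) :
    corr (fun z => φ z - ψ z) (fun z => φ z - ψ z) q
      = corr φ φ q + corr ψ ψ q - (corr φ ψ q + corr ψ φ q) := by
  unfold corr
  have i1 := integrable_shift_mul hφ hφb hφi (0, q)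
  have i2 := integrable_shift_mul hψ hψb hψi (0, q)
  have i3 := integrable_shift_mul hφ hφb hψi (0, q)
  have i4 := integrable_shift_mul hψ hψb hφi (0, q)
  rw [← integral_add i1 i2, ← integral_add i3 i4, ← integral_sub]
  · congr 1; ext z; ring
  · exact i1.add i2
  · exact i3.add i4

lemma abs_corr_self_le {u : ℝ × ℝ → ℝ} (hu2 : Integrable fun z => u z ^ 2) (q : ℝ) :
    |corr u u q| ≤ ∫ z, u z ^ 2 := by
  have h := hu2.comp_add_right (0, q)
  have e : ∫ z, u (z + (0, q)) ^ 2 = ∫ z, u z ^ 2 :=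
    integral_add_right_eq_self (fun z => u z ^ 2) ((0, q) : ℝ × ℝ)
  calc |corr u u q| ≤ ∫ z, (u (z + (0, q)) ^ 2 + u z ^ 2) / 2 := by
        rw [← Real.norm_eq_abs, corr]
        refine norm_integral_le_of_norm_le ((h.add hu2).div_const 2)
          (Filter.Eventually.of_forall fun z => ?_)
        rw [Real.norm_eq_abs, abs_le]
        constructor <;> nlinarith [sq_nonneg (u (z + (0, q)) - u z), sq_nonneg (u (z + (0, q)) + u z)]
    _ = _ := by
        rw [integral_div, integral_add h hu2, e]; ring

lemma integral_heatGxx_corr_self_nonneg {r : ℝ} (hr : 0 < r) {u : ℝ × ℝ → ℝ} (hu : Measurable u)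
    (hi : Integrable u) (hb : ∃ M, ∀ z, ‖u z‖ ≤ M) : 0 ≤ ∫ q, -heatGxx r q * corr u u q := by
  obtain ⟨M, hM⟩ := hb
  have hm := (continuous_heatGxx r).measurable
  have h_int : Integrable (fun p : ℝ × (ℝ × ℝ) =>
      -heatGxx r p.1 * (u (p.2 + (0, p.1)) * u p.2)) (volume.prod volume) := by
    have h1 : Integrable (fun p : ℝ × (ℝ × ℝ) => -heatGxx r p.1 * u p.2) (volume.prod volume) :=
      (integrable_heatGxx hr).neg.mul_prod hi
    refine (h1.bdd_mul (c := M) (f := fun p => u (p.2 + (0, p.1)))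
      (hu.comp (by fun_prop)).aestronglyMeasurable
      (Filter.Eventually.of_forall fun p => hM _)).congr (Filter.Eventually.of_forall fun p => ?_)
    simp only; ring
  have h1 := integral_prod _ h_int
  have h2 := integral_prod_symm _ h_int
  have h3 : ∫ q, -heatGxx r q * corr u u q
      = ∫ z : ℝ × ℝ, ∫ q, -heatGxx r q * (u (z + (0, q)) * u z) := by
    rw [← h2, h1]
    simp only [corr, integral_const_mul]
  rw [h3, Measure.volume_eq_prod, integral_prod _ h_int.integral_prod_right]
  refine integral_nonneg_of_ae ?_
  filter_upwards [hi.prod_right_ae] with t ht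
  have := integral_heatGxx_autocorr_nonneg hr (u := fun x => u (t, x)) ht
  simpa using this

lemma integrable_heatGxx_corr {r : ℝ} (hr : 0 < r) {φ ψ : ℝ × ℝ → ℝ} (hφ : Measurable φ)
    (hφb : ∃ M, ∀ z, ‖φ z‖ ≤ M) (hψ : Measurable ψ) (hψi : Integrable ψ) :
    Integrable fun q => heatGxx r q * corr φ ψ q := by
  obtain ⟨M, hM⟩ := corr_bdd hφb hψi
  exact (integrable_heatGxx hr).mul_bdd (c := M) (measurable_corr hφ hψ).aestronglyMeasurable
    (Filter.Eventually.of_forall hM)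

lemma integral_heatGxx_corr_le {r : ℝ} (hr : 0 < r) {φ ψ : ℝ × ℝ → ℝ} (hφ : Measurable φ)
    (hφi : Integrable φ) (hφb : ∃ M, ∀ z, ‖φ z‖ ≤ M) (hψ : Measurable ψ) (hψi : Integrable ψ)
    (hψb : ∃ M, ∀ z, ‖ψ z‖ ≤ M) :
    -∫ q, heatGxx r q * corr φ ψ q
      ≤ -((∫ q, heatGxx r q * corr φ φ q) + ∫ q, heatGxx r q * corr ψ ψ q) / 2 := by
  have hsub := integral_heatGxx_corr_self_nonneg hr (u := fun z => φ z - ψ z) (hφ.sub hψ)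
    (hφi.sub hψi) (by
      obtain ⟨M, hM⟩ := hφb; obtain ⟨L, hL⟩ := hψb
      exact ⟨M + L, fun z => (norm_sub_le _ _).trans (add_le_add (hM z) (hL z))⟩)
  have i1 := integrable_heatGxx_corr hr hφ hφb hφ hφi
  have i2 := integrable_heatGxx_corr hr hψ hψb hψ hψi
  have i3 := integrable_heatGxx_corr hr hφ hφb hψ hψi
  have i4 := integrable_heatGxx_corr hr hψ hψb hφ hφi
  have hs : ∫ q, heatGxx r q * corr ψ φ q = ∫ q, heatGxx r q * corr φ ψ q := by
    rw [← integral_neg_eq_self]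
    simp_rw [heatGxx_even, corr_symm]
  simp_rw [corr_sub hφ hφi hφb hψ hψi hψb] at hsub
  have e : ∫ q, -heatGxx r q * (corr φ φ q + corr ψ ψ q - (corr φ ψ q + corr ψ φ q))
      = -((∫ q, heatGxx r q * corr φ φ q) + ∫ q, heatGxx r q * corr ψ ψ q)
        + ((∫ q, heatGxx r q * corr φ ψ q) + ∫ q, heatGxx r q * corr ψ φ q) := by
    rw [← integral_add i1 i2, ← integral_add i3 i4, ← integral_neg, ← integral_add]
    · congr 1; ext q; ring
    · exact (i1.add i2).neg
    · exact i3.add i4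
  rw [e, hs] at hsub
  linarith

lemma integral_heatK_time {ε N : ℝ} (hε : 0 < ε) (hN : ε ≤ N) (q : ℝ) :
    ∫ r, heatK ε N (r, q) = heatG N q - heatG ε q := by
  have hd : ∀ r ∈ Set.uIcc ε N, HasDerivAt (fun r => heatG r q) (heatGxx r q) r := by
    intro r hr
    rw [Set.uIcc_of_le hN] at hr
    exact hasDerivAt_heatG_time (hε.trans_le hr.1) q
  have hc : ContinuousOn (fun r => heatGxx r q) (Set.uIcc ε N) := by
    intro r hr
    rw [Set.uIcc_of_le hN] at hr
    exact (hasDerivAt_heatGxx_time (hε.trans_le hr.1) q).continuousAt.continuousWithinAt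
  rw [← intervalIntegral.integral_eq_sub_of_hasDerivAt hd hc.intervalIntegrable,
    intervalIntegral.integral_of_le hN, integral_Ioc_eq_integral_Ioo, ← integral_indicator measurableSet_Ioo]
  congr 1; ext r
  by_cases h : r ∈ Set.Ioo ε N
  · rw [Set.indicator_of_mem h, heatK_of_mem h]
  · rw [Set.indicator_of_notMem h, heatK_of_notMem h]

lemma czop_eq_integral_add (K f : ℝ × ℝ → ℝ) (z : ℝ × ℝ) :
    czop K f z = ∫ w, K w * f (z + w) := by
  unfold czop
  rw [← integral_add_left_eq_self (fun w => K (w - z) * f w) z]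
  simp only [add_sub_cancel_left]

lemma integral_heatK_corr_self {ε N : ℝ} (hε : 0 < ε) (hN : ε ≤ N) {u : ℝ × ℝ → ℝ}
    (hu : Measurable u) (hi : Integrable u) (hb : ∃ M, ∀ z, ‖u z‖ ≤ M) :
    Integrable (fun w : ℝ × ℝ => heatK ε N w * corr u u w.2) ∧
      -∫ w : ℝ × ℝ, heatK ε N w * corr u u w.2 ≤ 2 * ∫ z, u z ^ 2 := by
  obtain ⟨L, hL⟩ := corr_bdd hb hi
  have h_int : Integrable (fun w : ℝ × ℝ => heatK ε N w * corr u u w.2) :=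
    (integrable_heatK hε N).mul_bdd (c := L) ((measurable_corr hu hu).comp
      measurable_snd).aestronglyMeasurable (Filter.Eventually.of_forall fun w => hL _)
  refine ⟨h_int, ?_⟩
  have hu2 : Integrable fun z => u z ^ 2 := by
    obtain ⟨M, hM⟩ := hb
    simp_rw [sq]
    exact hi.mul_bdd (c := M) hu.aestronglyMeasurable (Filter.Eventually.of_forall hM)
  have hN0 : 0 < N := hε.trans_le hN
  set S := ∫ z, u z ^ 2 with hS
  rw [Measure.volume_eq_prod, integral_prod_symm _ h_int]
  simp_rw [integral_mul_const, integral_heatK_time hε hN]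
  rw [← integral_neg]
  have e : 2 * S = ∫ q, (heatG N q + heatG ε q) * S := by
    rw [integral_mul_const, integral_add (integrable_heatG hN0) (integrable_heatG hε),
      integral_heatG hN0, integral_heatG hε]
    norm_num
  rw [e]
  have hc : ∀ q, ‖corr u u q‖ ≤ S := fun q => abs_corr_self_le hu2 q
  refine integral_mono ?_ (((integrable_heatG hN0).add (integrable_heatG hε)).mul_const _)
    fun q => ?_
  · exact (((integrable_heatG hN0).sub (integrable_heatG hε)).mul_bdd (c := S)
      (measurable_corr hu hu).aestronglyMeasurable (Filter.Eventually.of_forall hc)).neg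
  · have h1 := abs_le.1 (hc q)
    have h2 := heatG_pos hN0 q
    have h3 := heatG_pos hε q
    simp only
    nlinarith

lemma neg_integral_czop_heatK_mul_le {ε N : ℝ} (hε : 0 < ε) (hN : ε ≤ N) {g h : ℝ × ℝ → ℝ}
    (hg : Measurable g) (hgi : Integrable g) (hgb : ∃ M, ∀ z, ‖g z‖ ≤ M)
    (hh : Measurable h) (hhi : Integrable h) (hhb : ∃ M, ∀ z, ‖h z‖ ≤ M) :
    -∫ z, czop (heatK ε N) g z * h z ≤ (∫ z, g z ^ 2) + ∫ z, h z ^ 2 := by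
  set K := heatK ε N with hK
  obtain ⟨M, hM⟩ := hgb
  have h_int : Integrable (fun p : (ℝ × ℝ) × (ℝ × ℝ) => K p.2 * (g (p.1 + p.2) * h p.1))
      (volume.prod volume) := by
    have h1 : Integrable (fun p : (ℝ × ℝ) × (ℝ × ℝ) => h p.1 * K p.2) (volume.prod volume) :=
      hhi.mul_prod (integrable_heatK hε N)
    refine (h1.bdd_mul (c := M) (f := fun p => g (p.1 + p.2))
      (hg.comp (by fun_prop)).aestronglyMeasurable
      (Filter.Eventually.of_forall fun p => hM _)).congr (Filter.Eventually.of_forall fun p => ?_)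
    simp only; ring
  have e1 : ∫ z, czop K g z * h z = ∫ w, K w * ∫ z, g (z + w) * h z := by
    calc _ = ∫ z, ∫ w, K w * (g (z + w) * h z) := by
          congr 1; ext z
          rw [czop_eq_integral_add, ← integral_mul_const]
          congr 1; ext w; ring
      _ = ∫ w, ∫ z, K w * (g (z + w) * h z) := by
          rw [← integral_prod _ h_int, integral_prod_symm _ h_int]
      _ = _ := by simp_rw [integral_const_mul]
  have hint2 : Integrable (fun w => K w * ∫ z, g (z + w) * h z) := by
    simpa only [integral_const_mul] using h_int.integral_prod_right
  obtain ⟨ig, bg⟩ := integral_heatK_corr_self hε hN hg hgi ⟨M, hM⟩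
  obtain ⟨ih, bh⟩ := integral_heatK_corr_self hε hN hh hhi hhb
  have e2 : -∫ w, K w * ∫ z, g (z + w) * h z
      ≤ -((∫ w : ℝ × ℝ, K w * corr g g w.2) + ∫ w : ℝ × ℝ, K w * corr h h w.2) / 2 := by
    rw [Measure.volume_eq_prod] at *
    rw [integral_prod _ hint2, integral_prod _ ig, integral_prod _ ih,
      ← integral_add ig.integral_prod_left ih.integral_prod_left, neg_div, ← integral_div,
      ← integral_neg, ← integral_neg]
    refine integral_mono hint2.integral_prod_left.neg
      ((ig.integral_prod_left.add ih.integral_prod_left).div_const 2).neg fun r => ?_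
    by_cases hr : r ∈ Set.Ioo ε N
    · have hr0 : 0 < r := hε.trans hr.1
      have e3 : ∀ q, heatK ε N (r, q) = heatGxx r q := fun q => heatK_of_mem (z := (r, q)) hr
      have := integral_heatGxx_corr_le hr0 (φ := fun z => g (z + (r, 0))) (ψ := h)
        (hg.comp (by fun_prop)) (hgi.comp_add_right _) ⟨M, fun z => hM _⟩ hh hhi hhb
      have e4 : ∀ q, corr (fun z => g (z + (r, 0))) (fun z => g (z + (r, 0))) q = corr g g q := by
        intro q
        unfold corr
        rw [← integral_add_right_eq_self (fun z => g (z + (0, q)) * g z) ((r, 0) : ℝ × ℝ)]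
        congr 1; ext z
        rw [add_right_comm]
      have e5 : ∀ q, corr (fun z => g (z + (r, 0))) h q = ∫ z, g (z + (r, q)) * h z := by
        intro q
        unfold corr
        congr 1; ext z
        simp [add_assoc]
      simp only [hK, e3]
      simp only [e4, e5] at this
      rw [← neg_div]; exact this
    · have e3 : ∀ q, heatK ε N (r, q) = 0 := fun q => heatK_of_notMem (z := (r, q)) hr
      simp [hK, e3]
  rw [e1]
  linarith

lemma heatK_l2 {ε N : ℝ} (hε : 0 < ε) (hN : ε ≤ N) {g : ℝ × ℝ → ℝ}
    (hg : Measurable g) (hgi : Integrable g) (hgb : ∃ M, ∀ z, ‖g z‖ ≤ M) :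
    ∫⁻ z, ‖czop (heatK ε N) g z‖ₑ ^ 2 ≤ ENNReal.ofReal 4 * ∫⁻ z, ‖g z‖ₑ ^ 2 := by
  set T := czop (heatK ε N) g with hT
  obtain ⟨M, hM⟩ := hgb
  have hTm : Measurable T := by
    have : StronglyMeasurable (Function.uncurry fun z w : ℝ × ℝ => heatK ε N (w - z) * g w) :=
      (((measurable_heatK ε N).comp (measurable_snd.sub measurable_fst)).mul
        (hg.comp measurable_snd)).stronglyMeasurable
    exact this.integral_prod_right.measurable
  have hTb : ∃ B, ∀ z, ‖T z‖ ≤ B := by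
    refine ⟨∫ w, ‖heatK ε N w‖ * M, fun z => ?_⟩
    rw [hT, czop_eq_integral_add]
    refine norm_integral_le_of_norm_le ((integrable_heatK hε N).norm.mul_const M)
      (Filter.Eventually.of_forall fun w => ?_)
    rw [norm_mul]
    exact mul_le_mul_of_nonneg_left (hM _) (norm_nonneg _)
  have hsq : ∀ {φ : ℝ × ℝ → ℝ}, Integrable (fun z => φ z ^ 2) →
      ∫⁻ z, ‖φ z‖ₑ ^ 2 = ENNReal.ofReal (∫ z, φ z ^ 2) := by
    intro φ hφ
    rw [ofReal_integral_eq_lintegral_ofReal hφ (Filter.Eventually.of_forall fun z => sq_nonneg _)]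
    congr 1; ext z
    rw [← ofReal_norm, ← ENNReal.ofReal_pow (norm_nonneg _), Real.norm_eq_abs, sq_abs]
  have hg2 : Integrable fun z => g z ^ 2 := by
    simp_rw [sq]
    exact hgi.mul_bdd (c := M) hg.aestronglyMeasurable (Filter.Eventually.of_forall hM)
  have main : ∀ n : ℕ, ∫⁻ z in Metric.ball 0 (n : ℝ), ‖T z‖ₑ ^ 2
      ≤ ENNReal.ofReal 4 * ∫⁻ z, ‖g z‖ₑ ^ 2 := by
    intro n
    obtain ⟨B, hB⟩ := hTb
    set φ : ℝ × ℝ → ℝ := (Metric.ball 0 (n : ℝ)).indicator T with hφ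
    have hφm : Measurable φ := hTm.indicator measurableSet_ball
    have hφB : ∀ z, ‖φ z‖ ≤ B := fun z => (norm_indicator_le_norm_self _ _).trans (hB z)
    have hφi : Integrable φ := by
      rw [hφ, integrable_indicator_iff measurableSet_ball]
      exact Measure.integrableOn_of_bounded (M := B) measure_ball_lt_top.ne
        hTm.aestronglyMeasurable (Filter.Eventually.of_forall hB)
    have hφ2 : Integrable fun z => φ z ^ 2 := by
      simp_rw [sq]
      exact hφi.mul_bdd (c := B) hφm.aestronglyMeasurable (Filter.Eventually.of_forall hφB)
    have h1 := neg_integral_czop_heatK_mul_le hε hN hg hgi ⟨M, hM⟩ (h := fun z => -(1 / 2) * φ z)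
      (hφm.const_mul _) (hφi.const_mul _) ⟨1 / 2 * B, fun z => by
        rw [norm_mul, norm_neg]; norm_num; exact hφB z⟩
    have h2 : ∀ z, T z * (-(1 / 2) * φ z) = -(1 / 2) * φ z ^ 2 := by
      intro z
      by_cases hz : z ∈ Metric.ball (0 : ℝ × ℝ) n
      · rw [hφ, Set.indicator_of_mem hz]; ring
      · rw [hφ, Set.indicator_of_notMem hz]; ring
    simp_rw [← hT, h2, mul_pow, integral_const_mul] at h1
    have h3 : ∫⁻ z in Metric.ball 0 (n : ℝ), ‖T z‖ₑ ^ 2 = ∫⁻ z, ‖φ z‖ₑ ^ 2 := by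
      rw [← lintegral_indicator measurableSet_ball]
      congr 1; ext z
      by_cases hz : z ∈ Metric.ball (0 : ℝ × ℝ) n
      · rw [hφ, Set.indicator_of_mem hz, Set.indicator_of_mem hz]
      · rw [hφ, Set.indicator_of_notMem hz, Set.indicator_of_notMem hz]; simp
    rw [h3, hsq hφ2, hsq hg2, ← ENNReal.ofReal_mul (by norm_num)]
    exact ENNReal.ofReal_le_ofReal (by linarith)
  exact le_of_tendsto' ((aecover_ball tendsto_natCast_atTop_atTop).lintegral_tendsto_of_countably_generated
    (hTm.enorm.pow_const 2).aemeasurable) main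

lemma isCZKernel_heatK {ε N : ℝ} (hε : 0 < ε) (hN : ε ≤ N) :
    IsCZKernel (heatK ε N) (20000000 * Real.pi) where
  measurable := measurable_heatK ε N
  bdd := heatK_bdd hε N
  integrable := integrable_heatK hε N
  pos := by positivity
  l2 := fun g hg hgi hgb => (heatK_l2 hε hN hg hgi hgb).trans
    (mul_le_mul_left (ENNReal.ofReal_le_ofReal (by nlinarith [Real.pi_gt_three])) _)
  hormander := fun _ hl _ h₁ h₂ h₃ h₄ => hormander_heatK hε hl h₁ h₂ h₃ h₄

/-- The shift of the last two variables along a path depending on the first one. -/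
def pathShift (γ : ℝ → ℝ × ℝ) (p : ℝ × ℝ × ℝ) : ℝ × ℝ × ℝ := (p.1, p.2 + γ p.1)

/-- The operator with kernel `K` in the first two variables, conjugated by a path shift. -/
noncomputable def transOp (K : ℝ × ℝ → ℝ) (γ : ℝ → ℝ × ℝ) (g : ℝ × ℝ × ℝ → ℝ)
    (p : ℝ × ℝ × ℝ) : ℝ :=
  ∫ w : ℝ × ℝ, K w * g (p.1 + w.1, p.2 + (w.2, 0) + (γ (p.1 + w.1) - γ p.1))

lemma measurePreserving_pathShift {γ : ℝ → ℝ × ℝ} (hγ : Measurable γ) :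
    MeasurePreserving (pathShift γ) := by
  refine (MeasurePreserving.id (volume : Measure ℝ)).skew_product (g := fun a b => b + γ a)
    (measurable_snd.add (hγ.comp measurable_fst)) (Filter.Eventually.of_forall fun a => ?_)
  exact (measurePreserving_add_right (volume : Measure (ℝ × ℝ)) (γ a)).map_eq

lemma measurable_transOp {K : ℝ × ℝ → ℝ} (hK : Measurable K) {γ : ℝ → ℝ × ℝ} (hγ : Measurable γ)
    {g : ℝ × ℝ × ℝ → ℝ} (hg : Measurable g) : Measurable (transOp K γ g) := by
  have : StronglyMeasurable (Function.uncurry fun (p : ℝ × ℝ × ℝ) (w : ℝ × ℝ) =>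
      K w * g (p.1 + w.1, p.2 + (w.2, 0) + (γ (p.1 + w.1) - γ p.1))) := by
    refine Measurable.stronglyMeasurable ?_
    refine (hK.comp measurable_snd).mul (hg.comp ?_)
    refine Measurable.prodMk (by fun_prop) (Measurable.add (by fun_prop) (Measurable.sub ?_ ?_))
    · exact hγ.comp (by fun_prop)
    · exact hγ.comp (by fun_prop)
  exact this.integral_prod_right.measurable

lemma transOp_eq_comp (K : ℝ × ℝ → ℝ) (γ : ℝ → ℝ × ℝ) (g : ℝ × ℝ × ℝ → ℝ) :
    transOp K γ g = transOp K 0 (g ∘ pathShift γ) ∘ pathShift (-γ) := by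
  ext p
  simp only [transOp, pathShift, Function.comp_apply, Pi.neg_apply, Pi.zero_apply, sub_zero,
    add_zero]
  congr 1; ext w
  congr 3
  abel

lemma lintegral_transOp_zero_le {K : ℝ × ℝ → ℝ} {P C : ℝ} (hKm : Measurable K)
    (hC : ∀ f : ℝ × ℝ → ℝ, Measurable f → Integrable f → (∃ M, ∀ z, ‖f z‖ ≤ M) →
      ∫⁻ z, ‖czop K f z‖ₑ ^ P ≤ ENNReal.ofReal C * ∫⁻ z, ‖f z‖ₑ ^ P)
    {g : ℝ × ℝ × ℝ → ℝ} (hg : Measurable g) (hgi : Integrable g) (hgb : ∃ M, ∀ z, ‖g z‖ ≤ M) :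
    ∫⁻ p, ‖transOp K 0 g p‖ₑ ^ P ≤ ENNReal.ofReal C * ∫⁻ p, ‖g p‖ₑ ^ P := by
  obtain ⟨M, hM⟩ := hgb
  have hMP := (measurePreserving_prodAssoc (volume : Measure ℝ) (volume : Measure ℝ)
    (volume : Measure ℝ))
  have conv : ∀ φ : ℝ × ℝ × ℝ → ℝ, Measurable φ →
      ∫⁻ p, ‖φ p‖ₑ ^ P = ∫⁻ z, ∫⁻ w : ℝ × ℝ, ‖φ (w.1, w.2, z)‖ₑ ^ P := by
    intro φ hφ
    have h1 := hMP.lintegral_comp (f := fun p => ‖φ p‖ₑ ^ P) (hφ.enorm.pow_const P)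
    rw [lintegral_prod_symm _ (by fun_prop)] at h1
    exact h1.symm
  rw [conv _ (measurable_transOp hKm (γ := 0) measurable_const hg), conv _ hg,
    ← lintegral_const_mul' _ _ ENNReal.ofReal_ne_top]
  have h_int : Integrable (fun q : (ℝ × ℝ) × ℝ => g (q.1.1, q.1.2, q.2))
      ((volume.prod volume).prod volume) := hMP.integrable_comp_of_integrable hgi
  refine lintegral_mono_ae ?_
  filter_upwards [h_int.prod_left_ae] with z hz
  have h := hC (fun w => g (w.1, w.2, z)) (by fun_prop) hz ⟨M, fun w => hM _⟩
  refine le_trans (le_of_eq ?_) h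
  refine lintegral_congr fun w => ?_
  rw [czop_eq_integral_add]
  simp [transOp]

lemma lintegral_transOp_le {K : ℝ × ℝ → ℝ} {P C : ℝ} (hKm : Measurable K)
    (hC : ∀ f : ℝ × ℝ → ℝ, Measurable f → Integrable f → (∃ M, ∀ z, ‖f z‖ ≤ M) →
      ∫⁻ z, ‖czop K f z‖ₑ ^ P ≤ ENNReal.ofReal C * ∫⁻ z, ‖f z‖ₑ ^ P)
    {γ : ℝ → ℝ × ℝ} (hγ : Measurable γ)
    {g : ℝ × ℝ × ℝ → ℝ} (hg : Measurable g) (hgi : Integrable g) (hgb : ∃ M, ∀ z, ‖g z‖ ≤ M) :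
    ∫⁻ p, ‖transOp K γ g p‖ₑ ^ P ≤ ENNReal.ofReal C * ∫⁻ p, ‖g p‖ₑ ^ P := by
  obtain ⟨M, hM⟩ := hgb
  have h1 := measurePreserving_pathShift hγ
  have h2 := measurePreserving_pathShift hγ.neg
  have hgm : Measurable (g ∘ pathShift γ) := hg.comp h1.measurable
  have h3 := lintegral_transOp_zero_le hKm hC hgm (h1.integrable_comp_of_integrable hgi)
    ⟨M, fun z => hM _⟩
  rw [transOp_eq_comp]
  have h4 := h2.lintegral_comp (f := fun p => ‖transOp K 0 (g ∘ pathShift γ) p‖ₑ ^ P)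
    ((measurable_transOp hKm measurable_const hgm).enorm.pow_const P)
  have h5 := h1.lintegral_comp (f := fun p => ‖g p‖ₑ ^ P) (hg.enorm.pow_const P)
  simp only [Function.comp_apply] at h3 ⊢
  rw [h4, ← h5]
  exact h3

/-- The average of `transOp` over a finite family of paths. -/
noncomputable def avgOp {Ω : Type*} [Fintype Ω] (K : ℝ × ℝ → ℝ) (γ : Ω → ℝ → ℝ × ℝ)
    (g : ℝ × ℝ × ℝ → ℝ) (p : ℝ × ℝ × ℝ) : ℝ :=
  (Fintype.card Ω : ℝ)⁻¹ * ∑ ω, transOp K (γ ω) g p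

lemma measurable_avgOp {Ω : Type*} [Fintype Ω] {K : ℝ × ℝ → ℝ} (hK : Measurable K)
    {γ : Ω → ℝ → ℝ × ℝ} (hγ : ∀ ω, Measurable (γ ω))
    {g : ℝ × ℝ × ℝ → ℝ} (hg : Measurable g) : Measurable (avgOp K γ g) :=
  (Finset.measurable_sum _ fun ω _ => measurable_transOp hK (hγ ω) hg).const_mul _

lemma eLpNorm_avgOp_le {Ω : Type*} [Fintype Ω] {K : ℝ × ℝ → ℝ} {P C : ℝ} (hP : 1 < P)
    (hC0 : 0 ≤ C) (hKm : Measurable K)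
    (hC : ∀ f : ℝ × ℝ → ℝ, Measurable f → Integrable f → (∃ M, ∀ z, ‖f z‖ ≤ M) →
      ∫⁻ z, ‖czop K f z‖ₑ ^ P ≤ ENNReal.ofReal C * ∫⁻ z, ‖f z‖ₑ ^ P)
    {γ : Ω → ℝ → ℝ × ℝ} (hγ : ∀ ω, Measurable (γ ω))
    {g : ℝ × ℝ × ℝ → ℝ} (hg : Measurable g) (hgi : Integrable g) (hgb : ∃ M, ∀ z, ‖g z‖ ≤ M) :
    eLpNorm (avgOp K γ g) (ENNReal.ofReal P) volume
      ≤ ENNReal.ofReal (C ^ P⁻¹) * eLpNorm g (ENNReal.ofReal P) volume := by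
  have hP0 : 0 < P := by linarith
  have h1 : ∀ ω, eLpNorm (transOp K (γ ω) g) (ENNReal.ofReal P) volume
      ≤ ENNReal.ofReal (C ^ P⁻¹) * eLpNorm g (ENNReal.ofReal P) volume := by
    intro ω
    rw [← ENNReal.rpow_le_rpow_iff hP0, ENNReal.mul_rpow_of_nonneg _ _ hP0.le,
      eLpNorm_ofReal_rpow hP0, eLpNorm_ofReal_rpow hP0, ENNReal.ofReal_rpow_of_nonneg
      (by positivity) hP0.le, ← Real.rpow_mul hC0, inv_mul_cancel₀ hP0.ne', Real.rpow_one]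
    exact lintegral_transOp_le hKm hC (hγ ω) hg hgi hgb
  have h2 : avgOp K γ g = (Fintype.card Ω : ℝ)⁻¹ • ∑ ω, transOp K (γ ω) g := by
    ext p; simp [avgOp]
  rw [h2, eLpNorm_const_smul]
  have h3 := eLpNorm_sum_le (p := ENNReal.ofReal P) (μ := (volume : Measure (ℝ × ℝ × ℝ)))
    (s := Finset.univ) (f := fun ω => transOp K (γ ω) g)
    (fun ω _ => (measurable_transOp hKm (hγ ω) hg).aestronglyMeasurable)
    (by simpa using hP.le)
  have h4 : ∑ ω, eLpNorm (transOp K (γ ω) g) (ENNReal.ofReal P) volume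
      ≤ (Fintype.card Ω : ℝ≥0∞) * (ENNReal.ofReal (C ^ P⁻¹) * eLpNorm g (ENNReal.ofReal P) volume) := by
    refine (Finset.sum_le_sum fun ω _ => h1 ω).trans (le_of_eq ?_)
    simp
  refine (mul_le_mul_right (h3.trans h4) _).trans ?_
  have h5 : ‖(Fintype.card Ω : ℝ)⁻¹‖ₑ * (Fintype.card Ω : ℝ≥0∞) ≤ 1 := by
    rw [← ofReal_norm, Real.norm_of_nonneg (by positivity), ← ENNReal.ofReal_natCast,
      ← ENNReal.ofReal_mul (by positivity), ← ENNReal.ofReal_one]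
    exact ENNReal.ofReal_le_ofReal inv_mul_le_one
  calc _ = (‖(Fintype.card Ω : ℝ)⁻¹‖ₑ * (Fintype.card Ω : ℝ≥0∞)) *
        (ENNReal.ofReal (C ^ P⁻¹) * eLpNorm g (ENNReal.ofReal P) volume) := by rw [mul_assoc]
    _ ≤ _ := mul_le_of_le_one_left zero_le h5

section taylor

lemma exists_bound_of_hasCompactSupport {E F : Type*} [NormedAddCommGroup E]
    [NormedAddCommGroup F] {φ : E → F}
    (hφ : Continuous φ) (hc : HasCompactSupport φ) : ∃ C, 0 ≤ C ∧ ∀ x, ‖φ x‖ ≤ C := by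
  obtain ⟨C, hC⟩ := hc.exists_bound_of_continuous hφ
  exact ⟨C, (norm_nonneg _).trans (hC 0), hC⟩

variable {E : Type*} [NormedAddCommGroup E] [NormedSpace ℝ E]

lemma exists_lipschitz_of_hasCompactSupport {F : Type*} [NormedAddCommGroup F] [NormedSpace ℝ F]
    {φ : E → F} (hφ : ContDiff ℝ 1 φ) (hc : HasCompactSupport φ) :
    ∃ C, 0 ≤ C ∧ ∀ x y, ‖φ y - φ x‖ ≤ C * ‖y - x‖ := by
  obtain ⟨C, hC0, hC⟩ := exists_bound_of_hasCompactSupport (hφ.continuous_fderiv (by simp))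
    (hc.fderiv (𝕜 := ℝ))
  exact ⟨C, hC0, fun x y => convex_univ.norm_image_sub_le_of_norm_fderiv_le
    (fun z _ => (hφ.differentiable (by simp)) z) (fun z _ => hC z) trivial trivial⟩

lemma exists_taylor_two {φ : E → ℝ} (hφ : ContDiff ℝ (⊤ : ℕ∞) φ) (hc : HasCompactSupport φ) :
    ∃ C, 0 ≤ C ∧ ∀ p w : E,
      |φ (p + w) - φ p - fderiv ℝ φ p w - 1 / 2 * fderiv ℝ (fderiv ℝ φ) p w w| ≤ C * ‖w‖ ^ 3 := by
  have h1 : ContDiff ℝ (⊤ : ℕ∞) (fderiv ℝ φ) := hφ.fderiv_right (by simp)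
  have h2 : ContDiff ℝ (⊤ : ℕ∞) (fderiv ℝ (fderiv ℝ φ)) := h1.fderiv_right (by simp)
  obtain ⟨C, hC0, hC⟩ := exists_lipschitz_of_hasCompactSupport (h2.of_le (by simp))
    ((hc.fderiv (𝕜 := ℝ)).fderiv (𝕜 := ℝ))
  refine ⟨C, hC0, fun p w => ?_⟩
  have hseg : ∀ v : E, ∀ x ∈ segment ℝ p (p + v), ‖x - p‖ ≤ ‖v‖ := by
    intro v x hx
    obtain ⟨θ, hθ, rfl⟩ := (segment_eq_image' ℝ p (p + v)).subset hx
    simp only [add_sub_cancel_left, norm_smul, Real.norm_eq_abs]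
    rw [abs_of_nonneg hθ.1]
    exact mul_le_of_le_one_left (norm_nonneg _) hθ.2
  have hd1 : ∀ v : E, ‖fderiv ℝ φ (p + v) - fderiv ℝ φ p - fderiv ℝ (fderiv ℝ φ) p v‖
      ≤ C * ‖v‖ ^ 2 := by
    intro v
    have := (convex_segment (𝕜 := ℝ) p (p + v)).norm_image_sub_le_of_norm_hasFDerivWithin_le
      (f := fun x => fderiv ℝ φ x - fderiv ℝ (fderiv ℝ φ) p x)
      (f' := fun x => fderiv ℝ (fderiv ℝ φ) x - fderiv ℝ (fderiv ℝ φ) p) (C := C * ‖v‖)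
      (fun x _ => (((h1.differentiable (by simp)) x).hasFDerivAt.sub
        (fderiv ℝ (fderiv ℝ φ) p).hasFDerivAt).hasFDerivWithinAt)
      (fun x hx => (hC p x).trans (mul_le_mul_of_nonneg_left (hseg v x hx) hC0))
      (left_mem_segment ℝ p (p + v)) (right_mem_segment ℝ p (p + v))
    rw [add_sub_cancel_left] at this
    refine le_trans (le_of_eq ?_) (this.trans (le_of_eq (by ring)))
    congr 1
    simp only [map_add]; abel
  have hsymm : ∀ v w : E, fderiv ℝ (fderiv ℝ φ) p v w = fderiv ℝ (fderiv ℝ φ) p w v :=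
    fun v w => (hφ.contDiffAt.isSymmSndFDerivAt (by simpa using WithTop.coe_le_coe.2 (le_top : (2 : ℕ∞) ≤ ⊤))) v w
  set B := fderiv ℝ (fderiv ℝ φ) p with hB
  have hq : ∀ x : E, HasFDerivAt (fun x => φ x - fderiv ℝ φ p x - 1 / 2 * B (x - p) (x - p))
      (fderiv ℝ φ x - fderiv ℝ φ p - B (x - p)) x := by
    intro x
    have e1 : HasFDerivAt (fun x => B (x - p)) B x := by
      have := B.hasFDerivAt.comp x ((hasFDerivAt_id x).sub_const p)
      exact this
    have e2 := e1.clm_apply ((hasFDerivAt_id x).sub_const p)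
    have e3 := (((hφ.differentiable (by simp)) x).hasFDerivAt.sub
        (fderiv ℝ φ p).hasFDerivAt).sub (e2.const_mul (1 / 2))
    refine e3.congr_fderiv ?_
    ext v
    simp
    have := hsymm v (x - p)
    simp only [map_sub, sub_apply] at this ⊢
    linarith
  have := (convex_segment (𝕜 := ℝ) p (p + w)).norm_image_sub_le_of_norm_hasFDerivWithin_le
      (C := C * ‖w‖ ^ 2) (fun x _ => (hq x).hasFDerivWithinAt)
      (fun x hx => by
        have := hd1 (x - p)
        rw [add_sub_cancel] at this
        refine this.trans ?_
        have := hseg w x hx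
        gcongr)
      (left_mem_segment ℝ p (p + w)) (right_mem_segment ℝ p (p + w))
  rw [add_sub_cancel_left, Real.norm_eq_abs] at this
  refine le_trans (le_of_eq ?_) (this.trans (le_of_eq (by ring)))
  congr 1
  simp only [map_add, sub_self, map_zero]; ring

end taylor

lemma integrable_quadratic_gaussian (v : NNReal) (a b e : ℝ) :
    Integrable (fun y => a + b * y + e * y ^ 2) (ProbabilityTheory.gaussianReal 0 v) := by
  have h1 : Integrable (fun y : ℝ => y) (ProbabilityTheory.gaussianReal 0 v) :=
    (ProbabilityTheory.memLp_id_gaussianReal 1).integrable (by simp)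
  exact ((integrable_const a).add (h1.const_mul b)).add ((integrable_sq_gaussian v).const_mul e)

lemma integral_quadratic_gaussian (v : NNReal) (a b e : ℝ) :
    ∫ y, (a + b * y + e * y ^ 2) ∂(ProbabilityTheory.gaussianReal 0 v) = a + e * v := by
  have h1 : Integrable (fun y : ℝ => y) (ProbabilityTheory.gaussianReal 0 v) :=
    (ProbabilityTheory.memLp_id_gaussianReal 1).integrable (by simp)
  rw [integral_add, integral_add, integral_const_mul, integral_const_mul, integral_sq_gaussian,
    ProbabilityTheory.integral_id_gaussianReal]
  · simp
  · exact integrable_const a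
  · exact h1.const_mul b
  · exact (integrable_const a).add (h1.const_mul b)
  · exact (integrable_sq_gaussian v).const_mul e

lemma integrable_cube_gaussian (v : NNReal) (a : ℝ) :
    Integrable (fun y => (a + |y|) ^ 3) (ProbabilityTheory.gaussianReal 0 v) := by
  have h : MemLp (fun y : ℝ => a + |y|) 3 (ProbabilityTheory.gaussianReal 0 v) :=
    (memLp_const a).add (ProbabilityTheory.memLp_id_gaussianReal 3).norm
  refine (integrable_norm_iff (by fun_prop)).1 ?_
  simpa using h.integrable_norm_pow (by norm_num)

/-- One step of the scheme: Taylor expansion of the expectation after a Gaussian increment in the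
second variable and a centred four-valued jump in the last two. -/
lemma exists_one_step {φ : ℝ × ℝ × ℝ → ℝ} (hφ : ContDiff ℝ (⊤ : ℕ∞) φ) (hc : HasCompactSupport φ)
    {R : ℝ} (hR : 0 ≤ R) :
    ∃ C, 0 ≤ C ∧ ∀ (p : ℝ × ℝ × ℝ) (h : ℝ), 0 ≤ h → h ≤ 1 → ∀ d : Fin 4 → ℝ × ℝ,
      ∑ c, d c = 0 → (∀ c, ‖d c‖ ≤ R) →
      |1 / 4 * ∑ c, ∫ y, φ (p.1 + h, p.2 + (√h * y, 0) + √h • d c)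
            ∂(ProbabilityTheory.gaussianReal 0 2)
        - φ p - h * (fderiv ℝ φ p (1, 0, 0) + fderiv ℝ (fderiv ℝ φ) p (0, 1, 0) (0, 1, 0)
          + 1 / 8 * ∑ c, fderiv ℝ (fderiv ℝ φ) p (0, d c) (0, d c))| ≤ C * (h * √h) := by
  obtain ⟨C3, hC30, hC3⟩ := exists_taylor_two hφ hc
  have h1 : ContDiff ℝ (⊤ : ℕ∞) (fderiv ℝ φ) := hφ.fderiv_right (by simp)
  obtain ⟨C2, hC20, hC2⟩ := exists_bound_of_hasCompactSupport
    (φ := fun p => fderiv ℝ (fderiv ℝ φ) p (1, 0, 0) (1, 0, 0))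
    (((h1.continuous_fderiv (by simp)).clm_apply continuous_const).clm_apply continuous_const)
    (((hc.fderiv (𝕜 := ℝ)).fderiv (𝕜 := ℝ)).comp_left
      (g := fun B : (ℝ × ℝ × ℝ) →L[ℝ] (ℝ × ℝ × ℝ) →L[ℝ] ℝ => B (1, 0, 0) (1, 0, 0)) (by simp))
  obtain ⟨M, hM⟩ : ∃ M, M = ∫ y, (1 + R + |y|) ^ 3 ∂(ProbabilityTheory.gaussianReal 0 2) :=
    ⟨_, rfl⟩
  have hM0 : 0 ≤ M := by
    rw [hM]; exact integral_nonneg fun y => by positivity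
  refine ⟨C3 * M + C2, by positivity, fun p h hh0 hh1 d hd hdR => ?_⟩
  obtain ⟨k, hk⟩ : ∃ k, k = √h := ⟨_, rfl⟩
  have hk0 : 0 ≤ k := hk ▸ Real.sqrt_nonneg h
  have hkk : k * k = h := by rw [hk]; exact Real.mul_self_sqrt hh0
  have hk1 : k ≤ 1 := by rw [hk]; exact Real.sqrt_le_one.2 hh1
  rw [← hk]
  set μ := ProbabilityTheory.gaussianReal 0 2 with hμ
  set D := fderiv ℝ φ p with hD
  set B := fderiv ℝ (fderiv ℝ φ) p with hB
  set e1 : ℝ × ℝ × ℝ := (1, 0, 0) with he1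
  set e2 : ℝ × ℝ × ℝ := (0, 1, 0) with he2
  set w : Fin 4 → ℝ → ℝ × ℝ × ℝ := fun c y => h • e1 + (k * y) • e2 + k • (0, d c) with hw
  have hpt : ∀ c y, ((p.1 + h, p.2 + (k * y, 0) + k • d c) : ℝ × ℝ × ℝ) = p + w c y := by
    intro c y
    simp [hw, he1, he2, Prod.ext_iff]
    ring
  simp_rw [hpt]
  set a : Fin 4 → ℝ := fun c => φ p + h * D e1 + k * D (0, d c) + 1 / 2 * (h ^ 2 * B e1 e1
    + h * B (0, d c) (0, d c) + h * k * (B e1 (0, d c) + B (0, d c) e1)) with ha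
  set b : Fin 4 → ℝ := fun c => k * D e2 + 1 / 2 * (h * k * (B e1 e2 + B e2 e1)
    + h * (B e2 (0, d c) + B (0, d c) e2)) with hb
  set e : ℝ := 1 / 2 * (h * B e2 e2) with he
  have hQ : ∀ c y, φ p + D (w c y) + 1 / 2 * B (w c y) (w c y) = a c + b c * y + e * y ^ 2 := by
    intro c y
    simp only [hw, map_add, map_smul, add_apply, smul_apply,
      smul_eq_mul, ha, hb, he]
    rw [← hkk]; ring
  have hwn : ∀ c y, ‖w c y‖ ≤ k * (1 + R + |y|) := by
    intro c y
    have n1 : ‖e1‖ = 1 := by simp [he1, Prod.norm_def]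
    have n2 : ‖e2‖ = 1 := by simp [he2, Prod.norm_def]
    have n3 : ‖((0 : ℝ), d c)‖ ≤ R := by simpa [Prod.norm_def] using hdR c
    calc ‖w c y‖ ≤ ‖h • e1‖ + ‖(k * y) • e2‖ + ‖k • ((0 : ℝ), d c)‖ := norm_add₃_le
      _ = h + k * |y| + k * ‖((0 : ℝ), d c)‖ := by
          rw [norm_smul, norm_smul, norm_smul, n1, n2, Real.norm_eq_abs, Real.norm_eq_abs,
            Real.norm_eq_abs, abs_mul, abs_of_nonneg hh0, abs_of_nonneg hk0]; ring
      _ ≤ k * 1 + k * |y| + k * R := by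
          have : h ≤ k * 1 := by rw [← hkk]; exact mul_le_mul_of_nonneg_left hk1 hk0
          gcongr
      _ = k * (1 + R + |y|) := by ring
  have hrem : ∀ c y, |φ (p + w c y) - (a c + b c * y + e * y ^ 2)|
      ≤ C3 * k ^ 3 * (1 + R + |y|) ^ 3 := by
    intro c y
    rw [← hQ]
    have t1 := hC3 p (w c y)
    have t2 : ‖w c y‖ ^ 3 ≤ (k * (1 + R + |y|)) ^ 3 := by gcongr; exact hwn c y
    calc _ = |φ (p + w c y) - φ p - D (w c y) - 1 / 2 * B (w c y) (w c y)| := by congr 1; ring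
      _ ≤ C3 * ‖w c y‖ ^ 3 := t1
      _ ≤ C3 * (k * (1 + R + |y|)) ^ 3 := by gcongr
      _ = _ := by ring
  have hI : ∀ c, |∫ y, φ (p + w c y) ∂μ - (a c + e * 2)| ≤ C3 * k ^ 3 * M := by
    intro c
    have hq := integrable_quadratic_gaussian 2 (a c) (b c) e
    have h_int : Integrable (fun y => φ (p + w c y)) μ := by
      obtain ⟨M', _, hM'⟩ := exists_bound_of_hasCompactSupport hφ.continuous hc
      refine Integrable.of_bound (Continuous.aestronglyMeasurable ?_) M'
        (Filter.Eventually.of_forall fun y => hM' _)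
      exact hφ.continuous.comp (by simp only [hw]; fun_prop)
    have := integral_quadratic_gaussian 2 (a c) (b c) e
    rw [NNReal.coe_ofNat] at this
    rw [← this, ← integral_sub h_int hq, hM, ← integral_const_mul, ← Real.norm_eq_abs]
    exact norm_integral_le_of_norm_le ((integrable_cube_gaussian 2 (1 + R)).const_mul _)
      (Filter.Eventually.of_forall fun y => by simpa using hrem c y)
  have hsum : |1 / 4 * ∑ c, ∫ y, φ (p + w c y) ∂μ - 1 / 4 * ∑ c, (a c + e * 2)|
      ≤ C3 * k ^ 3 * M := by
    rw [← mul_sub, ← Finset.sum_sub_distrib, abs_mul]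
    have := (Finset.abs_sum_le_sum_abs (fun c => ∫ y, φ (p + w c y) ∂μ - (a c + e * 2))
      Finset.univ).trans (Finset.sum_le_sum fun c _ => hI c)
    simp only [Finset.sum_const, Finset.card_univ, Fintype.card_fin, nsmul_eq_mul] at this
    rw [abs_of_pos (by norm_num : (0 : ℝ) < 1 / 4)]
    push_cast at this
    linarith
  have hd0 : ∑ c, ((0 : ℝ), d c) = 0 := by
    have := Prod.ext_iff.1 hd
    ext <;> simp [Prod.fst_sum, Prod.snd_sum, hd]
  have z1 : ∑ c, D (0, d c) = 0 := by rw [← map_sum, hd0, map_zero]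
  have z2 : ∑ c, B e1 (0, d c) = 0 := by rw [← map_sum, hd0, map_zero]
  have z3 : ∑ c, B (0, d c) e1 = 0 := by
    rw [← sum_apply, ← map_sum, hd0, map_zero, zero_apply]
  have hsa : 1 / 4 * ∑ c, (a c + e * 2) = φ p + h * (D e1 + B e2 e2
      + 1 / 8 * ∑ c, B (0, d c) (0, d c)) + 1 / 2 * h ^ 2 * B e1 e1 := by
    simp only [Fin.sum_univ_four] at z1 z2 z3 ⊢
    simp only [ha, he]
    linear_combination 1 / 4 * k * z1 + 1 / 8 * h * k * z2 + 1 / 8 * h * k * z3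
  rw [hsa] at hsum
  have h2 : |1 / 2 * h ^ 2 * B e1 e1| ≤ C2 * (h * k) := by
    have t : |B e1 e1| ≤ C2 := hC2 p
    have t2 : h ≤ k := by rw [← hkk]; exact mul_le_of_le_one_left hk0 hk1
    rw [abs_mul, abs_of_nonneg (by positivity)]
    calc 1 / 2 * h ^ 2 * |B e1 e1| ≤ 1 * (h * h) * C2 := by
          have : 1 / 2 * h ^ 2 ≤ 1 * (h * h) := by nlinarith
          gcongr
      _ ≤ 1 * (h * k) * C2 := by gcongr
      _ = _ := by ring
  have hk3 : k ^ 3 = h * k := by rw [← hkk]; ring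
  rw [hk3] at hsum
  rw [abs_le] at *
  constructor <;> nlinarith

/-- The heat semigroup at time `r`, evaluated at the origin. -/
noncomputable def heatE (r : ℝ) (ψ : ℝ → ℝ) : ℝ :=
  ∫ y, ψ (√r * y) ∂(ProbabilityTheory.gaussianReal 0 2)

lemma heatE_zero (ψ : ℝ → ℝ) : heatE 0 ψ = ψ 0 := by simp [heatE]

lemma heatE_const (r a : ℝ) : heatE r (fun _ => a) = a := by simp [heatE]

lemma integrable_heatE (r : ℝ) {ψ : ℝ → ℝ} (hm : Measurable ψ) {M : ℝ} (hb : ∀ q, |ψ q| ≤ M) :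
    Integrable (fun y => ψ (√r * y)) (ProbabilityTheory.gaussianReal 0 2) :=
  Integrable.of_bound (hm.comp (measurable_const_mul _)).aestronglyMeasurable M
    (Filter.Eventually.of_forall fun _ => hb _)

lemma abs_heatE_le (r : ℝ) {ψ : ℝ → ℝ} {M : ℝ} (hb : ∀ q, |ψ q| ≤ M) : |heatE r ψ| ≤ M := by
  simpa [heatE] using norm_integral_le_of_norm_le_const (f := fun y => ψ (√r * y))
    (μ := ProbabilityTheory.gaussianReal 0 2) (Filter.Eventually.of_forall fun _ => hb _)

lemma heatE_sub (r : ℝ) {ψ χ : ℝ → ℝ} (hm : Measurable ψ) {M : ℝ} (hb : ∀ q, |ψ q| ≤ M)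
    (hm' : Measurable χ) {M' : ℝ} (hb' : ∀ q, |χ q| ≤ M') :
    heatE r (fun q => ψ q - χ q) = heatE r ψ - heatE r χ :=
  integral_sub (integrable_heatE r hm hb) (integrable_heatE r hm' hb')

lemma heatE_const_mul (r a : ℝ) (ψ : ℝ → ℝ) :
    heatE r (fun q => a * ψ q) = a * heatE r ψ := integral_const_mul _ _

lemma heatE_sum (r : ℝ) {ι : Type*} (s : Finset ι) {ψ : ι → ℝ → ℝ} (hm : ∀ i, Measurable (ψ i))
    {M : ℝ} (hb : ∀ i q, |ψ i q| ≤ M) :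
    heatE r (fun q => ∑ i ∈ s, ψ i q) = ∑ i ∈ s, heatE r (ψ i) :=
  integral_finsetSum _ fun i _ => integrable_heatE r (hm i) (hb i)

lemma heatE_eq_integral_gaussianReal {r : ℝ} (hr : 0 ≤ r) {ψ : ℝ → ℝ} (hm : Measurable ψ) :
    heatE r ψ = ∫ q, ψ q ∂(ProbabilityTheory.gaussianReal 0 (2 * r).toNNReal) := by
  have h := ProbabilityTheory.gaussianReal_map_const_mul (μ := 0) (v := 2) (√r)
  have hv : NNReal.mk (√r ^ 2) (sq_nonneg _) * 2 = (2 * r).toNNReal := by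
    ext
    rw [Real.coe_toNNReal _ (by positivity)]
    simp [Real.sq_sqrt hr, mul_comm]
  rw [hv, mul_zero] at h
  rw [← h, integral_map (by fun_prop) hm.aestronglyMeasurable]
  rfl

lemma heatE_add {r s : ℝ} (hr : 0 ≤ r) (hs : 0 ≤ s) {ψ : ℝ → ℝ} (hm : Measurable ψ) {M : ℝ}
    (hb : ∀ q, |ψ q| ≤ M) :
    heatE (r + s) ψ = heatE r (fun q => heatE s (fun q' => ψ (q + q'))) := by
  rw [heatE_eq_integral_gaussianReal (by positivity) hm]
  have h1 : (fun q => heatE s (fun q' => ψ (q + q'))) = fun q =>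
      ∫ q', ψ (q + q') ∂(ProbabilityTheory.gaussianReal 0 (2 * s).toNNReal) := by
    ext q
    exact heatE_eq_integral_gaussianReal hs (hm.comp (measurable_const_add q))
  have h2 : Measurable fun q =>
      ∫ q', ψ (q + q') ∂(ProbabilityTheory.gaussianReal 0 (2 * s).toNNReal) := by
    have : StronglyMeasurable (Function.uncurry fun q q' : ℝ => ψ (q + q')) :=
      (hm.comp measurable_add).stronglyMeasurable
    exact this.integral_prod_right.measurable
  rw [h1, heatE_eq_integral_gaussianReal hr h2, ← integral_conv,
    ProbabilityTheory.gaussianReal_conv_gaussianReal, ← Real.toNNReal_add (by positivity)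
      (by positivity), mul_add, add_zero]
  exact Integrable.of_bound hm.aestronglyMeasurable M (Filter.Eventually.of_forall fun _ => hb _)

lemma measurable_heatE {α : Type*} [MeasurableSpace α] {ρ : α → ℝ} (hρ : Measurable ρ)
    {ψ : α → ℝ → ℝ} (hm : Measurable (Function.uncurry ψ)) :
    Measurable fun a => heatE (ρ a) (ψ a) := by
  have : StronglyMeasurable (Function.uncurry fun (a : α) (y : ℝ) => ψ a (√(ρ a) * y)) := by
    refine (hm.comp (f := fun x : α × ℝ => (x.1, √(ρ x.1) * x.2)) ?_).stronglyMeasurable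
    fun_prop
  exact this.integral_prod_right.measurable

lemma integral_heatG_mul_eq_heatE {r : ℝ} (hr : 0 < r) {ψ : ℝ → ℝ} (hm : Measurable ψ) :
    ∫ q, heatG r q * ψ q = heatE r ψ := by
  rw [integral_heatG_mul hr, heatE_eq_integral_gaussianReal hr.le hm]

lemma integral_heatGxx_mul {r : ℝ} (hr : 0 < r) {ψ ψ' ψ'' : ℝ → ℝ} {M : ℝ}
    (h1 : ∀ q, HasDerivAt ψ (ψ' q) q) (h2 : ∀ q, HasDerivAt ψ' (ψ'' q) q)
    (h3 : Measurable ψ'') (b0 : ∀ q, |ψ q| ≤ M) (b1 : ∀ q, |ψ' q| ≤ M) (b2 : ∀ q, |ψ'' q| ≤ M) :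
    ∫ q, heatGxx r q * ψ q = heatE r ψ'' := by
  have c0 : Continuous ψ := continuous_iff_continuousAt.2 fun q => (h1 q).continuousAt
  have c1 : Continuous ψ' := continuous_iff_continuousAt.2 fun q => (h2 q).continuousAt
  have key : ∀ {g χ : ℝ → ℝ}, Integrable g → Measurable χ → (∀ q, |χ q| ≤ M) →
      Integrable (fun q => g q * χ q) := fun hg hχ hb =>
    hg.mul_bdd (c := M) hχ.aestronglyMeasurable (Filter.Eventually.of_forall hb)
  have i1 := integral_mul_deriv_eq_deriv_mul_of_integrable (u := heatG r) (v := ψ')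
    (u' := fun q => heatGx r q) (v' := ψ'') (fun q _ => hasDerivAt_heatG_space hr q) (fun q _ => h2 q)
    (key (integrable_heatG hr) h3 b2)
    (key (integrable_heatGx hr) c1.measurable b1)
    (key (integrable_heatG hr) c1.measurable b1)
  have i2 := integral_mul_deriv_eq_deriv_mul_of_integrable (u := heatGx r) (v := ψ)
    (u' := fun q => heatGxx r q) (v' := ψ') (fun q _ => hasDerivAt_heatG_space_two hr q) (fun q _ => h1 q)
    (key (integrable_heatGx hr) c1.measurable b1)
    (key (integrable_heatGxx hr) c0.measurable b0)
    (key (integrable_heatGx hr) c0.measurable b0)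
  rw [← integral_heatG_mul_eq_heatE hr h3, i1, i2, neg_neg]

/-- Averaging over one coordinate of a finite product. -/
lemma sum_resample {ι κ : Type*} [Fintype ι] [DecidableEq ι] [Fintype κ] (j : ι)
    (H : (ι → κ) → κ → ℝ) (hH : ∀ ω c c', H (Function.update ω j c') c = H ω c) :
    (Fintype.card κ : ℝ) * ∑ ω, H ω (ω j) = ∑ ω, ∑ c, H ω c := by
  have e : ∑ x : (ι → κ) × κ, H x.1 (x.1 j) = ∑ x : (ι → κ) × κ, H x.1 x.2 := by
    refine Finset.sum_bij' (fun x _ => (Function.update x.1 j x.2, x.1 j))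
      (fun x _ => (Function.update x.1 j x.2, x.1 j)) (by simp) (by simp) ?_ ?_ ?_
    · intro x _; simp
    · intro x _; simp
    · intro x _; simp [hH]
  rw [Fintype.sum_prod_type, Fintype.sum_prod_type] at e
  simpa [Finset.mul_sum] using e

section paths

variable {n : ℕ} {J : ℝ → Fin 4 → ℝ × ℝ}

/-- The grid of mesh `1 / n` starting at `-1`. -/
noncomputable def grid (n k : ℕ) : ℝ := -1 + k / n

/-- The piecewise constant path with jump `J (grid n k) (ω k) / √n` at the grid point `grid n k`. -/
noncomputable def jumpPath (n : ℕ) (J : ℝ → Fin 4 → ℝ × ℝ) (ω : Fin (4 * n + 1) → Fin 4) (t : ℝ) :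
    ℝ × ℝ :=
  ∑ k : Fin (4 * n + 1), if grid n k ≤ t then √(1 / n : ℝ) • J (grid n k) (ω k) else 0

lemma measurable_jumpPath (ω : Fin (4 * n + 1) → Fin 4) : Measurable (jumpPath n J ω) := by
  unfold jumpPath
  exact Finset.measurable_sum _ fun k _ =>
    Measurable.ite measurableSet_Ici measurable_const measurable_const

lemma grid_add_le (hn : 0 < n) {k l : ℕ} (h : k < l) : grid n k + 1 / n ≤ grid n l := by
  have hn' : (0 : ℝ) < n := by exact_mod_cast hn
  have : (k : ℝ) + 1 ≤ l := by exact_mod_cast h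
  unfold grid
  rw [add_assoc, ← add_div]
  gcongr

lemma exists_jump (hn : 0 < n) {s : ℝ} (hs : -1 ≤ s) (hs' : s < 3) :
    ∃ j : Fin (4 * n + 1), s < grid n j ∧ grid n j ≤ s + 1 / n ∧
      (∀ ω (δ : ℝ), 0 ≤ δ → δ ≤ 1 / n → jumpPath n J ω (s + δ) = jumpPath n J ω s +
        if grid n j ≤ s + δ then √(1 / n : ℝ) • J (grid n j) (ω j) else 0) ∧
      ∀ t ≤ s, ∀ ω c, jumpPath n J (Function.update ω j c) t = jumpPath n J ω t := by
  have hn' : (0 : ℝ) < n := by exact_mod_cast hn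
  have hpos : 0 ≤ (s + 1) * n := mul_nonneg (by linarith) hn'.le
  have hfl := Nat.floor_le hpos
  have hlt := Nat.lt_floor_add_one ((s + 1) * n)
  set N := ⌊(s + 1) * n⌋₊
  have hN : N < 4 * n := by
    have : (N : ℝ) < (4 * n : ℕ) := by push_cast; nlinarith
    exact_mod_cast this
  have h1 : s < grid n (N + 1) := by
    have := (lt_div_iff₀ hn').2 hlt
    unfold grid; push_cast; linarith
  have h2 : grid n (N + 1) ≤ s + 1 / n := by
    have := (div_le_iff₀ hn').2 hfl
    unfold grid; push_cast; rw [add_div]; linarith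
  refine ⟨⟨N + 1, by omega⟩, h1, h2, ?_, ?_⟩
  · intro ω δ hδ hδ'
    rw [← sub_eq_iff_eq_add']
    unfold jumpPath
    rw [← Finset.sum_sub_distrib, Finset.sum_eq_single ⟨N + 1, by omega⟩]
    · simp only [if_neg (not_le.2 h1), sub_zero]
    · intro k _ hk
      have hk' : (k : ℕ) ≠ N + 1 := fun h => hk (Fin.ext h)
      rcases lt_or_gt_of_ne hk' with h | h
      · have := grid_add_le hn h
        rw [if_pos (by linarith), if_pos (by linarith), sub_self]
      · have := grid_add_le hn h
        rw [if_neg (by linarith), if_neg (by linarith), sub_self]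
    · simp
  · intro t ht ω c
    unfold jumpPath
    refine Finset.sum_congr rfl fun k _ => ?_
    by_cases hk : k = ⟨N + 1, by omega⟩
    · subst hk
      rw [if_neg (by simpa using by linarith), if_neg (by simpa using by linarith)]
    · rw [Function.update_of_ne hk]

/-- Average over the paths of the heat flow along a path. -/
noncomputable def pathHeat {Ω : Type*} [Fintype Ω] (γ : Ω → ℝ → ℝ × ℝ) (ψ : ℝ × ℝ × ℝ → ℝ)
    (p : ℝ × ℝ × ℝ) (r : ℝ) : ℝ :=
  (Fintype.card Ω : ℝ)⁻¹ * ∑ ω, heatE r fun q =>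
    ψ (p.1 + r, p.2 + (q, 0) + (γ ω (p.1 + r) - γ ω p.1))

lemma abs_avg_le {Ω : Type*} [Fintype Ω] [Nonempty Ω] {F : Ω → ℝ} {M : ℝ} (h : ∀ ω, |F ω| ≤ M) :
    |(Fintype.card Ω : ℝ)⁻¹ * ∑ ω, F ω| ≤ M := by
  have hc : (0 : ℝ) < Fintype.card Ω := by exact_mod_cast Fintype.card_pos
  rw [abs_mul, abs_of_nonneg (by positivity), inv_mul_le_iff₀ hc]
  refine (Finset.abs_sum_le_sum_abs _ _).trans ((Finset.sum_le_sum fun ω _ => h ω).trans ?_)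
  simp

lemma abs_pathHeat_le {Ω : Type*} [Fintype Ω] [Nonempty Ω] (γ : Ω → ℝ → ℝ × ℝ)
    {ψ : ℝ × ℝ × ℝ → ℝ} {M : ℝ} (hb : ∀ p, |ψ p| ≤ M) (p : ℝ × ℝ × ℝ) (r : ℝ) :
    |pathHeat γ ψ p r| ≤ M :=
  abs_avg_le fun _ => abs_heatE_le _ fun _ => hb _

lemma pathHeat_zero {Ω : Type*} [Fintype Ω] [Nonempty Ω] (γ : Ω → ℝ → ℝ × ℝ)
    (ψ : ℝ × ℝ × ℝ → ℝ) (p : ℝ × ℝ × ℝ) : pathHeat γ ψ p 0 = ψ p := by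
  have hc : (Fintype.card Ω : ℝ) ≠ 0 := by exact_mod_cast Fintype.card_ne_zero
  simp [pathHeat, heatE_zero, hc, Prod.mk_zero_zero]

lemma measurable_pathHeat {Ω : Type*} [Fintype Ω] {γ : Ω → ℝ → ℝ × ℝ}
    (hγ : ∀ ω, Measurable (γ ω)) {ψ : ℝ × ℝ × ℝ → ℝ} (hψ : Measurable ψ) (p : ℝ × ℝ × ℝ) :
    Measurable (pathHeat γ ψ p) := by
  unfold pathHeat
  refine (Finset.measurable_sum _ fun ω _ => measurable_heatE measurable_id ?_).const_mul _
  have := hγ ω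
  simp only [Function.uncurry_def]
  fun_prop

variable {R : ℝ}

lemma exists_abs_pathHeat_add_sub_le (hR : 0 ≤ R) (hJ : ∀ τ ∈ Set.Icc (-1 : ℝ) 4, ∀ c, ‖J τ c‖ ≤ R)
    {ψ : ℝ × ℝ × ℝ → ℝ} {M L : ℝ} (hb : ∀ p, |ψ p| ≤ M) (hL0 : 0 ≤ L)
    (hL : ∀ p q, |ψ q - ψ p| ≤ L * ‖q - p‖) :
    ∃ C, 0 ≤ C ∧ ∀ n : ℕ, 0 < n → ∀ (p : ℝ × ℝ × ℝ) (r : ℝ), 0 ≤ r → -1 ≤ p.1 + r → p.1 + r < 3 →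
      ∀ δ : ℝ, 0 ≤ δ → δ ≤ 1 / n →
      |pathHeat (jumpPath n J) ψ p (r + δ) - pathHeat (jumpPath n J) ψ p r| ≤ C * √(1 / n) := by
  obtain ⟨A, hA⟩ : ∃ A, A = ∫ y, |y| ∂(ProbabilityTheory.gaussianReal 0 2) := ⟨_, rfl⟩
  have hA0 : 0 ≤ A := by rw [hA]; exact integral_nonneg fun y => abs_nonneg y
  have hAi : Integrable (fun y : ℝ => |y|) (ProbabilityTheory.gaussianReal 0 2) :=
    ((ProbabilityTheory.memLp_id_gaussianReal 1).integrable (by simp)).abs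
  refine ⟨L * (1 + R + A), by positivity, fun n hn p r hr hs hs' δ hδ hδ' => ?_⟩
  have hn1 : (1 : ℝ) ≤ n := by exact_mod_cast hn
  have hψ : Measurable ψ := by
    refine (LipschitzWith.of_dist_le_mul (K := ⟨L, hL0⟩) fun x y => ?_).continuous.measurable
    rw [dist_eq_norm, dist_eq_norm]
    exact hL y x
  obtain ⟨h, hh⟩ : ∃ h : ℝ, h = 1 / n := ⟨_, rfl⟩
  have hh0 : 0 ≤ h := by rw [hh]; positivity
  have hh1 : h ≤ 1 := by rw [hh]; exact (div_le_one (by linarith)).2 hn1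
  obtain ⟨j, hj, hj', hstep, -⟩ := exists_jump (J := J) hn hs hs'
  unfold pathHeat
  rw [← mul_sub, ← Finset.sum_sub_distrib]
  refine abs_avg_le fun ω => ?_
  rw [← hh] at hδ' hj' ⊢
  set a : ℝ × ℝ := jumpPath n J ω (p.1 + (r + δ)) - jumpPath n J ω p.1 with ha
  set b : ℝ × ℝ := jumpPath n J ω (p.1 + r) - jumpPath n J ω p.1 with hb'
  have hab : ‖a - b‖ ≤ √h * R := by
    have : a - b = if grid n j ≤ p.1 + r + δ then √h • J (grid n j) (ω j) else 0 := by
      have := hstep ω δ hδ (by rw [← hh]; exact hδ')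
      rw [← hh] at this
      rw [ha, hb', ← add_assoc, this]; abel
    rw [this]
    split_ifs
    · rw [norm_smul, Real.norm_eq_abs, abs_of_nonneg (Real.sqrt_nonneg _)]
      exact mul_le_mul_of_nonneg_left (hJ _ ⟨by linarith, by linarith⟩ _) (Real.sqrt_nonneg _)
    · simpa using by positivity
  have hm : ∀ (c : ℝ) (a : ℝ × ℝ), Measurable fun q : ℝ => ψ (c, p.2 + (q, 0) + a) := by
    intro c a; exact hψ.comp (by fun_prop)
  rw [heatE_add hr hδ (hm _ _) (fun _ => hb _), ← heatE_sub r (M := M) (M' := M)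
    (measurable_heatE measurable_const (by simp only [Function.uncurry_def]; fun_prop))
    (fun q => abs_heatE_le _ fun _ => hb _) (hm _ _) (fun _ => hb _)]
  refine abs_heatE_le _ fun q => ?_
  rw [← heatE_const δ (ψ (p.1 + r, p.2 + (q, 0) + b)), ← heatE_sub δ (M := M) (M' := M)
    (ψ := fun x => ψ (p.1 + (r + δ), p.2 + (q + x, 0) + a))
    ((hm _ _).comp (measurable_const_add q)) (fun _ => hb _) measurable_const fun _ => hb _]
  have hpt : ∀ y, |ψ (p.1 + (r + δ), p.2 + (q + √δ * y, 0) + a) - ψ (p.1 + r, p.2 + (q, 0) + b)|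
      ≤ L * √h * (1 + R) + L * √h * |y| := by
    intro y
    have e : ((p.1 + (r + δ), p.2 + (q + √δ * y, 0) + a) : ℝ × ℝ × ℝ)
        - (p.1 + r, p.2 + (q, 0) + b) = (δ, 0, 0) + (0, √δ * y, 0) + (0, a - b) := by
      simp only [Prod.ext_iff, Prod.fst_sub, Prod.snd_sub, Prod.fst_add, Prod.snd_add]
      refine ⟨by ring, by ring, by ring⟩
    refine (hL _ _).trans ?_
    rw [e]
    have n1 : ‖((δ, 0, 0) : ℝ × ℝ × ℝ)‖ = δ := by simp [Prod.norm_def, hδ]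
    have n2 : ‖((0, √δ * y, 0) : ℝ × ℝ × ℝ)‖ = √δ * |y| := by
      simp [Prod.norm_def, abs_of_nonneg (Real.sqrt_nonneg δ)]
      positivity
    have n3 : ‖((0 : ℝ), a - b)‖ = ‖a - b‖ := by rw [Prod.norm_def]; simp
    have t1 : δ ≤ √h := hδ'.trans (Real.le_sqrt_of_sq_le (by nlinarith))
    have t2 : √δ ≤ √h := Real.sqrt_le_sqrt hδ'
    calc _ ≤ L * (δ + √δ * |y| + ‖a - b‖) := by
          gcongr
          exact norm_add₃_le.trans (by rw [n1, n2, n3])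
      _ ≤ L * (√h + √h * |y| + √h * R) := by gcongr
      _ = _ := by ring
  unfold heatE
  rw [← Real.norm_eq_abs]
  refine (norm_integral_le_of_norm_le ((integrable_const _).add (hAi.const_mul _))
    (Filter.Eventually.of_forall hpt)).trans (le_of_eq ?_)
  have e1 : ∫ y, (fun y => L * √h * (1 + R) + L * √h * |y|) y
      ∂(ProbabilityTheory.gaussianReal 0 2) = L * √h * (1 + R) + L * √h * A := by
    rw [integral_add (integrable_const _) (hAi.const_mul _), integral_const, integral_const_mul, ← hA]
    simp
  refine e1.trans (by ring)

lemma exists_abs_pathHeat_step_le (hR : 0 ≤ R)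
    (hJ : ∀ τ ∈ Set.Icc (-1 : ℝ) 4, ∀ c, ‖J τ c‖ ≤ R) (hJ0 : ∀ τ, ∑ c, J τ c = 0)
    {φ G : ℝ × ℝ × ℝ → ℝ} (hφ : ContDiff ℝ (⊤ : ℕ∞) φ) (hc : HasCompactSupport φ)
    (hG : Measurable G) {M L : ℝ} (hb : ∀ p, |G p| ≤ M) (hL0 : 0 ≤ L)
    (hL : ∀ p : ℝ × ℝ × ℝ, p.1 ∈ Set.Icc (-1 : ℝ) 3 → ∀ τ ∈ Set.Icc (-1 : ℝ) 4,
      |fderiv ℝ φ p (1, 0, 0) + fderiv ℝ (fderiv ℝ φ) p (0, 1, 0) (0, 1, 0)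
        + 1 / 8 * ∑ c, fderiv ℝ (fderiv ℝ φ) p (0, J τ c) (0, J τ c) - G p| ≤ L * |τ - p.1|) :
    ∃ C, 0 ≤ C ∧ ∀ n : ℕ, 0 < n → ∀ (p : ℝ × ℝ × ℝ) (r : ℝ), 0 ≤ r → -1 ≤ p.1 + r → p.1 + r < 3 →
      |pathHeat (jumpPath n J) φ p (r + 1 / n) - pathHeat (jumpPath n J) φ p r
        - 1 / n * pathHeat (jumpPath n J) G p r| ≤ C * (1 / n * √(1 / n)) := by
  obtain ⟨C1, hC10, hC1⟩ := exists_one_step hφ hc hR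
  obtain ⟨M', -, hb'⟩ := exists_bound_of_hasCompactSupport hφ.continuous hc
  simp only [Real.norm_eq_abs] at hb'
  have hφm := hφ.continuous.measurable
  refine ⟨C1 + L, by positivity, fun n hn p r hr hs hs' => ?_⟩
  have hn1 : (1 : ℝ) ≤ n := by exact_mod_cast hn
  obtain ⟨j, hj, hj', hstep, hres⟩ := exists_jump (J := J) hn hs hs'
  obtain ⟨h, hh⟩ : ∃ h : ℝ, h = 1 / n := ⟨_, rfl⟩
  have hh0 : 0 ≤ h := by rw [hh]; positivity
  have hh1 : h ≤ 1 := by rw [hh]; exact (div_le_one (by linarith)).2 hn1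
  have hstep' : ∀ ω, jumpPath n J ω (p.1 + (r + h)) =
      jumpPath n J ω (p.1 + r) + √h • J (grid n j) (ω j) := by
    intro ω
    have := hstep ω h hh0 hh.le
    rwa [if_pos (by rw [hh]; exact hj'), ← hh, add_assoc] at this
  rw [← hh] at hj' ⊢
  clear hstep
  set g := grid n j
  set P : (Fin (4 * n + 1) → Fin 4) → ℝ → ℝ × ℝ × ℝ := fun ω q =>
    (p.1 + r, p.2 + (q, 0) + (jumpPath n J ω (p.1 + r) - jumpPath n J ω p.1)) with hP
  set S : (Fin (4 * n + 1) → Fin 4) → Fin 4 → ℝ → ℝ := fun ω c q =>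
    heatE h fun y => φ ((P ω q).1 + h, (P ω q).2 + (y, 0) + √h • J g c) with hS
  have hPm : ∀ ω, Measurable (P ω) := fun ω => by simp only [hP]; fun_prop
  have hSm : ∀ ω c, Measurable (S ω c) := by
    intro ω c
    refine measurable_heatE measurable_const ?_
    have := hPm ω
    simp only [Function.uncurry_def]
    fun_prop
  have hSb : ∀ ω c q, |S ω c q| ≤ M' := fun ω c q => abs_heatE_le _ fun _ => hb' _
  have hfin : ∀ ω, heatE (r + h) (fun q => φ (p.1 + (r + h), p.2 + (q, 0) +
      (jumpPath n J ω (p.1 + (r + h)) - jumpPath n J ω p.1))) = heatE r (S ω (ω j)) := by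
    intro ω
    rw [heatE_add hr hh0 (M := M') (by fun_prop) (fun _ => hb' _)]
    congr 1
    ext q
    simp only [hS, hP]
    congr 1
    ext y
    rw [hstep']
    congr 1
    ext
    · simp only; ring
    · simp only [Prod.fst_add, Prod.fst_sub]; ring
    · simp only [Prod.snd_add, Prod.snd_sub]; ring
  have hsum : ∑ ω, heatE r (S ω (ω j)) = ∑ ω, 1 / 4 * ∑ c, heatE r (S ω c) := by
    have := sum_resample j (fun ω c => heatE r (S ω c)) (by
      intro ω c c'
      simp only [hS, hP]
      rw [hres _ le_rfl, hres _ (by linarith)])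
    rw [Fintype.card_fin] at this
    rw [← Finset.mul_sum, ← this]
    push_cast; ring
  unfold pathHeat
  simp only [hfin]
  rw [hsum, ← mul_assoc, mul_comm h, mul_assoc, ← mul_sub, ← mul_sub, Finset.mul_sum,
    ← Finset.sum_sub_distrib, ← Finset.sum_sub_distrib]
  refine abs_avg_le fun ω => ?_
  have hφP : Measurable fun q => φ (P ω q) := hφm.comp (hPm ω)
  have hGP : Measurable fun q => G (P ω q) := hG.comp (hPm ω)
  have hSS : Measurable fun q => 1 / 4 * ∑ c, S ω c q :=
    (Finset.measurable_sum _ fun c _ => hSm ω c).const_mul _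
  have hSSb : ∀ q, |1 / 4 * ∑ c, S ω c q| ≤ M' := by
    intro q
    have := abs_avg_le (Ω := Fin 4) (F := fun c => S ω c q) (fun c => hSb ω c q)
    simpa using this
  have hsub : ∀ q, |1 / 4 * ∑ c, S ω c q - φ (P ω q)| ≤ M' + M' := fun q =>
    (abs_sub _ _).trans (add_le_add (hSSb q) (hb' _))
  rw [← heatE_sum r Finset.univ (hSm ω) (hSb ω), ← heatE_const_mul, ← heatE_const_mul]
  change |heatE r (fun q => 1 / 4 * ∑ c, S ω c q) - heatE r (fun q => φ (P ω q))
    - heatE r (fun q => h * G (P ω q))| ≤ _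
  rw [← heatE_sub r hSS hSSb hφP (fun q => hb' _), ← heatE_sub r (ψ := fun q => 1 / 4 * ∑ c, S ω c q - φ (P ω q))
    (hSS.sub hφP) hsub
    (hGP.const_mul h) (M' := h * M)
    (fun q => by rw [abs_mul, abs_of_nonneg hh0]; exact mul_le_mul_of_nonneg_left (hb _) hh0)]
  refine abs_heatE_le _ fun q => ?_
  have hg : g ∈ Set.Icc (-1 : ℝ) 4 := ⟨by linarith, by linarith⟩
  have k1 := hC1 (P ω q) h hh0 hh1 (J g) (hJ0 g) (hJ g hg)
  have k2 := hL (P ω q) ⟨hs, hs'.le⟩ g hg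
  have k3 : |g - (P ω q).1| ≤ √h := by
    have : (P ω q).1 = p.1 + r := rfl
    rw [this, abs_of_nonneg (by linarith)]
    exact le_trans (by linarith) (Real.le_sqrt_of_sq_le (by nlinarith : h ^ 2 ≤ h))
  have k4 : L * |g - (P ω q).1| ≤ L * √h := by gcongr
  have k5 := mul_le_mul_of_nonneg_left (k2.trans k4) hh0
  rw [← abs_of_nonneg hh0, ← abs_mul, abs_of_nonneg hh0] at k5
  refine le_trans (le_of_eq ?_) ((abs_add_le _ _).trans ((add_le_add k1 k5).trans
    (le_of_eq (by ring))))
  congr 1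
  simp only [hS, heatE]
  ring

end paths

lemma transOp_heatK {ε N : ℝ} (hε : 0 < ε) {γ : ℝ → ℝ × ℝ} (hγ : Measurable γ)
    {g g' G : ℝ × ℝ × ℝ → ℝ} {M : ℝ} (hg : Measurable g) (hG : Measurable G)
    (h1 : ∀ p : ℝ × ℝ × ℝ, HasDerivAt (fun a => g (p.1, a, p.2.2)) (g' p) p.2.1)
    (h2 : ∀ p : ℝ × ℝ × ℝ, HasDerivAt (fun a => g' (p.1, a, p.2.2)) (G p) p.2.1)
    (b0 : ∀ p, |g p| ≤ M) (b1 : ∀ p, |g' p| ≤ M) (b2 : ∀ p, |G p| ≤ M) (p : ℝ × ℝ × ℝ) :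
    transOp (heatK ε N) γ g p = ∫ r in Set.Ioo ε N,
      heatE r fun q => G (p.1 + r, p.2 + (q, 0) + (γ (p.1 + r) - γ p.1)) := by
  have h_int : Integrable (fun w : ℝ × ℝ =>
      heatK ε N w * g (p.1 + w.1, p.2 + (w.2, 0) + (γ (p.1 + w.1) - γ p.1))) (volume.prod volume) := by
    refine (integrable_heatK hε N).mul_bdd (c := M) ?_ (Filter.Eventually.of_forall fun _ => b0 _)
    exact Measurable.aestronglyMeasurable (by fun_prop)
  unfold transOp
  rw [Measure.volume_eq_prod, integral_prod _ h_int, ← integral_indicator measurableSet_Ioo]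
  congr 1
  ext r
  by_cases hr : r ∈ Set.Ioo ε N
  · rw [Set.indicator_of_mem hr]
    simp_rw [heatK_of_mem (z := (r, _)) hr]
    set b := γ (p.1 + r) - γ p.1
    have hd : ∀ {F F' : ℝ × ℝ × ℝ → ℝ}, (∀ p : ℝ × ℝ × ℝ,
        HasDerivAt (fun a => F (p.1, a, p.2.2)) (F' p) p.2.1) → ∀ q,
        HasDerivAt (fun q => F (p.1 + r, p.2 + (q, 0) + b)) (F' (p.1 + r, p.2 + (q, 0) + b)) q := by
      intro F F' h q
      have e := (h (p.1 + r, p.2 + (q, 0) + b)).scomp q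
        (((hasDerivAt_id q).const_add p.2.1).add_const b.1)
      rw [one_smul] at e
      refine e.congr_of_eventuallyEq (Filter.Eventually.of_forall fun x => ?_)
      simp only [Function.comp_apply, id]
      congr 2
    exact integral_heatGxx_mul (hε.trans hr.1) (hd h1) (hd h2) (hG.comp (by fun_prop))
      (fun _ => b0 _) (fun _ => b1 _) fun _ => b2 _
  · rw [Set.indicator_of_notMem hr]
    simp_rw [heatK_of_notMem (z := (r, _)) hr]
    simp

lemma avgOp_heatK {Ω : Type*} [Fintype Ω] {ε N : ℝ} (hε : 0 < ε) {γ : Ω → ℝ → ℝ × ℝ}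
    (hγ : ∀ ω, Measurable (γ ω))
    {g g' G : ℝ × ℝ × ℝ → ℝ} {M : ℝ} (hg : Measurable g) (hG : Measurable G)
    (h1 : ∀ p : ℝ × ℝ × ℝ, HasDerivAt (fun a => g (p.1, a, p.2.2)) (g' p) p.2.1)
    (h2 : ∀ p : ℝ × ℝ × ℝ, HasDerivAt (fun a => g' (p.1, a, p.2.2)) (G p) p.2.1)
    (b0 : ∀ p, |g p| ≤ M) (b1 : ∀ p, |g' p| ≤ M) (b2 : ∀ p, |G p| ≤ M) (p : ℝ × ℝ × ℝ) :
    avgOp (heatK ε N) γ g p = ∫ r in Set.Ioo ε N, pathHeat γ G p r := by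
  unfold avgOp pathHeat
  rw [integral_const_mul, integral_finsetSum]
  · simp_rw [fun ω => transOp_heatK (N := N) hε (hγ ω) hg hG h1 h2 b0 b1 b2 p]
  · intro ω _
    have : IsFiniteMeasure (volume.restrict (Set.Ioo ε N)) := ⟨by simp⟩
    refine Integrable.of_bound (Measurable.aestronglyMeasurable ?_) M
      (Filter.Eventually.of_forall fun r => abs_heatE_le _ fun _ => b2 _)
    refine measurable_heatE measurable_id ?_
    have := hγ ω
    simp only [Function.uncurry_def]
    fun_prop

lemma tendsto_avgOp_heatK {J : ℝ → Fin 4 → ℝ × ℝ} {R : ℝ} (hR : 0 ≤ R)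
    (hJ : ∀ τ ∈ Set.Icc (-1 : ℝ) 4, ∀ c, ‖J τ c‖ ≤ R) (hJ0 : ∀ τ, ∑ c, J τ c = 0)
    {φ g g' G : ℝ × ℝ × ℝ → ℝ} (hφ : ContDiff ℝ (⊤ : ℕ∞) φ) (hc : HasCompactSupport φ)
    (hφ1 : ∀ p : ℝ × ℝ × ℝ, 1 ≤ p.1 → φ p = 0)
    {M L L' : ℝ} (hg : Measurable g) (hG : Measurable G)
    (h1 : ∀ p : ℝ × ℝ × ℝ, HasDerivAt (fun a => g (p.1, a, p.2.2)) (g' p) p.2.1)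
    (h2 : ∀ p : ℝ × ℝ × ℝ, HasDerivAt (fun a => g' (p.1, a, p.2.2)) (G p) p.2.1)
    (b0 : ∀ p, |g p| ≤ M) (b1 : ∀ p, |g' p| ≤ M) (b2 : ∀ p, |G p| ≤ M)
    (hL0 : 0 ≤ L)
    (hL : ∀ p : ℝ × ℝ × ℝ, p.1 ∈ Set.Icc (-1 : ℝ) 3 → ∀ τ ∈ Set.Icc (-1 : ℝ) 4,
      |fderiv ℝ φ p (1, 0, 0) + fderiv ℝ (fderiv ℝ φ) p (0, 1, 0) (0, 1, 0)
        + 1 / 8 * ∑ c, fderiv ℝ (fderiv ℝ φ) p (0, J τ c) (0, J τ c) - G p| ≤ L * |τ - p.1|)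
    (hL'0 : 0 ≤ L') (hL' : ∀ p q, |G q - G p| ≤ L' * ‖q - p‖)
    {p : ℝ × ℝ × ℝ} (hp : p.1 ∈ Set.Ioo (-1 : ℝ) 1) :
    Filter.Tendsto (fun n : ℕ => avgOp (heatK (1 / n) 2) (jumpPath n J) g p) Filter.atTop
      (nhds (-φ p)) := by
  obtain ⟨C1, hC10, hC1⟩ := exists_abs_pathHeat_step_le hR hJ hJ0 hφ hc hG b2 hL0 hL
  obtain ⟨C2, hC20, hC2⟩ := exists_abs_pathHeat_add_sub_le hR hJ b2 hL'0 hL'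
  have hM0 : 0 ≤ M := (abs_nonneg _).trans (b0 0)
  have hmain : ∀ n : ℕ, 0 < n → |avgOp (heatK (1 / n) 2) (jumpPath n J) g p - (-φ p)|
      ≤ 2 * (C1 + C2) * √(1 / n) + M * (1 / n) := by
    intro n hn
    have hn' : (0 : ℝ) < n := by exact_mod_cast hn
    have hn1 : (1 : ℝ) ≤ n := by exact_mod_cast hn
    rw [avgOp_heatK (by positivity) (fun ω => measurable_jumpPath ω) hg hG h1 h2 b0 b1 b2]
    set B := pathHeat (jumpPath n J) G p with hB
    set Bφ := pathHeat (jumpPath n J) φ p with hBφ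
    have hBb : ∀ r, |B r| ≤ M := fun r => abs_pathHeat_le _ b2 _ _
    have hBm : Measurable B := measurable_pathHeat (fun ω => measurable_jumpPath ω) hG p
    have hBi : ∀ a b, IntervalIntegrable B volume a b := fun a b =>
      (intervalIntegrable_const (c := M)).mono_fun hBm.aestronglyMeasurable
        (Filter.Eventually.of_forall fun r => by
          simpa using (hBb r).trans (le_abs_self M))
    have hle : (1 : ℝ) / n ≤ 2 := (div_le_one hn').2 hn1 |>.trans (by norm_num)
    rw [← integral_Ioc_eq_integral_Ioo, ← intervalIntegral.integral_of_le hle,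
      ← intervalIntegral.integral_interval_sub_left (hBi 0 2) (hBi 0 (1 / n))]
    have hsum := intervalIntegral.sum_integral_adjacent_intervals (f := B) (μ := volume)
      (a := fun k : ℕ => (k : ℝ) / n) (n := 2 * n) (fun k _ => hBi _ _)
    have htel := Finset.sum_range_sub (fun k : ℕ => Bφ ((k : ℝ) / n)) (2 * n)
    have e2 : ((2 * n : ℕ) : ℝ) / n = 2 := by push_cast; field_simp
    have e0 : ((0 : ℕ) : ℝ) / n = 0 := by simp
    simp only [e2, e0] at hsum htel
    have hz0 : Bφ 0 = φ p := pathHeat_zero _ _ _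
    have hz2 : Bφ 2 = 0 := by
      have : ∀ q : ℝ × ℝ, φ (p.1 + 2, q) = 0 := fun q => hφ1 _ (by have := hp.1; simp only; linarith)
      simp [hBφ, pathHeat, this, heatE]
    have hterm : ∀ k ∈ Finset.range (2 * n), |(∫ r in ((k : ℝ) / n)..((k + 1 : ℕ) : ℝ) / n, B r) -
        (Bφ (((k + 1 : ℕ) : ℝ) / n) - Bφ ((k : ℝ) / n))| ≤ (C1 + C2) * (1 / n * √(1 / n)) := by
      intro k hk
      have hk2 : (k : ℝ) / n < 2 := by
        rw [div_lt_iff₀ hn']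
        exact_mod_cast Finset.mem_range.1 hk
      have hk0 : 0 ≤ (k : ℝ) / n := by positivity
      have hk1 : ((k + 1 : ℕ) : ℝ) / n = k / n + 1 / n := by push_cast; rw [add_div]
      have hs1 : -1 ≤ p.1 + (k : ℝ) / n := by have := hp.1; linarith
      have hs2 : p.1 + (k : ℝ) / n < 3 := by have := hp.2; linarith
      have t1 := hC1 n hn p (k / n) hk0 hs1 hs2
      have t2 : |∫ r in ((k : ℝ) / n)..(k / n + 1 / n), (B r - B (k / n))|
          ≤ C2 * √(1 / n) * |(k : ℝ) / n + 1 / n - k / n| := by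
        refine intervalIntegral.norm_integral_le_of_norm_le_const (E := ℝ) fun r hr => ?_
        rw [Set.uIoc_of_le (by linarith [one_div_pos.2 hn'])] at hr
        have := hC2 n hn p (k / n) hk0 hs1 hs2 (r - k / n) (by linarith [hr.1]) (by linarith [hr.2])
        rwa [add_sub_cancel] at this
      rw [intervalIntegral.integral_sub (hBi _ _) intervalIntegrable_const,
        intervalIntegral.integral_const, add_sub_cancel_left, abs_of_pos (one_div_pos.2 hn'),
        smul_eq_mul] at t2
      rw [hk1]
      rw [abs_le] at *
      constructor <;> nlinarith
    have hbig := (Finset.abs_sum_le_sum_abs (fun k : ℕ =>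
      (∫ r in ((k : ℝ) / n)..((k + 1 : ℕ) : ℝ) / n, B r) -
        (Bφ (((k + 1 : ℕ) : ℝ) / n) - Bφ ((k : ℝ) / n))) (Finset.range (2 * n))).trans
      (Finset.sum_le_sum hterm)
    rw [Finset.sum_sub_distrib, hsum, htel, hz0, hz2, Finset.sum_const, Finset.card_range,
      nsmul_eq_mul] at hbig
    have e3 : ((2 * n : ℕ) : ℝ) * ((C1 + C2) * (1 / n * √(1 / n))) = 2 * (C1 + C2) * √(1 / n) := by
      push_cast; field_simp
    rw [e3] at hbig
    have hsmall : |∫ r in (0 : ℝ)..1 / (n : ℝ), B r| ≤ M * |1 / (n : ℝ) - 0| :=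
      intervalIntegral.norm_integral_le_of_norm_le_const (E := ℝ) fun r _ => hBb r
    rw [sub_zero, abs_of_pos (one_div_pos.2 hn')] at hsmall
    rw [abs_le] at *
    constructor <;> linarith
  have hlim : Filter.Tendsto (fun n : ℕ => 2 * (C1 + C2) * √(1 / n) + M * (1 / n)) Filter.atTop
      (nhds 0) := by
    have t := tendsto_one_div_atTop_nhds_zero_nat (𝕜 := ℝ)
    have := ((Real.continuous_sqrt.tendsto 0).comp t).const_mul (2 * (C1 + C2))
    simpa using this.add (t.const_mul M)
  rw [tendsto_iff_dist_tendsto_zero]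
  refine squeeze_zero' (Filter.Eventually.of_forall fun _ => dist_nonneg) ?_ hlim
  filter_upwards [Filter.eventually_gt_atTop 0] with n hn
  rw [Real.dist_eq]
  exact hmain n hn

/-- The derivative of `F` in the direction `e`. -/
noncomputable def dird (e : ℝ × ℝ × ℝ) (F : ℝ × ℝ × ℝ → ℝ) (p : ℝ × ℝ × ℝ) : ℝ := fderiv ℝ F p e

section dird

variable {F : ℝ × ℝ × ℝ → ℝ}

lemma contDiff_dird (hF : ContDiff ℝ (⊤ : ℕ∞) F) (e : ℝ × ℝ × ℝ) :
    ContDiff ℝ (⊤ : ℕ∞) (dird e F) :=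
  (hF.fderiv_right (m := (⊤ : ℕ∞)) (by simp)).clm_apply contDiff_const

lemma hasCompactSupport_dird (hF : HasCompactSupport F) (e : ℝ × ℝ × ℝ) :
    HasCompactSupport (dird e F) := hF.fderiv_apply (𝕜 := ℝ) e

lemma dird_dird (hF : ContDiff ℝ (⊤ : ℕ∞) F) (a b p : ℝ × ℝ × ℝ) :
    dird a (dird b F) p = fderiv ℝ (fderiv ℝ F) p a b := by
  have h : HasFDerivAt (fderiv ℝ F) (fderiv ℝ (fderiv ℝ F) p) p :=
    ((hF.fderiv_right (m := (⊤ : ℕ∞)) (by simp)).differentiable (by simp) p).hasFDerivAt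
  have := (h.clm_apply (hasFDerivAt_const b p)).fderiv
  unfold dird
  rw [this]; simp

lemma dird_comm (hF : ContDiff ℝ (⊤ : ℕ∞) F) (a b : ℝ × ℝ × ℝ) :
    dird a (dird b F) = dird b (dird a F) := by
  ext p
  rw [dird_dird hF, dird_dird hF]
  exact (hF.contDiffAt.isSymmSndFDerivAt
    (by simpa using WithTop.coe_le_coe.2 (le_top : (2 : ℕ∞) ≤ ⊤))) a b

lemma hasDerivAt_dird (hF : ContDiff ℝ (⊤ : ℕ∞) F) (p : ℝ × ℝ × ℝ) :
    HasDerivAt (fun a => F (p.1, a, p.2.2)) (dird (0, 1, 0) F p) p.2.1 := by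
  have h := (hF.differentiable (by simp) p).hasFDerivAt
  have c : HasDerivAt (fun a : ℝ => (p.1, a, p.2.2)) (0, 1, 0) p.2.1 :=
    (hasDerivAt_const _ _).prodMk ((hasDerivAt_id _).prodMk (hasDerivAt_const _ _))
  exact h.comp_hasDerivAt (x := p.2.1) c

end dird

/-- The backward Kolmogorov operator in the coordinates following the drift. -/
noncomputable def opL (v : ℝ × ℝ × ℝ → ℝ) (p : ℝ × ℝ × ℝ) : ℝ :=
  dird (1, 0, 0) v p + (1 + Real.exp p.1) * dird (0, 1, 0) (dird (0, 1, 0) v) p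
    + (p.1 * Real.exp (-p.1)) * dird (0, 1, 0) (dird (0, 0, 1) v) p
    + (p.1 * Real.exp (-p.1)) ^ 2 * dird (0, 0, 1) (dird (0, 0, 1) v) p

section opL

variable {v : ℝ × ℝ × ℝ → ℝ}

lemma contDiff_opL (hv : ContDiff ℝ (⊤ : ℕ∞) v) : ContDiff ℝ (⊤ : ℕ∞) (opL v) := by
  have h1 := contDiff_dird hv (1, 0, 0)
  have h2 := contDiff_dird (contDiff_dird hv (0, 1, 0)) (0, 1, 0)
  have h3 := contDiff_dird (contDiff_dird hv (0, 0, 1)) (0, 1, 0)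
  have h4 := contDiff_dird (contDiff_dird hv (0, 0, 1)) (0, 0, 1)
  unfold opL
  fun_prop

lemma hasCompactSupport_opL (hv : HasCompactSupport v) : HasCompactSupport (opL v) :=
  (((hasCompactSupport_dird hv _).add
    (hasCompactSupport_dird (hasCompactSupport_dird hv _) _).mul_left).add
    (hasCompactSupport_dird (hasCompactSupport_dird hv _) _).mul_left).add
    (hasCompactSupport_dird (hasCompactSupport_dird hv _) _).mul_left

lemma hasDerivAt_opL (hv : ContDiff ℝ (⊤ : ℕ∞) v) (p : ℝ × ℝ × ℝ) :
    HasDerivAt (fun a => opL v (p.1, a, p.2.2)) (opL (dird (0, 1, 0) v) p) p.2.1 := by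
  have h1 := hasDerivAt_dird (contDiff_dird hv (1, 0, 0)) p
  have h2 := hasDerivAt_dird (contDiff_dird (contDiff_dird hv (0, 1, 0)) (0, 1, 0)) p
  have h3 := hasDerivAt_dird (contDiff_dird (contDiff_dird hv (0, 0, 1)) (0, 1, 0)) p
  have h4 := hasDerivAt_dird (contDiff_dird (contDiff_dird hv (0, 0, 1)) (0, 0, 1)) p
  have h := ((h1.add (h2.const_mul (1 + Real.exp p.1))).add
    (h3.const_mul (p.1 * Real.exp (-p.1)))).add (h4.const_mul ((p.1 * Real.exp (-p.1)) ^ 2))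
  refine h.congr_deriv ?_
  unfold opL
  rw [dird_comm hv (0, 1, 0) (1, 0, 0), dird_comm hv (0, 0, 1) (0, 1, 0),
    dird_comm (contDiff_dird hv (0, 0, 1)) (0, 1, 0) (0, 0, 1), dird_comm hv (0, 1, 0) (0, 0, 1)]

end opL

/-- The four jumps realising the part of the diffusion orthogonal to the heat flow. -/
noncomputable def ouJump (t : ℝ) : Fin 4 → ℝ × ℝ :=
  ![(1, 2 * (t * Real.exp (-t))), -(1, 2 * (t * Real.exp (-t))),
    (2 * √(Real.exp t - 1 / 4), 0), -(2 * √(Real.exp t - 1 / 4), 0)]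

lemma sum_ouJump (t : ℝ) : ∑ c, ouJump t c = 0 := by
  simp [ouJump, Fin.sum_univ_four]

lemma exists_ouJump_bound : ∃ R, 0 ≤ R ∧ ∀ τ ∈ Set.Icc (-1 : ℝ) 4, ∀ c, ‖ouJump τ c‖ ≤ R := by
  have h : ∀ c, ∃ R, ∀ τ ∈ Set.Icc (-1 : ℝ) 4, ‖ouJump τ c‖ ≤ R := by
    intro c
    refine isCompact_Icc.exists_bound_of_continuousOn (Continuous.continuousOn ?_)
    fin_cases c <;> simp only [ouJump] <;> simp <;> constructor <;> fun_prop
  choose R hR using h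
  refine ⟨∑ c, |R c|, by positivity, fun τ hτ c => (hR c τ hτ).trans ((le_abs_self _).trans ?_)⟩
  exact Finset.single_le_sum (f := fun c => |R c|) (fun c _ => abs_nonneg _) (Finset.mem_univ c)

lemma sum_ouJump_quadratic {τ : ℝ} (hτ : -1 ≤ τ)
    (B : (ℝ × ℝ × ℝ) →L[ℝ] (ℝ × ℝ × ℝ) →L[ℝ] ℝ) (hB : B (0, 0, 1) (0, 1, 0) = B (0, 1, 0) (0, 0, 1)) :
    1 / 8 * ∑ c, B (0, ouJump τ c) (0, ouJump τ c) = Real.exp τ * B (0, 1, 0) (0, 1, 0)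
      + (τ * Real.exp (-τ)) * B (0, 1, 0) (0, 0, 1)
      + (τ * Real.exp (-τ)) ^ 2 * B (0, 0, 1) (0, 0, 1) := by
  have he : 1 / 4 ≤ Real.exp τ := by
    have h1 : Real.exp (-1) ≤ Real.exp τ := Real.exp_le_exp.2 hτ
    have h2 : 1 / 4 ≤ Real.exp (-1) := by
      rw [Real.exp_neg, ← one_div]
      exact one_div_le_one_div_of_le (Real.exp_pos _) (by linarith [Real.exp_one_lt_d9])
    linarith
  have key : ∀ a b : ℝ, B (0, a, b) (0, a, b) = a ^ 2 * B (0, 1, 0) (0, 1, 0)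
      + 2 * a * b * B (0, 1, 0) (0, 0, 1) + b ^ 2 * B (0, 0, 1) (0, 0, 1) := by
    intro a b
    have : ((0, a, b) : ℝ × ℝ × ℝ) = a • (0, 1, 0) + b • (0, 0, 1) := by simp
    rw [this]
    simp only [map_add, map_smul, add_apply, smul_apply, smul_eq_mul, hB]
    ring
  have hs := Real.sq_sqrt (sub_nonneg.2 he)
  simp only [Fin.sum_univ_four, ouJump, Matrix.cons_val_zero, Matrix.cons_val_one,
    Matrix.cons_val, Prod.neg_mk, neg_zero]
  rw [key 1 (2 * (τ * Real.exp (-τ))), key (-1) (-(2 * (τ * Real.exp (-τ)))),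
    key (2 * √(Real.exp τ - 1 / 4)) 0, key (-(2 * √(Real.exp τ - 1 / 4))) 0]
  linear_combination B (0, 1, 0) (0, 1, 0) * hs

lemma exists_opL_defect {φ : ℝ × ℝ × ℝ → ℝ} (hφ : ContDiff ℝ (⊤ : ℕ∞) φ)
    (hc : HasCompactSupport φ) : ∃ L, 0 ≤ L ∧
    ∀ p : ℝ × ℝ × ℝ, p.1 ∈ Set.Icc (-1 : ℝ) 3 → ∀ τ ∈ Set.Icc (-1 : ℝ) 4,
      |fderiv ℝ φ p (1, 0, 0) + fderiv ℝ (fderiv ℝ φ) p (0, 1, 0) (0, 1, 0)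
        + 1 / 8 * ∑ c, fderiv ℝ (fderiv ℝ φ) p (0, ouJump τ c) (0, ouJump τ c) - opL φ p|
        ≤ L * |τ - p.1| := by
  have hlip : ∀ a : ℝ → ℝ, ContDiff ℝ 1 a → ∃ L, 0 ≤ L ∧ ∀ t ∈ Set.Icc (-1 : ℝ) 4,
      ∀ τ ∈ Set.Icc (-1 : ℝ) 4, |a τ - a t| ≤ L * |τ - t| := by
    intro a ha
    obtain ⟨K, hK⟩ := ha.contDiffOn.exists_lipschitzOnWith (s := Set.Icc (-1 : ℝ) 4) one_ne_zero
      (convex_Icc _ _) isCompact_Icc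
    refine ⟨K, K.2, fun t ht τ hτ => ?_⟩
    simpa [Real.dist_eq] using hK.dist_le_mul τ hτ t ht
  obtain ⟨L1, hL10, hL1⟩ := hlip Real.exp Real.contDiff_exp
  obtain ⟨L2, hL20, hL2⟩ := hlip (fun t => t * Real.exp (-t)) (by fun_prop)
  obtain ⟨L3, hL30, hL3⟩ := hlip (fun t => (t * Real.exp (-t)) ^ 2) (by fun_prop)
  have hbd : ∀ a b : ℝ × ℝ × ℝ, ∃ C, 0 ≤ C ∧ ∀ p, |dird a (dird b φ) p| ≤ C := fun a b =>
    exists_bound_of_hasCompactSupport (contDiff_dird (contDiff_dird hφ b) a).continuous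
      (hasCompactSupport_dird (hasCompactSupport_dird hc b) a)
  obtain ⟨B1, hB10, hB1⟩ := hbd (0, 1, 0) (0, 1, 0)
  obtain ⟨B2, hB20, hB2⟩ := hbd (0, 1, 0) (0, 0, 1)
  obtain ⟨B3, hB30, hB3⟩ := hbd (0, 0, 1) (0, 0, 1)
  refine ⟨L1 * B1 + L2 * B2 + L3 * B3, by positivity, fun p hp τ hτ => ?_⟩
  have hp' : p.1 ∈ Set.Icc (-1 : ℝ) 4 := ⟨hp.1, hp.2.trans (by norm_num)⟩
  have hsym := congrFun (dird_comm hφ (0, 0, 1) (0, 1, 0)) p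
  rw [dird_dird hφ, dird_dird hφ] at hsym
  rw [sum_ouJump_quadratic hτ.1 _ hsym, ← dird_dird hφ, ← dird_dird hφ, ← dird_dird hφ]
  have e : fderiv ℝ φ p (1, 0, 0) + dird (0, 1, 0) (dird (0, 1, 0) φ) p
      + (Real.exp τ * dird (0, 1, 0) (dird (0, 1, 0) φ) p
        + τ * Real.exp (-τ) * dird (0, 1, 0) (dird (0, 0, 1) φ) p
        + (τ * Real.exp (-τ)) ^ 2 * dird (0, 0, 1) (dird (0, 0, 1) φ) p) - opL φ p
      = (Real.exp τ - Real.exp p.1) * dird (0, 1, 0) (dird (0, 1, 0) φ) p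
        + (τ * Real.exp (-τ) - p.1 * Real.exp (-p.1)) * dird (0, 1, 0) (dird (0, 0, 1) φ) p
        + ((τ * Real.exp (-τ)) ^ 2 - (p.1 * Real.exp (-p.1)) ^ 2)
          * dird (0, 0, 1) (dird (0, 0, 1) φ) p := by
    unfold opL; rw [show fderiv ℝ φ p (1, 0, 0) = dird (1, 0, 0) φ p from rfl]; ring
  rw [e]
  refine (abs_add_three _ _ _).trans ?_
  rw [abs_mul, abs_mul, abs_mul]
  have k1 := mul_le_mul (hL1 p.1 hp' τ hτ) (hB1 p) (abs_nonneg _) (by positivity)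
  have k2 := mul_le_mul (hL2 p.1 hp' τ hτ) (hB2 p) (abs_nonneg _) (by positivity)
  have k3 := mul_le_mul (hL3 p.1 hp' τ hτ) (hB3 p) (abs_nonneg _) (by positivity)
  linarith

/-- The a priori estimate in the coordinates following the drift. -/
theorem exists_eLpNorm_dird_le_opL (P : ℝ) (hP : 1 < P) : ∃ C : ℝ, 0 ≤ C ∧
    ∀ v : ℝ × ℝ × ℝ → ℝ, ContDiff ℝ (⊤ : ℕ∞) v → HasCompactSupport v →
      tsupport v ⊆ Set.Ioo (-1 : ℝ) 1 ×ˢ (Set.univ : Set (ℝ × ℝ)) →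
      eLpNorm (dird (0, 1, 0) (dird (0, 1, 0) v)) (ENNReal.ofReal P) volume
        ≤ ENNReal.ofReal C * eLpNorm (opL v) (ENNReal.ofReal P) volume := by
  obtain ⟨C, hC0, hC⟩ := IsCZKernel.exists_bound hP (A := 20000000 * Real.pi) (by positivity)
  obtain ⟨R, hR0, hR⟩ := exists_ouJump_bound
  refine ⟨C ^ P⁻¹, by positivity, fun v hv hc hs => ?_⟩
  set X : (ℝ × ℝ × ℝ → ℝ) → ℝ × ℝ × ℝ → ℝ := dird (0, 1, 0) with hX
  have hv1 : ContDiff ℝ (⊤ : ℕ∞) (X v) := contDiff_dird hv _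
  have hv2 : ContDiff ℝ (⊤ : ℕ∞) (X (X v)) := contDiff_dird hv1 _
  have hc1 : HasCompactSupport (X v) := hasCompactSupport_dird hc _
  have hc2 : HasCompactSupport (X (X v)) := hasCompactSupport_dird hc1 _
  have hsub : ∀ F : ℝ × ℝ × ℝ → ℝ, tsupport (X F) ⊆ tsupport F := fun F =>
    closure_minimal ((Function.support_subset_iff'.2 fun p hp => by
      have : fderiv ℝ F p = 0 := by
        by_contra h
        exact hp (support_fderiv_subset ℝ h)
      simp [hX, dird, this])) (isClosed_tsupport F)
  have hz : ∀ p : ℝ × ℝ × ℝ, p.1 ∉ Set.Ioo (-1 : ℝ) 1 → X (X v) p = 0 := by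
    intro p hp
    by_contra h
    exact hp (hs (hsub _ (hsub _ (subset_tsupport _ h)))).1
  obtain ⟨L, hL0, hL⟩ := exists_opL_defect hv2 hc2
  have hg := contDiff_opL hv
  have hgc := hasCompactSupport_opL hc
  have hG := contDiff_opL hv2
  have hGc := hasCompactSupport_opL hc2
  obtain ⟨M0, hM00, hM0⟩ := exists_bound_of_hasCompactSupport hg.continuous hgc
  obtain ⟨M1, hM10, hM1⟩ := exists_bound_of_hasCompactSupport (contDiff_opL hv1).continuous
    (hasCompactSupport_opL hc1)
  obtain ⟨M2, hM20, hM2⟩ := exists_bound_of_hasCompactSupport hG.continuous hGc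
  obtain ⟨L', hL'0, hL'⟩ := exists_lipschitz_of_hasCompactSupport (hG.of_le (by simp)) hGc
  have hlim : ∀ p : ℝ × ℝ × ℝ, p.1 ∈ Set.Ioo (-1 : ℝ) 1 → Filter.Tendsto
      (fun n : ℕ => avgOp (heatK (1 / n) 2) (jumpPath n ouJump) (opL v) p) Filter.atTop
      (nhds (-X (X v) p)) := fun p hp =>
    tendsto_avgOp_heatK (M := M0 + M1 + M2) hR0 hR sum_ouJump hv2 hc2
      (fun p hp => hz p fun h => by linarith [h.2]) hg.continuous.measurable
      hG.continuous.measurable (hasDerivAt_opL hv) (hasDerivAt_opL hv1)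
      (fun p => (hM0 p).trans (by linarith)) (fun p => (hM1 p).trans (by linarith))
      (fun p => (hM2 p).trans (by linarith)) hL0 hL hL'0 hL' hp
  have hgi : Integrable (opL v) := hg.continuous.integrable_of_hasCompactSupport hgc
  set S : Set (ℝ × ℝ × ℝ) := Set.Ioo (-1 : ℝ) 1 ×ˢ Set.univ with hS
  have hSm : MeasurableSet S := measurableSet_Ioo.prod MeasurableSet.univ
  set T : ℕ → ℝ × ℝ × ℝ → ℝ := fun n =>
    avgOp (heatK (1 / (n + 1 : ℕ)) 2) (jumpPath (n + 1) ouJump) (opL v) with hT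
  have hTm : ∀ n, Measurable (T n) := fun n =>
    measurable_avgOp (measurable_heatK _ _) (fun ω => measurable_jumpPath ω) hg.continuous.measurable
  have hTb : ∀ n, eLpNorm (T n) (ENNReal.ofReal P) volume
      ≤ ENNReal.ofReal (C ^ P⁻¹) * eLpNorm (opL v) (ENNReal.ofReal P) volume := by
    intro n
    have h1 : (1 : ℝ) ≤ (n + 1 : ℕ) := by exact_mod_cast Nat.le_add_left 1 n
    refine eLpNorm_avgOp_le hP hC0 (measurable_heatK _ _) (fun f hf hfi hfb => ?_)
      (fun ω => measurable_jumpPath ω) hg.continuous.measurable hgi ⟨M0, hM0⟩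
    refine hC _ (isCZKernel_heatK (by positivity) ?_) f hf hfi hfb
    exact ((div_le_one (by linarith)).2 h1).trans (by norm_num)
  have hfat := Lp.eLpNorm_lim_le_liminf_eLpNorm (p := ENNReal.ofReal P) (μ := volume)
    (f := fun n => S.indicator (T n)) (fun n => ((hTm n).indicator hSm).aestronglyMeasurable)
    (-X (X v)) (Filter.Eventually.of_forall fun p => ?_)
  · rw [eLpNorm_neg] at hfat
    refine hfat.trans ?_
    refine (Filter.liminf_le_liminf (Filter.Eventually.of_forall fun n =>
      (eLpNorm_indicator_le _).trans (hTb n))).trans ?_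
    simp
  · by_cases hp : p ∈ S
    · simp only [Set.indicator_of_mem hp]
      exact (hlim p hp.1).comp (Filter.tendsto_add_atTop_nat 1)
    · simp only [Set.indicator_of_notMem hp, Pi.neg_apply]
      rw [hz p fun h => hp ⟨h, trivial⟩, neg_zero]
      exact tendsto_const_nhds

/-- The flow of the drift `y ∂_y`. -/
noncomputable def driftFlow (p : ℝ × ℝ × ℝ) : ℝ × ℝ × ℝ := (p.1, p.2.1, Real.exp p.1 * p.2.2)

lemma contDiff_driftFlow : ContDiff ℝ (⊤ : ℕ∞) driftFlow := by
  unfold driftFlow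
  fun_prop

lemma hasCompactSupport_comp_driftFlow {u : ℝ × ℝ × ℝ → ℝ} (hc : HasCompactSupport u) :
    HasCompactSupport (fun p => u (driftFlow p)) := by
  have hcont : Continuous (fun q : ℝ × ℝ × ℝ => (q.1, q.2.1, Real.exp (-q.1) * q.2.2)) := by
    fun_prop
  refine HasCompactSupport.intro (hc.isCompact.image hcont) fun p hp => ?_
  by_contra h
  refine hp ⟨driftFlow p, subset_tsupport _ h, ?_⟩
  ext <;> simp [driftFlow, ← mul_assoc, ← Real.exp_add]

lemma tsupport_comp_driftFlow {u : ℝ × ℝ × ℝ → ℝ}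
    (hu : tsupport u ⊆ Set.Ioo (-1 : ℝ) 1 ×ˢ (Set.univ : Set (ℝ × ℝ))) :
    tsupport (fun p => u (driftFlow p)) ⊆ Set.Ioo (-1 : ℝ) 1 ×ˢ (Set.univ : Set (ℝ × ℝ)) := by
  intro p hp
  exact ⟨(hu (tsupport_comp_subset_preimage u contDiff_driftFlow.continuous hp)).1, trivial⟩

lemma lintegral_comp_driftFlow {G : ℝ × ℝ × ℝ → ℝ≥0∞} (hG : Measurable G) :
    ∫⁻ p, G (driftFlow p) = ∫⁻ p, ENNReal.ofReal (Real.exp (-p.1)) * G p := by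
  have hm : Measurable driftFlow := contDiff_driftFlow.continuous.measurable
  have hw : Measurable fun p : ℝ × ℝ × ℝ => ENNReal.ofReal (Real.exp (-p.1)) * G p := by
    fun_prop
  rw [Measure.volume_eq_prod, lintegral_prod (fun p => G (driftFlow p)) (hG.comp hm).aemeasurable,
    lintegral_prod _ hw.aemeasurable]
  refine lintegral_congr fun t => ?_
  rw [Measure.volume_eq_prod, lintegral_prod (fun q : ℝ × ℝ => G (driftFlow (t, q)))
      ((hG.comp hm).comp measurable_prodMk_left).aemeasurable,
    lintegral_prod (fun q : ℝ × ℝ => ENNReal.ofReal (Real.exp (-t)) * G (t, q))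
      (hw.comp measurable_prodMk_left).aemeasurable]
  refine lintegral_congr fun x => ?_
  have hg : Measurable fun y => G (t, x, y) := by fun_prop
  simp only [driftFlow]
  rw [lintegral_const_mul _ hg,
    ← lintegral_map (f := fun y => G (t, x, y)) (g := fun y => Real.exp t * y) hg
      (measurable_const_mul _),
    Real.map_volume_mul_left (Real.exp_pos t).ne', lintegral_smul_measure, ← Real.exp_neg,
    abs_of_pos (Real.exp_pos _), smul_eq_mul]

/-- Composition with the flow distorts `L^p` norms by a bounded factor on a slab of times. -/
lemma eLpNorm_driftFlow {P : ℝ} (hP : 1 < P) {F : ℝ × ℝ × ℝ → ℝ} (hF : Continuous F)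
    (h0 : ∀ p : ℝ × ℝ × ℝ, p.1 ∉ Set.Ioo (-1 : ℝ) 1 → F p = 0) :
    eLpNorm (fun p => F (driftFlow p)) (ENNReal.ofReal P) volume
        ≤ ENNReal.ofReal (Real.exp 1) * eLpNorm F (ENNReal.ofReal P) volume ∧
      eLpNorm F (ENNReal.ofReal P) volume
        ≤ ENNReal.ofReal (Real.exp 1) *
          eLpNorm (fun p => F (driftFlow p)) (ENNReal.ofReal P) volume := by
  have hP0 : 0 < P := by linarith
  have hroot : ∀ a b : ℝ≥0∞, a ^ P ≤ ENNReal.ofReal (Real.exp 1) * b ^ P →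
      a ≤ ENNReal.ofReal (Real.exp 1) * b := by
    intro a b h
    have h1 : 1 ≤ ENNReal.ofReal (Real.exp 1) :=
      ENNReal.one_le_ofReal.2 (Real.one_le_exp zero_le_one)
    rw [← ENNReal.rpow_le_rpow_iff hP0, ENNReal.mul_rpow_of_nonneg _ _ hP0.le]
    refine h.trans (mul_le_mul_left ?_ _)
    simpa using ENNReal.rpow_le_rpow_of_exponent_le h1 hP.le
  have hmeas : Measurable fun p => ‖F p‖ₑ ^ P := by
    have := hF.measurable
    fun_prop
  have key := lintegral_comp_driftFlow hmeas
  constructor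
  all_goals
    apply hroot
    rw [eLpNorm_ofReal_rpow hP0, eLpNorm_ofReal_rpow hP0, key,
      ← lintegral_const_mul _ (by fun_prop)]
    refine lintegral_mono fun p => ?_
    by_cases hp : p.1 ∈ Set.Ioo (-1 : ℝ) 1
    swap
    · simp [h0 p hp, hP0]
  · exact mul_le_mul_left (ENNReal.ofReal_le_ofReal (Real.exp_le_exp.2 (by linarith [hp.1]))) _
  · rw [← mul_assoc, ← ENNReal.ofReal_mul (Real.exp_pos _).le, ← Real.exp_add]
    refine le_mul_of_one_le_left' (ENNReal.one_le_ofReal.2 (Real.one_le_exp ?_))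
    linarith [hp.2]

section chain

variable {u : ℝ × ℝ × ℝ → ℝ}

lemma dird_driftFlow (hu : ContDiff ℝ (⊤ : ℕ∞) u) (e p : ℝ × ℝ × ℝ) :
    dird e (fun q => u (driftFlow q)) p = dird (e.1, e.2.1,
      Real.exp p.1 * e.2.2 + e.1 * (Real.exp p.1 * p.2.2)) u (driftFlow p) := by
  have hl : HasDerivAt (fun s : ℝ => p + s • e) e 0 := by
    simpa using ((hasDerivAt_id (0 : ℝ)).smul_const e).const_add p
  have hv : HasDerivAt (fun s : ℝ => u (driftFlow (p + s • e)))
      (dird e (fun q => u (driftFlow q)) p) 0 :=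
    HasFDerivAt.comp_hasDerivAt (x := (0 : ℝ)) (f := fun s : ℝ => p + s • e)
      (l := fun q => u (driftFlow q)) (by
        simpa using! ((hu.comp contDiff_driftFlow).differentiable (by simp) p).hasFDerivAt) hl
  have h1 : HasDerivAt (fun s : ℝ => p.1 + s * e.1) e.1 0 := by
    simpa using ((hasDerivAt_id (0 : ℝ)).mul_const e.1).const_add p.1
  have h2 : HasDerivAt (fun s : ℝ => p.2.1 + s * e.2.1) e.2.1 0 := by
    simpa using ((hasDerivAt_id (0 : ℝ)).mul_const e.2.1).const_add p.2.1
  have h3 : HasDerivAt (fun s : ℝ => p.2.2 + s * e.2.2) e.2.2 0 := by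
    simpa using ((hasDerivAt_id (0 : ℝ)).mul_const e.2.2).const_add p.2.2
  have hf : HasDerivAt (fun s : ℝ => driftFlow (p + s • e)) (e.1, e.2.1,
      Real.exp p.1 * e.2.2 + e.1 * (Real.exp p.1 * p.2.2)) 0 := by
    refine h1.prodMk (h2.prodMk ((h1.exp.mul h3).congr_deriv ?_))
    simp only [zero_mul, add_zero]
    ring
  have hw : HasDerivAt (fun s : ℝ => u (driftFlow (p + s • e))) _ 0 :=
    HasFDerivAt.comp_hasDerivAt (x := (0 : ℝ)) (f := fun s : ℝ => driftFlow (p + s • e))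
      (l := u) (by simpa using (hu.differentiable (by simp) (driftFlow p)).hasFDerivAt) hf
  exact hv.unique hw

lemma pt3_eq_dird (hu : ContDiff ℝ (⊤ : ℕ∞) u) : pt3 u = dird (1, 0, 0) u := by
  ext p
  have c : HasDerivAt (fun a : ℝ => (a, p.2.1, p.2.2)) (1, 0, 0) p.1 :=
    (hasDerivAt_id _).prodMk ((hasDerivAt_const _ _).prodMk (hasDerivAt_const _ _))
  exact ((hu.differentiable (by simp) p).hasFDerivAt.comp_hasDerivAt (x := p.1) c).deriv

lemma px3_eq_dird (hu : ContDiff ℝ (⊤ : ℕ∞) u) : px3 u = dird (0, 1, 0) u := by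
  ext p
  exact (hasDerivAt_dird hu p).deriv

lemma py3_eq_dird (hu : ContDiff ℝ (⊤ : ℕ∞) u) : py3 u = dird (0, 0, 1) u := by
  ext p
  have c : HasDerivAt (fun a : ℝ => (p.1, p.2.1, a)) (0, 0, 1) p.2.2 :=
    (hasDerivAt_const _ _).prodMk ((hasDerivAt_const _ _).prodMk (hasDerivAt_id _))
  exact ((hu.differentiable (by simp) p).hasFDerivAt.comp_hasDerivAt (x := p.2.2) c).deriv

lemma dird_x_driftFlow (hu : ContDiff ℝ (⊤ : ℕ∞) u) :
    dird (0, 1, 0) (fun q => u (driftFlow q)) = fun q => dird (0, 1, 0) u (driftFlow q) := by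
  ext p
  simp [dird_driftFlow hu]

lemma dird_smul_add (a : ℝ) (d e p : ℝ × ℝ × ℝ) :
    dird (a • d + e) u p = a * dird d u p + dird e u p := by
  simp [dird]

lemma dird_t_driftFlow (hu : ContDiff ℝ (⊤ : ℕ∞) u) (p : ℝ × ℝ × ℝ) :
    dird (1, 0, 0) (fun q => u (driftFlow q)) p
      = dird (1, 0, 0) u (driftFlow p) + Real.exp p.1 * p.2.2 * dird (0, 0, 1) u (driftFlow p) := by
  rw [add_comm, ← dird_smul_add, dird_driftFlow hu]
  simp

lemma dird_y_driftFlow (hu : ContDiff ℝ (⊤ : ℕ∞) u) (p : ℝ × ℝ × ℝ) :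
    dird (0, 0, 1) (fun q => u (driftFlow q)) p
      = Real.exp p.1 * dird (0, 0, 1) u (driftFlow p) := by
  have h := dird_smul_add (u := u) (Real.exp p.1) (0, 0, 1) 0 (driftFlow p)
  rw [dird_driftFlow hu]
  simpa [dird] using h

lemma dird_exp_mul (hu : ContDiff ℝ (⊤ : ℕ∞) u) (e p : ℝ × ℝ × ℝ) (he : e.1 = 0) :
    dird e (fun q => Real.exp q.1 * u q) p = Real.exp p.1 * dird e u p := by
  have h1 : HasFDerivAt (fun q : ℝ × ℝ × ℝ => Real.exp q.1) _ p :=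
    (hasFDerivAt_fst (𝕜 := ℝ) (p := p)).exp
  have h : fderiv ℝ (fun q => Real.exp q.1 * u q) p = _ :=
    (h1.mul (hu.differentiable (by simp) p).hasFDerivAt).fderiv
  unfold dird
  rw [h]
  simp [he]

lemma opL_driftFlow (hu : ContDiff ℝ (⊤ : ℕ∞) u) (p : ℝ × ℝ × ℝ) :
    opL (fun q => u (driftFlow q)) p = pt3 u (driftFlow p)
      + (1 + Real.exp (driftFlow p).1) * px3 (px3 u) (driftFlow p)
      + (driftFlow p).1 * px3 (py3 u) (driftFlow p)
      + (driftFlow p).1 ^ 2 * py3 (py3 u) (driftFlow p)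
      + (driftFlow p).2.2 * py3 u (driftFlow p) := by
  have hx := contDiff_dird hu (0, 1, 0)
  have hy := contDiff_dird hu (0, 0, 1)
  have hv : ContDiff ℝ (⊤ : ℕ∞) fun q => dird (0, 0, 1) u (driftFlow q) :=
    hy.comp contDiff_driftFlow
  have hexp : Real.exp (-p.1) * Real.exp p.1 = 1 := by rw [← Real.exp_add]; simp
  rw [pt3_eq_dird hu, px3_eq_dird hu, py3_eq_dird hu, px3_eq_dird hx, px3_eq_dird hy,
    py3_eq_dird hy]
  unfold opL
  rw [dird_t_driftFlow hu, dird_x_driftFlow hu, dird_x_driftFlow hx,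
    funext (dird_y_driftFlow hu), dird_exp_mul hv _ _ rfl, dird_exp_mul hv _ _ rfl,
    dird_x_driftFlow hy, dird_y_driftFlow hy]
  simp only [driftFlow]
  linear_combination (p.1 * dird (0, 1, 0) (dird (0, 0, 1) u) (p.1, p.2.1, Real.exp p.1 * p.2.2)
    + p.1 ^ 2 * (Real.exp (-p.1) * Real.exp p.1 + 1)
      * dird (0, 0, 1) (dird (0, 0, 1) u) (p.1, p.2.1, Real.exp p.1 * p.2.2)) * hexp

lemma dird_of_notMem_tsupport {e p : ℝ × ℝ × ℝ} (hp : p ∉ tsupport u) : dird e u p = 0 :=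
  image_eq_zero_of_notMem_tsupport fun h => hp (tsupport_fderiv_apply_subset ℝ e h)

lemma tsupport_dird_subset (e : ℝ × ℝ × ℝ) : tsupport (dird e u) ⊆ tsupport u :=
  tsupport_fderiv_apply_subset ℝ e

end chain

/-- Example of Ornstein–Uhlenbeck type:
`u_t + (1+eᵗ) u_{xx} + t u_{xy} + t² u_{yy} + y u_y = f`.
For `1 < p < ∞` there is `C > 0` such that every smooth `u` with compact support
contained in `(-1,1) × ℝ²` solving
`∂ₜ u + (1+eᵗ) ∂²_{xx} u + t ∂²_{xy} u + t² ∂²_{yy} u + y ∂_y u = f` on `ℝ³` satisfies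
`‖∂²_{xx} u‖_{L^p(ℝ³)} ≤ C ‖f‖_{L^p(ℝ³)}`. -/
theorem example_ou_equation (p : ℝ) (hp : 1 < p) :
    ∃ C : ℝ, 0 < C ∧
      ∀ u f : ℝ × ℝ × ℝ → ℝ,
        ContDiff ℝ (⊤ : ℕ∞) u → HasCompactSupport u →
        tsupport u ⊆ Set.Ioo (-1 : ℝ) 1 ×ˢ (Set.univ : Set (ℝ × ℝ)) →
        (∀ z : ℝ × ℝ × ℝ,
          pt3 u z + (1 + Real.exp z.1) * px3 (px3 u) z + z.1 * px3 (py3 u) z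
            + z.1 ^ 2 * py3 (py3 u) z + z.2.2 * py3 u z = f z) →
        eLpNorm (px3 (px3 u)) (ENNReal.ofReal p) volume
          ≤ ENNReal.ofReal C * eLpNorm f (ENNReal.ofReal p) volume := by
  obtain ⟨C, hC0, hC⟩ := exists_eLpNorm_dird_le_opL p hp
  refine ⟨Real.exp 1 * (C * Real.exp 1) + 1, by positivity, fun u f hu hc hsupp heq => ?_⟩
  have hx := contDiff_dird hu (0, 1, 0)
  have hxx := contDiff_dird hx (0, 1, 0)
  have hy := contDiff_dird hu (0, 0, 1)
  have hv : ContDiff ℝ (⊤ : ℕ∞) fun q => u (driftFlow q) := hu.comp contDiff_driftFlow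
  have hnot : ∀ z : ℝ × ℝ × ℝ, z.1 ∉ Set.Ioo (-1 : ℝ) 1 → z ∉ tsupport u :=
    fun z hz h => hz (hsupp h).1
  have hd : ∀ e z : ℝ × ℝ × ℝ, z.1 ∉ Set.Ioo (-1 : ℝ) 1 → dird e u z = 0 :=
    fun e z hz => dird_of_notMem_tsupport (hnot z hz)
  have hdd : ∀ e e' z : ℝ × ℝ × ℝ, z.1 ∉ Set.Ioo (-1 : ℝ) 1 → dird e (dird e' u) z = 0 :=
    fun e e' z hz => dird_of_notMem_tsupport fun h => hnot z hz (tsupport_dird_subset e' h)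
  have hfL : (fun q => f (driftFlow q)) = opL fun q => u (driftFlow q) := by
    ext q
    rw [opL_driftFlow hu, heq]
  simp only [pt3_eq_dird hu, px3_eq_dird hu, py3_eq_dird hu, px3_eq_dird hx, px3_eq_dird hy,
    py3_eq_dird hy] at heq ⊢
  have hf0 : ∀ z : ℝ × ℝ × ℝ, z.1 ∉ Set.Ioo (-1 : ℝ) 1 → f z = 0 := by
    intro z hz
    rw [← heq]
    simp [hd _ z hz, hdd _ _ z hz]
  have hfc : Continuous f := by
    have h1 := (contDiff_dird hu (1, 0, 0)).continuous
    have h2 := hxx.continuous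
    have h3 := (contDiff_dird hy (0, 1, 0)).continuous
    have h4 := (contDiff_dird hy (0, 0, 1)).continuous
    have h5 := hy.continuous
    rw [← funext heq]
    fun_prop
  have h := hC _ hv (hasCompactSupport_comp_driftFlow hc) (tsupport_comp_driftFlow hsupp)
  rw [dird_x_driftFlow hu, dird_x_driftFlow hx, ← hfL] at h
  have hE : (0 : ℝ) ≤ Real.exp 1 := (Real.exp_pos 1).le
  calc eLpNorm (dird (0, 1, 0) (dird (0, 1, 0) u)) (ENNReal.ofReal p) volume
      ≤ ENNReal.ofReal (Real.exp 1) * (ENNReal.ofReal C *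
          (ENNReal.ofReal (Real.exp 1) * eLpNorm f (ENNReal.ofReal p) volume)) := by
        refine (eLpNorm_driftFlow hp hxx.continuous (hdd _ _)).2.trans ?_
        gcongr
        refine h.trans ?_
        gcongr
        exact (eLpNorm_driftFlow hp hfc hf0).1
    _ = ENNReal.ofReal (Real.exp 1 * (C * Real.exp 1)) * eLpNorm f (ENNReal.ofReal p) volume := by
        rw [ENNReal.ofReal_mul hE, ENNReal.ofReal_mul hC0, mul_assoc, mul_assoc]
    _ ≤ _ := by
        gcongr
        linarith
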